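/- Up to isomorphism, there are exactly 17004 trimedial quasigroups of order 243 that are not medial. -/

import Mathlib

/-- A quasigroup: a set with a binary operation whose left and right
translations are bijections. -/
structure Quasigroup (Q : Type) where
  mul : Q → Q → Q
  leftBij : ∀ x, Function.Bijective fun y => mul x y
  rightBij : ∀ x, Function.Bijective fun y => mul y x

namespace Quasigroup

/-- Mediality: (x*y)*(u*v) = (x*u)*(y*v). -/
def Medial {Q : Type} (q : Quasigroup Q) : Prop :=
  ∀ x y u v, q.mul (q.mul x y) (q.mul u v) = q.mul (q.mul x u) (q.mul y v)

/-- Distributivity: both left and right self-distributivity. -/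
def Distributive {Q : Type} (q : Quasigroup Q) : Prop :=
  (∀ x y z, q.mul x (q.mul y z) = q.mul (q.mul x y) (q.mul x z)) ∧
  (∀ x y z, q.mul (q.mul x y) z = q.mul (q.mul x z) (q.mul y z))

/-- Idempotency: x*x = x. -/
def Idempotent {Q : Type} (q : Quasigroup Q) : Prop := ∀ x, q.mul x x = x

/-- Mendelsohn quasigroup: idempotent and semisymmetric. -/
def Mendelsohn {Q : Type} (q : Quasigroup Q) : Prop :=
  Idempotent q ∧ ∀ x y, q.mul y (q.mul x y) = x

/-- A subquasigroup: a subset closed under multiplication, left division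
and right division. -/
def IsSubquasigroup {Q : Type} (q : Quasigroup Q) (S : Set Q) : Prop :=
  (∀ x ∈ S, ∀ y ∈ S, q.mul x y ∈ S) ∧
  (∀ x ∈ S, ∀ z ∈ S, ∀ y, q.mul x y = z → y ∈ S) ∧
  (∀ y ∈ S, ∀ z ∈ S, ∀ x, q.mul x y = z → x ∈ S)

/-- The smallest subquasigroup containing `a`, `b`, `c`. -/
def genSet {Q : Type} (q : Quasigroup Q) (a b c : Q) : Set Q :=
  ⋂₀ {S : Set Q | IsSubquasigroup q S ∧ a ∈ S ∧ b ∈ S ∧ c ∈ S}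

/-- Trimediality: every subquasigroup generated by three elements is medial. -/
def Trimedial {Q : Type} (q : Quasigroup Q) : Prop :=
  ∀ a b c : Q, ∀ x ∈ genSet q a b c, ∀ y ∈ genSet q a b c,
    ∀ u ∈ genSet q a b c, ∀ v ∈ genSet q a b c,
      q.mul (q.mul x y) (q.mul u v) = q.mul (q.mul x u) (q.mul y v)

/-- Isomorphism of quasigroups. -/
def Iso {Q₁ Q₂ : Type} (q₁ : Quasigroup Q₁) (q₂ : Quasigroup Q₂) : Prop :=
  ∃ f : Q₁ ≃ Q₂, ∀ x y, f (q₁.mul x y) = q₂.mul (f x) (f y)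

end Quasigroup


/-- Commutative loops with the inverse property. -/
class CIP (Q : Type) extends Add Q, Zero Q, Neg Q where
  comm : ∀ x y : Q, x + y = y + x
  zadd : ∀ x : Q, 0 + x = x
  nac : ∀ x y : Q, -x + (x + y) = y

namespace CIP
variable {Q : Type} [CIP Q]

theorem addz (x : Q) : x + 0 = x := by rw [comm, zadd]
theorem nadd (x : Q) : -x + x = 0 := by have := nac x 0; rwa [addz] at this
theorem addn (x : Q) : x + -x = 0 := by rw [comm, nadd]
theorem nn (x : Q) : - -x = x := by
  have := nac (-x) x; rwa [nadd, addz] at this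
theorem anc (x y : Q) : x + (-x + y) = y := by
  have := nac (-x) y; rwa [nn] at this
theorem lcan {x y z : Q} (h : x + y = x + z) : y = z := by
  rw [← nac x y, h, nac]
theorem rcan {x y z : Q} (h : y + x = z + x) : y = z := by
  rw [comm y, comm z] at h; exact lcan h
theorem nzero : -(0 : Q) = 0 := by have := nadd (0 : Q); rwa [addz] at this
theorem neg_add' (x y : Q) : -(x + y) = -x + -y := by
  have h1 : -(x + y) + y = -x := by
    have := nac (x + y) (-x)
    rwa [comm (x + y) (-x), nac] at this
  have h2 := nac y (-(x + y))
  rw [comm y, h1] at h2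
  rw [← h2, comm]
theorem eq_neg_of {x y : Q} (h : x + y = 0) : x = -y := by
  have := nac y x
  rw [comm y x, h, addz] at this; exact this.symm
theorem neg_inj' {x y : Q} (h : -x = -y) : x = y := by rw [← nn x, h, nn]

/-- Nuclear (equivalently central) elements. -/
def Nuc (n : Q) : Prop := ∀ x y : Q, n + (x + y) = (n + x) + y

theorem Nuc.r {n : Q} (h : Nuc n) (x y : Q) : x + (n + y) = n + (x + y) := by
  rw [comm x, ← h, comm y]
theorem nuc_zero : Nuc (0 : Q) := fun x y => by rw [zadd, zadd]
theorem Nuc.add {m n : Q} (hm : Nuc m) (hn : Nuc n) : Nuc (m + n) := fun x y => by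
  rw [← hm, hn, hm, hm]
theorem Nuc.neg {n : Q} (h : Nuc n) : Nuc (-n) := fun x y => by
  apply lcan (x := n)
  rw [anc, h, anc]
theorem nuc_of_mid {n : Q} (h : ∀ y z : Q, (y + n) + z = y + (n + z)) : Nuc n := by
  intro p w
  have h4 : -n + -p + n = -p := by rw [comm, anc]
  have h7 : ∀ w, (n + p) + (-p + w) = n + w := by
    intro w
    have := h (-(n + p)) w
    rw [neg_add', h4, ← neg_add'] at this
    have h6 := congrArg (fun t => (n + p) + t) this
    simp only [anc] at h6
    exact h6
  have := h7 (p + w)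
  rw [nac] at this
  exact this.symm

theorem nuc_of_swap {A B : Q} (h : ∀ C D : Q, (A + B) + (C + D) = (A + C) + (B + D)) :
    Nuc (B + -A) := by
  have hs : ∀ y z : Q, y + (B + (-A + z)) = z + (B + (-A + y)) := by
    intro y z
    have h1 := h (-A + y) (-A + z)
    have h2 := h (-A + z) (-A + y)
    rw [comm (-A + z) (-A + y), h1, anc, anc] at h2
    exact h2
  have h0 : ∀ y : Q, B + (-A + y) = y + (B + -A) := by
    intro y
    have := hs y 0
    rw [zadd, addz] at this
    exact this.symm
  apply nuc_of_mid
  intro y z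
  have := hs z y
  rw [h0, h0, comm] at this
  rw [this, comm z]
end CIP

/-- Commutative Moufang loops. -/
class CML (Q : Type) extends CIP Q where
  mouf : ∀ x y z : Q, (x + x) + (y + z) = (x + y) + (x + z)


namespace Toy
open Quasigroup

variable {S : Type}

/-- right translation -/
noncomputable def R (q : Quasigroup S) (e : S) : S ≃ S := Equiv.ofBijective _ (q.rightBij e)
/-- left translation -/
noncomputable def Lt (q : Quasigroup S) (e : S) : S ≃ S := Equiv.ofBijective _ (q.leftBij e)
theorem R_apply (q : Quasigroup S) (e x : S) : R q e x = q.mul x e := rfl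
theorem Lt_apply (q : Quasigroup S) (e x : S) : Lt q e x = q.mul e x := rfl

/-- the principal loop isotope at `e` -/
noncomputable def pl (q : Quasigroup S) (e : S) (x y : S) : S :=
  q.mul ((R q e).symm x) ((Lt q e).symm y)

theorem pl_mul (q : Quasigroup S) (e x y : S) : pl q e (q.mul x e) (q.mul e y) = q.mul x y := by
  unfold pl
  rw [← R_apply q e x, ← Lt_apply q e y, Equiv.symm_apply_apply, Equiv.symm_apply_apply]

theorem pl_zero_left (q : Quasigroup S) (e y : S) : pl q e (q.mul e e) y = y := by
  unfold pl
  rw [← R_apply q e e, Equiv.symm_apply_apply, ← Lt_apply, Equiv.apply_symm_apply]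
theorem pl_zero_right (q : Quasigroup S) (e y : S) : pl q e y (q.mul e e) = y := by
  unfold pl
  rw [← Lt_apply q e e, Equiv.symm_apply_apply, ← R_apply, Equiv.apply_symm_apply]
theorem pl_lcan (q : Quasigroup S) (e : S) {x y z : S} (h : pl q e x y = pl q e x z) : y = z :=
  (Lt q e).symm.injective ((q.leftBij _).1 h)
theorem pl_rcan (q : Quasigroup S) (e : S) {x y z : S} (h : pl q e y x = pl q e z x) : y = z :=
  (R q e).symm.injective ((q.rightBij _).1 h)
theorem pl_surj (q : Quasigroup S) (e x z : S) : ∃ y, pl q e y x = z := by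
  obtain ⟨t, ht⟩ := (q.rightBij ((Lt q e).symm x)).2 z
  exact ⟨R q e t, by unfold pl; rw [Equiv.symm_apply_apply]; exact ht⟩

theorem toyoda (q : Quasigroup S) (hm : Medial q) (e : S) :
    ∃ (_ : AddCommGroup S) (φ ψ : S ≃+ S) (c : S), (∀ x, φ (ψ x) = ψ (φ x)) ∧
      (∀ x y, q.mul x y = φ x + ψ y + c) ∧ φ e + ψ e + c = 0 := by
  set f := R q e with hf
  set g := Lt q e with hg
  set p := pl q e with hp
  have hmul : ∀ x y, q.mul x y = p (f x) (g y) := fun x y => (pl_mul q e x y).symm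
  set o := q.mul e e with ho
  have z1 : ∀ y, p o y = y := pl_zero_left q e
  have z2 : ∀ y, p y o = y := pl_zero_right q e
  have fe : f e = o := rfl
  have ge : g e = o := rfl
  have law : ∀ X V y u, p (f (p X (g y))) (g (p (f u) V)) = p (f (p X (g u))) (g (p (f y) V)) := by
    intro X V y u
    have := hm (f.symm X) y u (g.symm V)
    simpa [hmul] using this
  have law1 : ∀ X V u, p (f X) (g (p (f u) V)) = p (f (p X (g u))) (g V) := by
    intro X V u
    have := law X V e u
    rwa [fe, ge, z1, z2] at this
  have law2 : ∀ X u, f (p X (g u)) = p (f X) (g (p (f u) e)) := by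
    intro X u
    rw [law1, ge, z2]
  have law3 : ∀ V u, g (p (f u) V) = p (f (p e (g u))) (g V) := by
    intro V u
    rw [← law1, fe, z1]
  have a1 : ∀ A B u, p A (p (f (p e (g u))) B) = p (p A (g (p (f u) e))) B := by
    intro A B u
    obtain ⟨X, rfl⟩ := f.surjective A
    obtain ⟨V, rfl⟩ := g.surjective B
    rw [← law3, ← law2, law1]
  have a2 : ∀ u, f (p e (g u)) = g (p (f u) e) := by
    intro u
    have := a1 o o u
    rwa [z1, z1, z2, z2] at this
  have sw : ∀ w, ∃ u, w = g (p (f u) e) := by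
    intro w
    obtain ⟨y, hy⟩ := pl_surj q e e (g.symm w)
    refine ⟨f.symm y, ?_⟩
    rw [Equiv.apply_symm_apply, ← g.symm_apply_eq]; exact hy.symm
  have assoc : ∀ A w B, p (p A w) B = p A (p w B) := by
    intro A w B
    obtain ⟨u, rfl⟩ := sw w
    rw [← a1, a2]
  have comm : ∀ a b, p a b = p b a := by
    intro a b
    obtain ⟨y, rfl⟩ := sw a
    obtain ⟨u, rfl⟩ := sw b
    have h := law o e y u
    rw [law2, law2 o, assoc, assoc] at h
    exact pl_lcan q e h
  choose ng hng using fun x => pl_surj q e x o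
  let i1 : Add S := ⟨p⟩
  let i2 : Zero S := ⟨o⟩
  let i3 : Neg S := ⟨ng⟩
  let i4 : AddGroup S := AddGroup.ofLeftAxioms assoc z1 hng
  let i5 : AddCommGroup S := { i4 with add_comm := comm }
  have hp' : ∀ x y, p x y = x + y := fun _ _ => rfl
  have ho' : o = 0 := rfl
  have fa : ∀ X Y, f (X + Y) = f X + (f Y - f 0) := by
    intro X Y
    obtain ⟨u, rfl⟩ := g.surjective Y
    have h1 := law2 X u
    have h2 := law2 o u
    rw [z1] at h2
    simp only [hp', ho'] at h1 h2
    rw [h1, h2]; abel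
  have ga : ∀ X Y, g (X + Y) = g X + (g Y - g 0) := by
    intro Y X
    obtain ⟨u, rfl⟩ := f.surjective Y
    have h1 := law3 X u
    have h2 := law3 o u
    rw [z2] at h2
    simp only [hp', ho'] at h1 h2
    rw [h1, h2]; abel
  have e1 : ∀ u, f (g u) - f 0 = g (f u) - g 0 := by
    intro u
    have h2 := law2 o u
    rw [z1] at h2
    have h2' := law3 o u
    rw [z2, a2] at h2'
    simp only [hp', ho'] at h2 h2'
    rw [h2, h2']; abel
  let φ : S ≃+ S := { f.trans (Equiv.subRight (f 0)) with
    map_add' := fun x y => by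
      show f (x + y) - f 0 = (f x - f 0) + (f y - f 0)
      rw [fa]; abel }
  let ψ : S ≃+ S := { g.trans (Equiv.subRight (g 0)) with
    map_add' := fun x y => by
      show g (x + y) - g 0 = (g x - g 0) + (g y - g 0)
      rw [ga]; abel }
  have hφ : ∀ x, φ x = f x - f 0 := fun _ => rfl
  have hψ : ∀ x, ψ x = g x - g 0 := fun _ => rfl
  have hx : ∀ x y, q.mul x y = φ x + ψ y + (f 0 + g 0) := by
    intro x y
    rw [hmul, hp', hφ, hψ]; abel
  refine ⟨i5, φ, ψ, f 0 + g 0, ?_, hx, ?_⟩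
  · intro x
    have k1 : φ (ψ x) = φ (g x) - φ (g 0) := by rw [hψ, map_sub]
    have k2 : ψ (φ x) = ψ (f x) - ψ (f 0) := by rw [hφ, map_sub]
    rw [k1, k2, hφ (g x), hφ (g 0), hψ (f x), hψ (f 0), e1, e1]
  · rw [← hx]; exact ho'
/-- local affine structure -/
theorem loc {Q : Type} (q : Quasigroup Q) (ht : Trimedial q) (e x y : Q) :
    ∃ (A : Type) (_ : AddCommGroup A) (ι : A → Q) (φ ψ : A ≃+ A) (c e0 : A),
      (∀ a, φ (ψ a) = ψ (φ a)) ∧ (∀ a b, q.mul (ι a) (ι b) = ι (φ a + ψ b + c)) ∧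
      φ e0 + ψ e0 + c = 0 ∧ ι e0 = e ∧ (∃ a, ι a = x) ∧ (∃ b, ι b = y) := by
  have hsub : IsSubquasigroup q (genSet q e x y) := by
    refine ⟨?_, ?_, ?_⟩
    · intro a ha b hb S hS
      exact hS.1.1 a (ha S hS) b (hb S hS)
    · intro a ha b hb z hz S hS
      exact hS.1.2.1 a (ha S hS) b (hb S hS) z hz
    · intro a ha b hb z hz S hS
      exact hS.1.2.2 a (ha S hS) b (hb S hS) z hz
  let qs : Quasigroup (genSet q e x y) :=
    { mul := fun a b => ⟨q.mul a b, hsub.1 _ a.2 _ b.2⟩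
      leftBij := fun a => ⟨fun b c h => Subtype.ext ((q.leftBij a).1 (congrArg Subtype.val h)),
        fun b => by
          obtain ⟨t, ht⟩ := (q.leftBij a).2 b
          exact ⟨⟨t, hsub.2.1 _ a.2 _ b.2 t ht⟩, Subtype.ext ht⟩⟩
      rightBij := fun a => ⟨fun b c h => Subtype.ext ((q.rightBij a).1 (congrArg Subtype.val h)),
        fun b => by
          obtain ⟨t, ht⟩ := (q.rightBij a).2 b
          exact ⟨⟨t, hsub.2.2 _ a.2 _ b.2 t ht⟩, Subtype.ext ht⟩⟩ }
  have hm : Medial qs := fun a b c d => Subtype.ext (ht e x y a a.2 b b.2 c c.2 d d.2)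
  obtain ⟨inst, φ, ψ, c, h1, h2, h3⟩ := toyoda qs hm ⟨e, fun S hS => hS.2.1⟩
  refine ⟨_, inst, Subtype.val, φ, ψ, c, _, h1, ?_, h3, rfl,
    ⟨⟨x, fun S hS => hS.2.2.1⟩, rfl⟩, ⟨⟨y, fun S hS => hS.2.2.2⟩, rfl⟩⟩
  intro a b
  rw [← h2]
end Toy


namespace Toy
open Quasigroup CIP

theorem trim3 {Q : Type} {q : Quasigroup Q} (ht : Trimedial q) (a b c x y u v : Q)
    (hx : ∀ S, IsSubquasigroup q S → a ∈ S → b ∈ S → c ∈ S → x ∈ S ∧ y ∈ S ∧ u ∈ S ∧ v ∈ S) :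
    q.mul (q.mul x y) (q.mul u v) = q.mul (q.mul x u) (q.mul y v) :=
  ht a b c x (fun S hS => (hx S hS.1 hS.2.1 hS.2.2.1 hS.2.2.2).1)
    y (fun S hS => (hx S hS.1 hS.2.1 hS.2.2.1 hS.2.2.2).2.1)
    u (fun S hS => (hx S hS.1 hS.2.1 hS.2.2.1 hS.2.2.2).2.2.1)
    v (fun S hS => (hx S hS.1 hS.2.1 hS.2.2.1 hS.2.2.2).2.2.2)

theorem affine1 {Q : Type} (q : Quasigroup Q) (ht : Trimedial q) (e : Q) :
    ∃ (_ : CIP Q) (Φ Ψ : Equiv.Perm Q) (c : Q), (∀ x y, Φ (x + y) = Φ x + Φ y) ∧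
      (∀ x y, Ψ (x + y) = Ψ x + Ψ y) ∧ (∀ x, Φ (Ψ x) = Ψ (Φ x)) ∧ Nuc c ∧
      (∀ x y, q.mul x y = c + (Φ x + Ψ y)) ∧
      (∀ X Y Z, (Φ X + Ψ X) + (Y + Z) = (Φ X + Y) + (Ψ X + Z)) := by
  set p := pl q e with hp
  set f := R q e with hf
  set g := Lt q e with hg
  set o := q.mul e e with ho
  have hmul : ∀ x y, q.mul x y = p (f x) (g y) := fun x y => (pl_mul q e x y).symm
  set f0 := f o with hf0
  set g0 := g o with hg0
  choose Φ' hΦ' using fun x => pl_surj q e f0 (f x)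
  choose Ψ' hΨ' using fun x => pl_surj q e g0 (g x)
  choose ng hng using fun x => pl_surj q e x o
  have Φbij : Function.Bijective Φ' := by
    constructor
    · intro x y h
      apply f.injective
      rw [← hΦ', ← hΦ', h]
    · intro z
      refine ⟨f.symm (p z f0), ?_⟩
      apply pl_rcan q e (x := f0)
      rw [hΦ', Equiv.apply_symm_apply]
  have Ψbij : Function.Bijective Ψ' := by
    constructor
    · intro x y h
      apply g.injective
      rw [← hΨ', ← hΨ', h]
    · intro z
      refine ⟨g.symm (p z g0), ?_⟩
      apply pl_rcan q e (x := g0)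
      rw [hΨ', Equiv.apply_symm_apply]
  have H : ∀ x y, ∃ (A : Type) (_ : AddCommGroup A) (ι : A → Q) (φ ψ : A ≃+ A) (e0 : A),
      (∀ a, φ (ψ a) = ψ (φ a)) ∧ (∀ a b, p (ι a) (ι b) = ι (a + b)) ∧ (ι 0 = o) ∧
      (∀ a, Φ' (ι a) = ι (φ a)) ∧ (∀ a, Ψ' (ι a) = ι (ψ a)) ∧ (∀ a, ng (ι a) = ι (-a)) ∧
      f0 = ι (- φ e0) ∧ g0 = ι (- ψ e0) ∧ (∃ a, ι a = x) ∧ (∃ b, ι b = y) := by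
    intro x y
    obtain ⟨A, iA, ι, φ, ψ, c, e0, h1, h2, h3, h4, h5, h6⟩ := loc q ht e x y
    have hc : c = - φ e0 - ψ e0 := by
      have : c = (φ e0 + ψ e0 + c) - φ e0 - ψ e0 := by abel
      rw [this, h3, zero_sub]
    have hfi : ∀ a, f (ι a) = ι (φ a - φ e0) := by
      intro a
      rw [hf, R_apply, ← h4, h2, hc]; congr 1; abel
    have hgi : ∀ a, g (ι a) = ι (ψ a - ψ e0) := by
      intro a
      rw [hg, Lt_apply, ← h4, h2, hc]; congr 1; abel
    have ho1 : ι 0 = o := by rw [ho, ← h4, h2, h3]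
    have hadd : ∀ a b, p (ι a) (ι b) = ι (a + b) := by
      intro a b
      have e1 : ι a = f (ι (φ.symm (a + φ e0))) := by rw [hfi]; simp
      have e2 : ι b = g (ι (ψ.symm (b + ψ e0))) := by rw [hgi]; simp
      rw [e1, e2, ← hmul, h2]; congr 1; simp [hc]; abel
    have hf0' : f0 = ι (- φ e0) := by rw [hf0, ← ho1, hfi]; simp
    have hg0' : g0 = ι (- ψ e0) := by rw [hg0, ← ho1, hgi]; simp
    refine ⟨A, iA, ι, φ, ψ, e0, h1, hadd, ho1, ?_, ?_, ?_, hf0', hg0', h5, h6⟩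
    · intro a
      apply pl_rcan q e (x := f0)
      rw [hΦ', ← hp, hf0', hadd, hfi]; congr 1; abel
    · intro a
      apply pl_rcan q e (x := g0)
      rw [hΨ', ← hp, hg0', hadd, hgi]; congr 1; abel
    · intro a
      apply pl_rcan q e (x := ι a)
      rw [hng, ← hp, hadd]; simp [ho1]
  let i1 : CIP Q :=
    { add := p, zero := o, neg := ng
      comm := fun x y => by
        obtain ⟨A, iA, ι, φ, ψ, e0, h1, ha, h0, h4, h5, hn, h6, h7, ⟨a, rfl⟩, ⟨b, rfl⟩⟩ := H x y
        show p _ _ = p _ _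
        rw [ha, ha, add_comm]
      zadd := pl_zero_left q e
      nac := fun x y => by
        obtain ⟨A, iA, ι, φ, ψ, e0, h1, ha, h0, h4, h5, hn, h6, h7, ⟨a, rfl⟩, ⟨b, rfl⟩⟩ := H x y
        show p (ng _) (p _ _) = _
        rw [hn, ha, ha]; simp }
  have hp' : ∀ x y, p x y = x + y := fun _ _ => rfl
  have hz' : o = 0 := rfl
  simp only [hp'] at H hmul
  have fx : ∀ x, f x = Φ' x + f0 := fun x => (hΦ' x).symm
  have gx : ∀ x, g x = Ψ' x + g0 := fun x => (hΨ' x).symm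
  have Φa : ∀ x y, Φ' (x + y) = Φ' x + Φ' y := by
    intro x y
    obtain ⟨A, iA, ι, φ, ψ, e0, h1, ha, h0, h4, h5, hn, h6, h7, ⟨a, rfl⟩, ⟨b, rfl⟩⟩ := H x y
    simp [ha, h4]
  have Ψa : ∀ x y, Ψ' (x + y) = Ψ' x + Ψ' y := by
    intro x y
    obtain ⟨A, iA, ι, φ, ψ, e0, h1, ha, h0, h4, h5, hn, h6, h7, ⟨a, rfl⟩, ⟨b, rfl⟩⟩ := H x y
    simp [ha, h5]
  have Φ0 : Φ' 0 = 0 := lcan (x := Φ' 0) (by rw [← Φa, addz, addz])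
  have Ψ0 : Ψ' 0 = 0 := lcan (x := Ψ' 0) (by rw [← Ψa, addz, addz])
  have ΦΨ : ∀ x, Φ' (Ψ' x) = Ψ' (Φ' x) := by
    intro x
    obtain ⟨A, iA, ι, φ, ψ, e0, h1, ha, h0, h4, h5, hn, h6, h7, ⟨a, rfl⟩, -⟩ := H x x
    simp [h4, h5, h1]
  have fadd : ∀ x y, f (x + y) = f x + Φ' y := by
    intro x y
    obtain ⟨A, iA, ι, φ, ψ, e0, h1, ha, h0, h4, h5, hn, h6, h7, ⟨a, rfl⟩, ⟨b, rfl⟩⟩ := H x y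
    rw [fx, fx, ha, h4, h4, h4, h6, ha, ha, ha]; congr 1; rw [map_add]; abel
  have gadd : ∀ x y, g (x + y) = Ψ' x + g y := by
    intro x y
    obtain ⟨A, iA, ι, φ, ψ, e0, h1, ha, h0, h4, h5, hn, h6, h7, ⟨a, rfl⟩, ⟨b, rfl⟩⟩ := H x y
    rw [gx, gx, ha, h5, h5, h5, h7, ha, ha, ha]; congr 1; rw [map_add]; abel
  have f0g0 : Φ' g0 = Ψ' f0 := by
    obtain ⟨A, iA, ι, φ, ψ, e0, h1, ha, h0, h4, h5, hn, h6, h7, ⟨a, -⟩, ⟨b, -⟩⟩ := H e e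
    rw [h6, h7, h4, h5]; simp [h1]
  have fg : ∀ y, Φ' (g y) = Ψ' (f y) := by
    intro y; rw [fx, gx, Φa, Ψa, ΦΨ, f0g0]
  have key : ∀ X Y Z, (f X + Ψ' X) + (Y + Z) = (f X + Y) + (Ψ' X + Z) := by
    intro X Y Z
    obtain ⟨x, rfl⟩ := f.surjective X
    obtain ⟨Y', rfl⟩ := Φbij.2 Y
    obtain ⟨y, rfl⟩ := g.surjective Y'
    obtain ⟨Z', rfl⟩ := g.surjective Z
    obtain ⟨z, rfl⟩ := g.surjective Z'
    have := trim3 ht x y z x x y z (fun S _ a b c => ⟨a, a, b, c⟩)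
    simp only [hmul, fadd, gadd] at this
    rw [fg, ← fg y] at this
    exact this
  have nf0 : Nuc f0 := by
    intro Y Z
    have := key 0 Y Z
    rw [Ψ0, zadd, addz] at this
    exact this
  have nucΦ : ∀ n, Nuc (Φ' n) → Nuc n := by
    intro n h x y
    apply Φbij.1
    rw [Φa, Φa, h, Φa, Φa]
  have nucΨ : ∀ n, Nuc n → Nuc (Ψ' n) := by
    intro n h x y
    obtain ⟨x, rfl⟩ := Ψbij.2 x
    obtain ⟨y, rfl⟩ := Ψbij.2 y
    rw [← Ψa, ← Ψa, h, Ψa, Ψa]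
  have ng0 : Nuc g0 := by
    apply nucΦ; rw [f0g0]; exact nucΨ _ nf0
  refine ⟨i1, Equiv.ofBijective _ Φbij, Equiv.ofBijective _ Ψbij, f0 + g0, Φa, Ψa, ΦΨ,
    nf0.add ng0, ?_, ?_⟩
  · intro x y
    show q.mul x y = (f0 + g0) + (Φ' x + Ψ' y)
    rw [hmul, fx, gx, comm (Φ' x), comm (Ψ' y), ← nf0, ← nf0, ng0.r]
  · intro X Y Z
    show (Φ' X + Ψ' X) + (Y + Z) = (Φ' X + Y) + (Ψ' X + Z)
    have := key X Y Z
    rw [fx, comm _ f0, ← nf0, ← nf0, ← nf0, ← nf0] at this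
    exact lcan this

theorem affine2 {Q : Type} (q : Quasigroup Q) (ht : Trimedial q) (e : Q) :
    ∃ (_ : CML Q) (Φ Ψ : Equiv.Perm Q) (c : Q), (∀ x y, Φ (x + y) = Φ x + Φ y) ∧
      (∀ x y, Ψ (x + y) = Ψ x + Ψ y) ∧ (∀ x, Φ (Ψ x) = Ψ (Φ x)) ∧ Nuc c ∧
      (∀ x y, q.mul x y = c + (Φ x + Ψ y)) ∧
      (∀ x, Nuc (Ψ x + -Φ x)) ∧ (∀ x, Nuc (Φ (Ψ (Φ x + Ψ x)) + -Φ (Φ x))) := by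
  obtain ⟨i1, Φ, Ψ, c, Φa, Ψa, ΦΨ, nc, hmul, key⟩ := affine1 q ht e
  have hN : ∀ x, Nuc (Ψ x + -Φ x) := fun x => nuc_of_swap (key x)
  let i2 : CML Q :=
    { i1 with
      mouf := by
        intro A Y Z
        obtain ⟨X, rfl⟩ := Φ.surjective A
        have h := key X Y Z
        have h2 : Ψ X = (Ψ X + -Φ X) + Φ X := by rw [CIP.comm, CIP.comm (Ψ X), anc]
        have hn := hN X
        generalize Ψ X + -Φ X = n at *
        generalize Φ X = A at *
        rw [h2, hn.r, ← hn, ← hn, hn.r] at h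
        exact lcan h }
  have nucΦ : ∀ n, Nuc n → Nuc (Φ n) := by
    intro n h x y
    obtain ⟨x, rfl⟩ := Φ.surjective x
    obtain ⟨y, rfl⟩ := Φ.surjective y
    rw [← Φa, ← Φa, h, Φa, Φa]
  have nucΨ : ∀ n, Nuc n → Nuc (Ψ n) := by
    intro n h x y
    obtain ⟨x, rfl⟩ := Ψ.surjective x
    obtain ⟨y, rfl⟩ := Ψ.surjective y
    rw [← Ψa, ← Ψa, h, Ψa, Ψa]
  refine ⟨i2, Φ, Ψ, c, Φa, Ψa, ΦΨ, nc, hmul, hN, ?_⟩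
  intro x
  have goal' : Nuc (Φ (Ψ (q.mul x x)) + -Φ (Φ x)) := ?_
  · rw [hmul, Ψa, Φa] at goal'
    have n1 := nucΦ _ (nucΨ _ nc)
    rw [← n1] at goal'
    have := n1.neg.add goal'
    rwa [nac] at this
  apply nuc_of_swap
  intro C D
  obtain ⟨C', rfl⟩ := Ψ.surjective C
  obtain ⟨u, rfl⟩ := Φ.surjective C'
  obtain ⟨D', rfl⟩ := Ψ.surjective D
  obtain ⟨v, rfl⟩ := Ψ.surjective D'
  have := trim3 ht x u v x (q.mul x x) u v (fun S hS a b c => ⟨a, hS.1 _ a _ a, b, c⟩)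
  have hk : ∀ a b, q.mul (c + a) (c + b) = (c + (Φ c + Ψ c)) + (Φ a + Ψ b) := by
    intro a b
    have n1 := nucΦ _ nc
    have n2 := nucΨ _ nc
    rw [hmul, Φa, Ψa, ← n1, n2.r, ← nc, ← n1]
  generalize hw : q.mul x x = w at this
  have e1 : ∀ s t u v, q.mul (q.mul s t) (q.mul u v) =
      (c + (Φ c + Ψ c)) + (Φ (Φ s + Ψ t) + Ψ (Φ u + Ψ v)) := by
    intro s t u v
    rw [hmul s t, hmul u v, hk]
  rw [e1, e1] at this
  have this := lcan this
  rw [Φa, Φa, Ψa, Ψa, ΦΨ u, ← ΦΨ w] at this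
  exact this
end Toy


namespace CML
open CIP Equiv
variable {Q : Type} [CML Q]

theorem pinv (f : Perm Q) (x : Q) : f⁻¹ (f x) = x := Perm.inv_eq_iff_eq.mpr rfl
theorem pinv' (f : Perm Q) (x : Q) : f (f⁻¹ x) = x := (eq_symm_apply f).mp rfl
/-- translation -/
def L (x : Q) : Perm Q := ⟨fun y => x + y, fun y => -x + y, nac x, anc x⟩
theorem L_apply (x y : Q) : L x y = x + y := rfl
theorem L_inv_apply (x y : Q) : (L x)⁻¹ y = -x + y := rfl
theorem L_neg (x : Q) : L (-x) = (L x)⁻¹ := by ext y; rfl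

theorem add_self_add (x z : Q) : (x + x) + z = x + (x + z) := by
  have := mouf x 0 z; rwa [zadd, addz] at this
theorem L_add_self (x : Q) : L (x + x) = L x * L x := by
  ext y; simp [L_apply, Perm.mul_apply, add_self_add]

/-- autotopism-like pairs -/
def Atp (h k : Perm Q) : Prop := ∀ u v, h u + h v = k (u + v)
theorem Atp.mul {h k h' k' : Perm Q} (a : Atp h k) (b : Atp h' k') : Atp (h * h') (k * k') := by
  intro u v; simp only [Perm.mul_apply]; rw [a, b]
theorem Atp.inv {h k : Perm Q} (a : Atp h k) : Atp h⁻¹ k⁻¹ := by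
  intro u v
  rw [Perm.eq_inv_iff_eq, ← a]; simp
theorem atp_L (x : Q) : Atp (L x) (L x * L x) := by
  intro u v
  rw [← L_add_self]; exact (mouf x u v).symm

/-- inner mappings -/
def I (x y : Q) : Perm Q := (L (x + y))⁻¹ * (L x * L y)
theorem I_apply (x y z : Q) : I x y z = -(x + y) + (x + (y + z)) := rfl
theorem add_I (x y z : Q) : x + (y + z) = (x + y) + I x y z := by rw [I_apply, anc]
theorem I_zero (x y : Q) : I x y 0 = 0 := by rw [I_apply, addz, nadd]
theorem I_eq (x y : Q) : I x y =
    ((L (x + y))⁻¹ * (L (x + y))⁻¹) * ((L x * L x) * (L y * L y)) := by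
  have h : Atp (I x y) (((L (x + y)) * (L (x + y)))⁻¹ * ((L x * L x) * (L y * L y))) :=
    (atp_L (x+y)).inv.mul ((atp_L x).mul (atp_L y))
  rw [mul_inv_rev] at h
  ext u
  have := h u 0
  rwa [I_zero, addz, addz] at this
theorem I_add (x y u v : Q) : I x y (u + v) = I x y u + I x y v := by
  have h : Atp (I x y) (((L (x + y)) * (L (x + y)))⁻¹ * ((L x * L x) * (L y * L y))) :=
    (atp_L (x+y)).inv.mul ((atp_L x).mul (atp_L y))
  rw [mul_inv_rev, ← I_eq] at h
  exact (h u v).symm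
theorem I_neg (x y u : Q) : I x y (-u) = - I x y u := by
  apply eq_neg_of; rw [← I_add, nadd, I_zero]
theorem I_fix_left (x y : Q) : I x y x = x := by
  rw [I_apply, CIP.comm y x, CIP.comm x (x + y), nac]
theorem I_fix_right (x y : Q) : I x y y = y := by
  rw [I_apply]
  have : x + (y + y) = (x + y) + y := by
    rw [CIP.comm, add_self_add, CIP.comm y, CIP.comm y]
  rw [this, nac]

/-- an additive permutation conjugates translations -/
theorem conj_L (h : Perm Q) (ha : ∀ u v, h (u + v) = h u + h v) (z : Q) : h * L z = L (h z) * h := by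
  ext u; simp [L_apply, Perm.mul_apply, ha]
theorem conj_I (h : Perm Q) (ha : ∀ u v, h (u + v) = h u + h v) (x y : Q) :
    h * I x y = I (h x) (h y) * h := by
  ext u; simp only [Perm.mul_apply]
  have h0 : h 0 = 0 := lcan (x := h 0) (by rw [← ha, addz, addz])
  have hn : ∀ x, h (-x) = - h x := fun x => eq_neg_of (by rw [← ha, nadd, h0])
  simp only [I_apply, ha, hn]
theorem I_comm_L (x y z : Q) (h : I x y z = z) : I x y * L z = L z * I x y := by
  rw [conj_L _ (I_add x y), h]

section grp
variable {G : Type} [Group G]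
theorem grp1 {P R S i j : G} (h1 : S * i = P * R) (h2 : S * j = R * P)
    (iP : i * P = P * i) (iR : i * R = R * i) (iS : i * S = S * i)
    (jP : j * P = P * j) (jR : j * R = R * j) (jS : j * S = S * j)
    (h3 : S * (P * R) = (P * P) * (R * R)) : j = i * i := by
  have a1 : (P * S * R) * i = (S * S) * i := by
    calc (P * S * R) * i = P * S * (R * i) := by group
      _ = P * (S * i) * R := by rw [← iR]; group
      _ = (P * P) * (R * R) := by rw [h1]; group
      _ = S * (S * i) := by rw [← h3, h1]
      _ = (S * S) * i := by group
  have a1 := mul_right_cancel a1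
  have a2 : (P * S * R) * j = (S * S) * (i * i) := by
    calc (P * S * R) * j = P * S * (R * j) := by group
      _ = P * (S * j) * R := by rw [← jR]; group
      _ = (P * R) * (P * R) := by rw [h2]; group
      _ = S * (i * S) * i := by rw [← h1]; group
      _ = (S * S) * (i * i) := by rw [iS]; group
  rw [a1] at a2
  exact mul_left_cancel a2
end grp

theorem SI (x y : Q) : L (x + y) * I x y = L x * L y := by unfold I; group
theorem SPR (x y : Q) : L (x + y) * (L x * L y) = (L x * L x) * (L y * L y) := by
  have h := I_eq x y
  rw [← SI, h]; group
theorem I_fix_sum (x y : Q) : I x y (x + y) = x + y := by rw [I_add, I_fix_left, I_fix_right]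
theorem I_swap_sq (x y : Q) : I y x = I x y * I x y := by
  have h2 : L (x + y) * I y x = L y * L x := by rw [CIP.comm x y, SI]
  have f1 : I y x (x + y) = x + y := by rw [I_add, I_fix_left, I_fix_right]
  exact grp1 (SI x y) h2 (I_comm_L _ _ _ (I_fix_left x y)) (I_comm_L _ _ _ (I_fix_right x y))
    (I_comm_L _ _ _ (I_fix_sum x y)) (I_comm_L _ _ _ (I_fix_right y x)) (I_comm_L _ _ _ (I_fix_left y x))
    (I_comm_L _ _ _ f1) (SPR x y)
theorem I_cube (x y : Q) : I x y * (I x y * I x y) = 1 := by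
  have h := I_swap_sq y x
  rw [I_swap_sq x y] at h
  have h' : I x y * 1 = I x y * (I x y * (I x y * I x y)) := by
    rw [mul_one]
    calc I x y = I x y * I x y * (I x y * I x y) := h
      _ = _ := by group
  exact (mul_left_cancel h').symm
theorem I_swap (x y : Q) : I y x = (I x y)⁻¹ := by
  rw [I_swap_sq]; exact eq_inv_of_mul_eq_one_right (I_cube x y)
theorem I_sq (x y : Q) : I x y * I x y = (I x y)⁻¹ := eq_inv_of_mul_eq_one_right (I_cube x y)

theorem RP (x y : Q) : L y * L x = L x * L y * I x y := by
  have h2 : L (x + y) * I y x = L y * L x := by rw [CIP.comm x y, SI]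
  rw [← h2, I_swap_sq, ← SI]; group
theorem L_xyx (x y : Q) : L (x + (x + y)) = L x * L y * L x := by
  have h := SPR x (x + y)
  have h1 := SI x y
  have c1 := I_comm_L _ _ _ (I_fix_left x y)
  have c2 := I_comm_L _ _ _ (I_fix_right x y)
  have c3 := I_comm_L _ _ _ (I_fix_sum x y)
  have h2 := RP x y
  have i3 := I_sq x y
  generalize L (x + (x + y)) = T at *
  generalize L (x + y) = S at *
  generalize L x = P at *
  generalize L y = R at *
  generalize I x y = i at *
  have hS : S = P * R * i⁻¹ := by rw [← h1]; group
  have hT : T = P * P * S * P⁻¹ := by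
    have : T = (T * (P * S)) * S⁻¹ * P⁻¹ := by group
    rw [this, h]; group
  have e2 : P * S = R * P * P := by
    calc P * S = P * (P * R * i⁻¹) := by rw [hS]
      _ = P * (P * R * (i * i)) := by rw [i3]
      _ = P * (P * R * i) * i := by group
      _ = P * (R * P) * i := by rw [h2]
      _ = P * R * (P * i) := by group
      _ = P * R * (i * P) := by rw [c1]
      _ = P * R * i * P := by group
      _ = R * P * P := by rw [h2]
  rw [hT, mul_assoc P P S, e2]; group
theorem I_add_left (x y : Q) : I x (x + y) = I x y := by
  have h : I x (x + y) = (L x * L y * L x)⁻¹ * (L x * L (x + y)) := by rw [← L_xyx]; rfl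
  have h2 : L (x + y) * I y x = L y * L x := by rw [CIP.comm x y, SI]
  have : I x (x + y) = (I y x)⁻¹ := by
    rw [h, eq_inv_iff_mul_eq_one]
    calc _ = (L x * L y * L x)⁻¹ * (L x * (L (x + y) * I y x)) := by group
      _ = 1 := by rw [h2]; group
  rw [this, ← I_swap]
theorem I_neg_left (x y : Q) : I (-x) y = (I x y)⁻¹ := by
  have h1 : I x y = I x (-x + y) := by rw [← I_add_left x (-x + y), anc]
  rw [h1]
  unfold I
  rw [anc, L_neg]; group
theorem I_neg_right (x y : Q) : I x (-y) = (I x y)⁻¹ := by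
  rw [I_swap (-y) x, I_neg_left, I_swap x y, inv_inv]

theorem nuc_three (x : Q) : Nuc (x + (x + x)) := by
  intro z y
  rw [CIP.comm z y]
  have h : L (x + (x + x)) = L x * L x * L x := L_xyx x x
  have c : L y * (L x * L x * L x) = (L x * L x * L x) * L y := by
    have h2 := RP x y
    have c1 := I_comm_L _ _ _ (I_fix_left x y)
    have i3 := I_cube x y
    generalize L x = P at *
    generalize L y = R at *
    generalize I x y = i at *
    calc R * (P * P * P) = (R * P) * P * P := by group
      _ = P * R * (i * P) * P := by rw [h2]; group
      _ = P * R * (P * i) * P := by rw [c1]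
      _ = P * (R * P) * (i * P) := by group
      _ = P * (P * R * i) * (P * i) := by rw [h2, c1]
      _ = P * P * R * (i * P) * i := by group
      _ = P * P * (R * P) * (i * i) := by rw [c1]; group
      _ = P * P * P * R * (i * (i * i)) := by rw [h2]; group
      _ = _ := by rw [i3]; group
  have := congrArg (fun t : Perm Q => t z) c
  rw [← h] at this
  simp only [Perm.mul_apply, L_apply] at this
  rw [← this, CIP.comm]

theorem three_fix (x y u : Q) : I x y u = u ↔ I x y (I x y u) = u := by
  have h := I_cube x y
  have h' : I x y (I x y (I x y u)) = u := by
    have := congrArg (fun t : Perm Q => t u) h; simpa using this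
  constructor
  · intro h1; rw [h1, h1]
  · intro h1; rw [h1] at h'; exact h'
theorem I3 (x y u : Q) : I x y (I x y (I x y u)) = u := by
  have := congrArg (fun t : Perm Q => t u) (I_cube x y); simpa using this
theorem Iinv (x y u : Q) : (I x y)⁻¹ u = I x y (I x y u) := by
  rw [← I_sq]; rfl

/-- main commutation (1) -/
theorem one (x y z : Q) : y + I x y z = z + I z x y := by
  have key : ∀ y : Q, I x y ((x + y) + z) = I z x ((x + y) + z) := by
    intro y
    have h1 : I x y ((x + y) + z) = x + (y + z) := by
      rw [I_add, I_fix_sum, ← add_I]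
    have h2 : (x + y) + z = I z x ((z + x) + y) := by
      rw [I_add, I_fix_sum, ← add_I, CIP.comm]
    have h3 : x + (y + z) = I z x (I z x ((z + x) + y)) := by
      rw [I_add, I_fix_sum, I_add, I_fix_sum, CIP.comm y z, add_I, CIP.comm x z, I_swap, Iinv]
    rw [h1, h3, ← h2]
  have h := key (-x + y)
  rw [anc] at h
  have e : I x (-x + y) = I x y := by rw [← I_add_left x (-x + y), anc]
  rw [e, I_add, I_add, I_fix_right, I_fix_left, CIP.comm (I z x y)] at h
  exact h

theorem pq (z p q : Q) : (z + p) + (-z + q) = p + I z p q := by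
  have : q = z + (-z + q) := (anc z q).symm
  conv_rhs => rw [this, I_add, I_fix_left, add_I, I_swap]
  simp only [pinv]
  rw [CIP.comm z p]
end CML

/-- commutative Moufang loops without elements of order two -/
class OCML (Q : Type) extends CML Q where
  odd : ∀ t : Q, t + t = 0 → t = 0

namespace OCML
open CIP CML Equiv
variable {Q : Type} [OCML Q]

theorem dbl_inj {x y : Q} (h : x + x = y + y) : x = y := by
  have : (x + -y) + (x + -y) = 0 := by
    rw [← mouf, ← CIP.neg_add', h, addn]
  have := odd _ this
  have := eq_neg_of this
  rwa [nn] at this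

theorem eqI (x y z : Q) : (I z x)⁻¹ (y + y) = y + I z y (I z x y) := by
  have h1 := one x y z
  have h2 := one x y (-z)
  rw [I_neg, I_neg_left] at h2
  have h3 : y + y = (z + I z x y) + (-z + (I z x)⁻¹ y) := by
    rw [← h1, ← h2, ← mouf, addn, addz]
  rw [pq] at h3
  have c := conj_I (I z x) (I_add z x) z y
  rw [I_fix_left] at c
  have c' : I z (I z x y) ((I z x)⁻¹ y) = I z x (I z y (I z x y)) := by
    rw [Iinv]
    have := congrArg (fun t : Perm Q => t (I z x y)) c
    simp only [Perm.mul_apply] at this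
    exact this.symm
  rw [c', ← I_add] at h3
  rw [Perm.inv_eq_iff_eq]; exact h3
/-- (I) -/
theorem eqI' (x y z : Q) : I z y (I z x y) + I z y (I z x y) = y + (I z x)⁻¹ y := by
  have h2' := eqI x y (-z)
  rw [I_neg_left, I_neg_left] at h2'
  simp only [inv_inv] at h2'
  have h3 := congrArg (I z y) h2'
  simp only [I_add, I_fix_right, pinv'] at h3
  exact h3
theorem tau_fix (x y z : Q) : I z y (I z x y) = I z x y := by
  have h1 := eqI' x y z
  have h2 := eqI (-x) y z
  rw [I_neg_right] at h2
  simp only [inv_inv] at h2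
  have h3 := congrArg (fun t => (I z y)⁻¹ t) h2
  have e : ∀ u v, (I z y)⁻¹ (u + v) = (I z y)⁻¹ u + (I z y)⁻¹ v := by
    intro u v; rw [Perm.inv_eq_iff_eq, I_add]; simp
  have ey : (I z y)⁻¹ y = y := by rw [Perm.inv_eq_iff_eq, I_fix_right]
  simp only [I_add, e, ey, pinv] at h3
  rw [← h1] at h3
  have h4 := dbl_inj h3
  rw [Perm.inv_eq_iff_eq] at h4
  have := (three_fix z y (I z x y)).2 h4.symm
  exact this
theorem dbl_sig (x y z : Q) : I z x y + I z x y = y + (I z x)⁻¹ y := by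
  rw [← eqI', tau_fix]

/-- the associator bracket -/
def br (x y z : Q) : Q := -z + I x y z
theorem I_br (x y z : Q) : I x y z = z + br x y z := (anc _ _).symm
theorem fix0 (x y z : Q) : I z x (br z x y) = br z x y := by
  have h := dbl_sig x y z
  rw [Iinv] at h
  have h2 : -y + (I z x y + I z x y) = I z x (I z x y) := by rw [h, nac]
  rw [CIP.comm, add_self_add, CIP.comm (I z x y) (-y)] at h2
  unfold br
  rw [I_add, I_neg, ← h2, nac]
theorem fix1 (x y z : Q) : I z y (br z x y) = br z x y := by
  unfold br; rw [I_add, I_neg, tau_fix, I_fix_right]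
theorem br_cyc (x y z : Q) : br x y z = br z x y := by
  have h1 := one x y z
  rw [I_br z x y, add_I, fix1] at h1
  have h2 : y + (z + br z x y) = (z + y) + br z x y := by
    rw [add_I, I_swap, CIP.comm y z]
    congr 1
    rw [Perm.inv_eq_iff_eq, fix1]
  rw [← h2] at h1
  have := lcan h1
  unfold br at *
  rw [this, nac]
theorem br_three (x y z : Q) : br x y z + (br x y z + br x y z) = 0 := by
  have h := I3 x y z
  have f := fix0 y z x
  have e := I_br x y z
  generalize br x y z = u at *
  rw [e, I_add, f, I_add, f, e] at h
  have h3 : (z + u) + u + u = z + (u + (u + u)) := by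
    have := (L_xyx u u)
    have := congrArg (fun t : Perm Q => t z) this
    simp only [Perm.mul_apply, CML.L_apply] at this
    rw [CIP.comm z (u + (u + u)), this, CIP.comm z u, CIP.comm (u + z) u, CIP.comm _ u]
  rw [I_add, f, e] at h
  rw [h3] at h
  exact lcan (x := z) (by rw [h, addz])
theorem br_swap (x y z : Q) : br y x z = - br x y z := by
  have f := fix0 y z x
  have e := I_br x y z
  have e3 := I_br y x z
  rw [I_swap, Iinv, e, I_add, f, e] at e3
  have h3 : (z + br x y z) + br x y z = z + (br x y z + br x y z) := by
    rw [CIP.comm, CIP.comm z (br x y z), ← add_self_add, CIP.comm]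
  rw [h3] at e3
  have e4 := lcan e3
  rw [← e4]
  apply eq_neg_of
  rw [CIP.comm, br_three]
end OCML


namespace OCML
open CIP CML Equiv
variable {Q : Type} [OCML Q]

theorem br_eq_zero {x y z : Q} : br x y z = 0 ↔ I x y z = z := by
  rw [I_br]; constructor
  · intro h; rw [h, addz]
  · intro h; exact lcan (x := z) (by rw [h, addz])
theorem br_cyc' (x y z : Q) : br x y z = br y z x := (br_cyc y z x).symm
theorem br_swap' (x y z : Q) : br x z y = - br x y z := by
  rw [br_cyc, br_swap, ← br_cyc']
theorem br_same1 (x z : Q) : br x x z = 0 := by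
  rw [br_cyc, br_eq_zero, I_fix_right]
theorem br_same2 (x z : Q) : br x z z = 0 := by rw [br_eq_zero, I_fix_right]
theorem br_same3 (x z : Q) : br z x z = 0 := by rw [br_eq_zero, I_fix_left]
/-- a bracket is fixed by the inner mappings of pairs of its entries -/
theorem fixa (x y z : Q) : I x y (br x y z) = br x y z := fix0 y z x
theorem fixb (x y z : Q) : I y z (br x y z) = br x y z := by rw [br_cyc']; exact fixa y z x
theorem fixc (x y z : Q) : I x z (br x y z) = br x y z := fix1 y z x
theorem nuc_iff {n : Q} : Nuc n ↔ ∀ x y, br n x y = 0 := by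
  constructor
  · intro h x y
    rw [br_eq_zero, I_apply, h, nac]
  · intro h x y
    have := br_eq_zero.1 (h x y)
    rw [add_I, this]

/-- subloops -/
structure IsSub (S : Set Q) : Prop where
  zero : (0 : Q) ∈ S
  add : ∀ {x y}, x ∈ S → y ∈ S → x + y ∈ S
  neg : ∀ {x}, x ∈ S → -x ∈ S

/-- a subloop as a loop -/
@[reducible] def IsSub.ocml {S : Set Q} (h : IsSub S) : OCML S where
  add x y := ⟨x.1 + y.1, h.add x.2 y.2⟩
  zero := ⟨0, h.zero⟩
  neg x := ⟨-x.1, h.neg x.2⟩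
  comm x y := Subtype.ext (CIP.comm _ _)
  zadd x := Subtype.ext (CIP.zadd _)
  nac x y := Subtype.ext (CIP.nac _ _)
  mouf x y z := Subtype.ext (CML.mouf _ _ _)
  odd t ht := Subtype.ext (OCML.odd _ (congrArg Subtype.val ht))

theorem IsSub.fix (x y : Q) : IsSub {z | I x y z = z} where
  zero := I_zero x y
  add := fun {u v} hu hv => by simp only [Set.mem_setOf_eq] at *; rw [I_add, hu, hv]
  neg := fun {u} hu => by simp only [Set.mem_setOf_eq] at *; rw [I_neg, hu]
theorem IsSub.inter {S T : Set Q} (hS : IsSub S) (hT : IsSub T) : IsSub (S ∩ T) where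
  zero := ⟨hS.zero, hT.zero⟩
  add := fun hu hv => ⟨hS.add hu.1 hv.1, hT.add hu.2 hv.2⟩
  neg := fun hu => ⟨hS.neg hu.1, hT.neg hu.2⟩

/-- the subloop generated by three elements -/
def gen3 (p q r : Q) : Set Q := {x | ∀ S : Set Q, IsSub S → p ∈ S → q ∈ S → r ∈ S → x ∈ S}
theorem gen3_sub (p q r : Q) : IsSub (gen3 p q r) where
  zero := fun S h _ _ _ => h.zero
  add := fun hu hv S h a b c => h.add (hu S h a b c) (hv S h a b c)
  neg := fun hu S h a b c => h.neg (hu S h a b c)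

theorem sub_card {S T : Set Q} [Finite Q] (hS : IsSub S) (hT : IsSub T) (hST : S ⊆ T) {u : Q}
    (hu : u ∈ T) (hu' : u ∉ S) : 3 * Nat.card S ≤ Nat.card T := by
  have hd : ∀ v, v + v ∈ S → v ∈ S := by
    intro v hv
    let g : S → S := fun s => ⟨s.1 + s.1, hS.add s.2 s.2⟩
    have gi : Function.Injective g := fun s t h => Subtype.ext (dbl_inj (congrArg Subtype.val h))
    obtain ⟨s, hs⟩ := (Finite.injective_iff_surjective.1 gi) ⟨_, hv⟩
    have := dbl_inj (congrArg Subtype.val hs)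
    rw [← this]; exact s.2
  have hun : -u ∉ S := fun h => hu' (by have := hS.neg h; rwa [nn] at this)
  let f : S ⊕ S ⊕ S → T := fun x => match x with
    | .inl s => ⟨s.1, hST s.2⟩
    | .inr (.inl s) => ⟨u + s.1, hT.add hu (hST s.2)⟩
    | .inr (.inr s) => ⟨-u + s.1, hT.add (hT.neg hu) (hST s.2)⟩
  have a1 : ∀ w, w ∉ S → ∀ s ∈ S, ∀ t ∈ S, w + s = t → False := by
    intro w hw s hs t ht h
    apply hw
    have : w = -s + t := by rw [← h, CIP.comm w s, nac]
    rw [this]; exact hS.add (hS.neg hs) ht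
  have a2 : ∀ s ∈ S, ∀ t ∈ S, u + s = -u + t → False := by
    intro s hs t ht h
    have h2 : (u + u) + s = t := by rw [add_self_add, h, anc]
    exact a1 _ (fun h => hu' (hd u h)) s hs t ht h2
  have fi : Function.Injective f := by
    rintro (s | s | s) (t | t | t) h <;> have h := congrArg Subtype.val h <;> simp only [f] at h
    · rw [Subtype.ext h]
    · exact (a1 u hu' _ t.2 _ s.2 h.symm).elim
    · exact (a1 _ hun _ t.2 _ s.2 h.symm).elim
    · exact (a1 u hu' _ s.2 _ t.2 h).elim
    · rw [Subtype.ext (lcan h)]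
    · exact (a2 _ s.2 _ t.2 h).elim
    · exact (a1 _ hun _ s.2 _ t.2 h).elim
    · exact (a2 _ t.2 _ s.2 h.symm).elim
    · rw [Subtype.ext (lcan h)]
  have := Nat.card_le_card_of_injective f fi
  rw [Nat.card_sum, Nat.card_sum] at this
  omega

/-- multiples -/
def sm (k : ZMod 3) (a : Q) : Q := if k = 0 then 0 else if k = 1 then a else -a
theorem sm_zero (a : Q) : sm 0 a = 0 := by simp [sm]
theorem sm_one (a : Q) : sm 1 a = a := by simp [sm]
theorem sm_neg_one (a : Q) : sm (-1) a = -a := by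
  have : (-1 : ZMod 3) ≠ 0 ∧ (-1 : ZMod 3) ≠ 1 := by decide
  simp [sm, this]
theorem zmod3 (k : ZMod 3) : k = 0 ∨ k = 1 ∨ k = -1 := by revert k; decide
theorem sm_neg (k : ZMod 3) (a : Q) : sm (-k) a = - sm k a := by
  rcases zmod3 k with rfl | rfl | rfl
  · rw [neg_zero, sm_zero, nzero]
  · rw [sm_neg_one, sm_one]
  · rw [neg_neg, sm_one, sm_neg_one, nn]
theorem dbl_neg {a : Q} (h : a + (a + a) = 0) : a + a = -a := by
  apply eq_neg_of; rw [CIP.comm, h]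
theorem sm_add {a : Q} (h : a + (a + a) = 0) (k l : ZMod 3) : sm (k + l) a = sm k a + sm l a := by
  have e1 : a + a = -a := dbl_neg h
  have e2 : -a + -a = a := by rw [← CIP.neg_add', e1, nn]
  have d1 : (1 : ZMod 3) + 1 = -1 := by decide
  have d2 : (-1 : ZMod 3) + -1 = 1 := by decide
  rcases zmod3 k with rfl | rfl | rfl <;> rcases zmod3 l with rfl | rfl | rfl <;>
    simp [sm_zero, sm_one, sm_neg_one, zadd, addz, d1, d2, e1, e2, addn, nadd]
theorem sm_eq_zero {a : Q} (ha : a ≠ 0) {k : ZMod 3} (h : sm k a = 0) : k = 0 := by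
  rcases zmod3 k with rfl | rfl | rfl
  · rfl
  · rw [sm_one] at h; exact (ha h).elim
  · rw [sm_neg_one] at h
    exact (ha (by rw [← nn a, h, nzero])).elim
theorem sm_inj {a : Q} (h3 : a + (a + a) = 0) (ha : a ≠ 0) {k l : ZMod 3} (h : sm k a = sm l a) :
    k = l := by
  have : sm (k + -l) a = 0 := by rw [sm_add h3, sm_neg, h, addn]
  have := sm_eq_zero ha this
  exact eq_of_sub_eq_zero (by rw [sub_eq_add_neg, this])
theorem nuc_sm {a : Q} (h : Nuc a) (k : ZMod 3) : Nuc (sm k a) := by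
  rcases zmod3 k with rfl | rfl | rfl
  · rw [sm_zero]; exact nuc_zero
  · rwa [sm_one]
  · rw [sm_neg_one]; exact h.neg

/-- `Q` is generated by `p,q,r` and the nucleus -/
def GenN (p q r : Q) : Prop :=
  ∀ S : Set Q, IsSub S → p ∈ S → q ∈ S → r ∈ S → (∀ n, Nuc n → n ∈ S) → ∀ x, x ∈ S

theorem nuc_of_gen {p q r m : Q} (hg : GenN p q r) (h1 : br p q m = 0) (h2 : br q r m = 0)
    (h3 : br r p m = 0) : Nuc m := by
  have hn : ∀ n x y : Q, Nuc n → br x y n = 0 := by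
    intro n x y h; rw [br_cyc]; exact nuc_iff.1 h x y
  have nz : ∀ x y z : Q, br x y z = 0 → br y x z = 0 := by
    intro x y z h; rw [br_swap, h, nzero]
  have cz : ∀ x y z : Q, br x y z = 0 → br z x y = 0 := by
    intro x y z h; rw [← br_cyc, h]
  have mp : ∀ x, br m p x = 0 := fun x => br_eq_zero.2 (hg _ (IsSub.fix m p)
    (br_eq_zero.1 (br_same2 _ _)) (br_eq_zero.1 (cz _ _ _ h1))
    (br_eq_zero.1 (cz _ _ _ (nz _ _ _ h3))) (fun n h => br_eq_zero.1 (hn n _ _ h)) x)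
  have mq : ∀ x, br m q x = 0 := fun x => br_eq_zero.2 (hg _ (IsSub.fix m q)
    (br_eq_zero.1 (cz _ _ _ (nz _ _ _ h1))) (br_eq_zero.1 (br_same2 _ _))
    (br_eq_zero.1 (cz _ _ _ h2)) (fun n h => br_eq_zero.1 (hn n _ _ h)) x)
  have mr : ∀ x, br m r x = 0 := fun x => br_eq_zero.2 (hg _ (IsSub.fix m r)
    (br_eq_zero.1 (cz _ _ _ h3)) (br_eq_zero.1 (cz _ _ _ (nz _ _ _ h2)))
    (br_eq_zero.1 (br_same2 _ _)) (fun n h => br_eq_zero.1 (hn n _ _ h)) x)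
  rw [nuc_iff]
  intro x y
  exact br_eq_zero.2 (hg _ (IsSub.fix m x)
    (br_eq_zero.1 (cz _ _ _ (cz _ _ _ (nz _ _ _ (mp x)))))
    (br_eq_zero.1 (cz _ _ _ (cz _ _ _ (nz _ _ _ (mq x)))))
    (br_eq_zero.1 (cz _ _ _ (cz _ _ _ (nz _ _ _ (mr x)))))
    (fun n h => br_eq_zero.1 (hn n _ _ h)) y)

/-- The determinant of three vectors. -/
def det3 (u v w : Fin 3 → ZMod 3) : ZMod 3 :=
  u 0 * (v 1 * w 2 - v 2 * w 1) - u 1 * (v 0 * w 2 - v 2 * w 0) + u 2 * (v 0 * w 1 - v 1 * w 0)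

theorem struct {p q r a : Q} (hg : GenN p q r) (hbr : br p q r = a) (ha : a ≠ 0) :
    Nuc a ∧ ∃ π : Q → (Fin 3 → ZMod 3), (∀ x y, π (x + y) = π x + π y) ∧ Function.Surjective π ∧
      (∀ x y z, br x y z = sm (det3 (π x) (π y) (π z)) a) ∧ (∀ x, π x = 0 → Nuc x) := by
  have h3 : a + (a + a) = 0 := by rw [← hbr]; exact br_three p q r
  have na : Nuc a := by
    apply nuc_of_gen hg
    · rw [br_eq_zero, ← hbr]; exact fixa p q r
    · rw [br_eq_zero, ← hbr]; exact fixb p q r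
    · rw [br_swap, br_eq_zero.2, nzero]; rw [← hbr]; exact fixc p q r
  have hn : ∀ n x y : Q, Nuc n → br x y n = 0 := by
    intro n x y h; rw [br_cyc]; exact nuc_iff.1 h x y
  -- all brackets are multiples of `a`
  have subm : ∀ x y : Q, IsSub {z | ∃ k, br x y z = sm k a} := by
    intro x y
    have e : ∀ z k, br x y z = sm k a ↔ I x y z = z + sm k a := by
      intro z k; rw [I_br]; exact ⟨fun h => by rw [h], fun h => lcan h⟩
    refine ⟨⟨0, ?_⟩, ?_, ?_⟩
    · rw [e, sm_zero, I_zero, addz]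
    · rintro u v ⟨k, hk⟩ ⟨l, hl⟩
      refine ⟨k + l, ?_⟩
      rw [e] at *
      have n1 := nuc_sm na k
      have n2 := nuc_sm na l
      rw [I_add, hk, hl, sm_add h3, CIP.comm u, CIP.comm v, ← n1, n2.r, CIP.comm (u + v), ← n1]
    · rintro u ⟨k, hk⟩
      refine ⟨-k, ?_⟩
      rw [e] at *
      rw [I_neg, hk, CIP.neg_add', sm_neg]
  have hs : ∀ x y z, (∃ k, br x y z = sm k a) → ∃ k, br y x z = sm k a := by
    rintro x y z ⟨k, hk⟩; exact ⟨-k, by rw [br_swap, hk, sm_neg]⟩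
  have hc : ∀ x y z, (∃ k, br x y z = sm k a) → ∃ k, br z x y = sm k a := by
    rintro x y z ⟨k, hk⟩; exact ⟨k, by rw [← br_cyc, hk]⟩
  have h0 : ∀ x y z, br x y z = 0 → ∃ k, br x y z = sm k a := fun x y z h => ⟨0, by rw [h, sm_zero]⟩
  have hnn : ∀ x y n, Nuc n → ∃ k, br x y n = sm k a := fun x y n h => h0 _ _ _ (hn n x y h)
  have b1 : ∃ k, br p q r = sm k a := ⟨1, by rw [sm_one, hbr]⟩
  have c1 : ∀ z, ∃ k, br p q z = sm k a := hg _ (subm p q) (h0 _ _ _ (br_same3 _ _))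
    (h0 _ _ _ (br_same2 _ _)) b1 (fun n h => hnn _ _ n h)
  have c2 : ∀ z, ∃ k, br q r z = sm k a := hg _ (subm q r) (hc _ _ _ (hc _ _ _ b1))
    (h0 _ _ _ (br_same3 _ _)) (h0 _ _ _ (br_same2 _ _)) (fun n h => hnn _ _ n h)
  have c3 : ∀ z, ∃ k, br r p z = sm k a := hg _ (subm r p) (h0 _ _ _ (br_same2 _ _))
    (hc _ _ _ b1) (h0 _ _ _ (br_same3 _ _)) (fun n h => hnn _ _ n h)
  have d1 : ∀ z w, ∃ k, br z p w = sm k a := fun z => hg _ (subm z p) (h0 _ _ _ (br_same2 _ _))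
    (hc _ _ _ (c1 z)) (hc _ _ _ (hs _ _ _ (c3 z))) (fun n h => hnn _ _ n h)
  have d2 : ∀ z w, ∃ k, br z q w = sm k a := fun z => hg _ (subm z q) (hc _ _ _ (hs _ _ _ (c1 z)))
    (h0 _ _ _ (br_same2 _ _)) (hc _ _ _ (c2 z)) (fun n h => hnn _ _ n h)
  have d3 : ∀ z w, ∃ k, br z r w = sm k a := fun z => hg _ (subm z r) (hc _ _ _ (c3 z))
    (hc _ _ _ (hs _ _ _ (c2 z))) (h0 _ _ _ (br_same2 _ _)) (fun n h => hnn _ _ n h)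
  have all : ∀ x y z, ∃ k, br x y z = sm k a := fun x y => hg _ (subm x y)
    (hc _ _ _ (hc _ _ _ (hs _ _ _ (d1 x y)))) (hc _ _ _ (hc _ _ _ (hs _ _ _ (d2 x y))))
    (hc _ _ _ (hc _ _ _ (hs _ _ _ (d3 x y)))) (fun n h => hnn _ _ n h)
  choose B hB using all
  have Badd : ∀ x y u v, B x y (u + v) = B x y u + B x y v := by
    intro x y u v
    apply sm_inj h3 ha
    rw [← hB, sm_add h3, ← hB, ← hB]
    apply lcan (x := u + v)
    have n1 : Nuc (br x y u) := by rw [hB]; exact nuc_sm na _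
    have n2 : Nuc (br x y v) := by rw [hB]; exact nuc_sm na _
    rw [← I_br, I_add, I_br, I_br, CIP.comm u, CIP.comm v, ← n1, n2.r, CIP.comm (u + v), ← n1]
  have Bc : ∀ x y z, B z x y = B x y z := by
    intro x y z; apply sm_inj h3 ha; rw [← hB, ← hB, ← br_cyc]
  have Bs : ∀ x y z, B y x z = - B x y z := by
    intro x y z; apply sm_inj h3 ha; rw [← hB, sm_neg, ← hB, br_swap]
  have Bn : ∀ n x y, Nuc n → B x y n = 0 := by
    intro n x y h; apply sm_inj h3 ha; rw [← hB, sm_zero, hn n x y h]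
  have B0 : ∀ x y z, br x y z = 0 → B x y z = 0 := by
    intro x y z h; apply sm_inj h3 ha; rw [← hB, sm_zero, h]
  have Bneg : ∀ x y u, B x y (-u) = - B x y u := by
    intro x y u
    have := Badd x y (-u) u
    rw [nadd, Bn 0 _ _ nuc_zero] at this
    exact eq_neg_of_add_eq_zero_left this.symm
  have Bpqr : B p q r = 1 := by apply sm_inj h3 ha; rw [← hB, sm_one, hbr]
  let π : Q → (Fin 3 → ZMod 3) := fun m => ![B q r m, B r p m, B p q m]
  have πadd : ∀ x y, π (x + y) = π x + π y := by
    intro x y; simp only [π, Badd]; ext i; fin_cases i <;> rfl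
  have πneg : ∀ x, π (-x) = - π x := by
    intro x; simp only [π, Bneg]; ext i; fin_cases i <;> rfl
  have Bq : B q r p = 1 := by rw [← Bc, Bpqr]
  have Br : B r p q = 1 := by rw [Bc, Bpqr]
  have z2 : ∀ x z, B x z z = 0 := fun x z => B0 _ _ _ (br_same2 x z)
  have z3 : ∀ x z, B z x z = 0 := fun x z => B0 _ _ _ (br_same3 x z)
  have z1 : ∀ x z, B x x z = 0 := fun x z => B0 _ _ _ (br_same1 x z)
  have πp : π p = ![1, 0, 0] := by simp [π, Bq, z2, z3]
  have πq : π q = ![0, 1, 0] := by simp [π, Br, z2, z3]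
  have πr : π r = ![0, 0, 1] := by simp [π, Bpqr, z2, z3]
  have exp : ∀ x y z, B x y z = π z 0 * B x y p + π z 1 * B x y q + π z 2 * B x y r := by
    intro x y
    refine hg {z | B x y z = π z 0 * B x y p + π z 1 * B x y q + π z 2 * B x y r} ⟨?_, ?_, ?_⟩
      ?_ ?_ ?_ ?_
    · simp [π, Bn 0 _ _ nuc_zero]
    · intro u v hu hv
      simp only [Set.mem_setOf_eq] at *
      rw [Badd, hu, hv, πadd]; simp only [Pi.add_apply]; ring
    · intro u hu
      simp only [Set.mem_setOf_eq] at *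
      rw [Bneg, hu, πneg]; simp only [Pi.neg_apply]; ring
    · simp [πp]
    · simp [πq]
    · simp [πr]
    · intro n h
      simp [π, Bn n _ _ h]
  refine ⟨na, π, πadd, ?_, ?_, ?_⟩
  · intro v
    have hS : IsSub {x : Q | π x ∈ Set.range π} := ⟨⟨0, rfl⟩, fun _ _ => ⟨_, rfl⟩, fun _ => ⟨_, rfl⟩⟩
    have hsm : ∀ (k : ZMod 3) x, ∃ y, π y = k • π x := by
      intro k x
      rcases zmod3 k with rfl | rfl | rfl
      · exact ⟨0, by simp [π, Bn 0 _ _ nuc_zero]⟩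
      · exact ⟨x, by simp⟩
      · exact ⟨-x, by rw [πneg]; simp⟩
    obtain ⟨x1, h1⟩ := hsm (v 0) p
    obtain ⟨x2, h2⟩ := hsm (v 1) q
    obtain ⟨x3, h3⟩ := hsm (v 2) r
    refine ⟨(x1 + x2) + x3, ?_⟩
    rw [πadd, πadd, h1, h2, h3, πp, πq, πr]
    ext i; fin_cases i <;> simp
  · intro x y z
    rw [hB]
    congr 1
    unfold det3
    rw [exp x y z]
    have e2 : ∀ w, B x y w = π y 0 * B w x p + π y 1 * B w x q + π y 2 * B w x r := by
      intro w; rw [← Bc, exp]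
    have e3 : ∀ y w, B w x y = π x 0 * B y w p + π x 1 * B y w q + π x 2 * B y w r := by
      intro y w; rw [← Bc, exp]
    rw [e2 p, e2 q, e2 r]
    simp only [e3]
    have s1 : B q p r = -1 := by rw [Bs, Bpqr]
    have s2 : B p r q = -1 := by rw [Bs, Br]
    have s3 : B r q p = -1 := by rw [Bs, Bq]
    simp [z1, z2, z3, Bpqr, Bq, Br, s1, s2, s3]
    ring
  · intro x hx
    have e : B q r x = 0 ∧ B r p x = 0 ∧ B p q x = 0 := by
      have h0 := congrFun hx 0
      have h1 := congrFun hx 1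
      have h2 := congrFun hx 2
      exact ⟨h0, h1, h2⟩
    apply nuc_of_gen hg
    · rw [hB, e.2.2, sm_zero]
    · rw [hB, e.1, sm_zero]
    · rw [hB, e.2.1, sm_zero]
end OCML


namespace OCML
open CIP CML Equiv
variable {Q : Type} [OCML Q]

theorem sm_coe {S : Set Q} (h : IsSub S) (k : ZMod 3) (x : S) :
    (letI := h.ocml; (sm k x : S)).1 = sm k x.1 := by
  unfold sm; split_ifs <;> rfl

theorem sm_mem {S : Set Q} (h : IsSub S) (k : ZMod 3) {x : Q} (hx : x ∈ S) : sm k x ∈ S := by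
  unfold sm; split_ifs
  · exact h.zero
  · exact hx
  · exact h.neg hx

theorem mem_gen3 (p q r : Q) : p ∈ gen3 p q r ∧ q ∈ gen3 p q r ∧ r ∈ gen3 p q r :=
  ⟨fun _ _ a _ _ => a, fun _ _ _ b _ => b, fun _ _ _ _ c => c⟩

theorem br_mem {S : Set Q} (h : IsSub S) {x y z : Q} (hx : x ∈ S) (hy : y ∈ S) (hz : z ∈ S) :
    br x y z ∈ S := by
  unfold br; rw [I_apply]
  exact h.add (h.neg hz) (h.add (h.neg (h.add hx hy)) (h.add hx (h.add hy hz)))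

theorem structM {p q r a : Q} (hbr : br p q r = a) (ha : a ≠ 0) :
    ∃ π : Q → (Fin 3 → ZMod 3), (∀ x ∈ gen3 p q r, ∀ y ∈ gen3 p q r, π (x + y) = π x + π y) ∧
      (∀ v, ∃ x ∈ gen3 p q r, π x = v) ∧
      (∀ x ∈ gen3 p q r, ∀ y ∈ gen3 p q r, ∀ z ∈ gen3 p q r,
        br x y z = sm (det3 (π x) (π y) (π z)) a) ∧
      (∀ y ∈ gen3 p q r, ∀ z ∈ gen3 p q r, br a y z = 0) := by
  classical
  have hM := gen3_sub p q r
  obtain ⟨mp, mq, mr⟩ := mem_gen3 p q r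
  have ma : a ∈ gen3 p q r := by rw [← hbr]; exact br_mem hM mp mq mr
  letI := hM.ocml
  have hg : GenN (⟨p, mp⟩ : gen3 p q r) ⟨q, mq⟩ ⟨r, mr⟩ := by
    intro S hS h1 h2 h3 _ x
    have hS' : IsSub {x : Q | ∃ h : x ∈ gen3 p q r, (⟨x, h⟩ : gen3 p q r) ∈ S} := by
      refine ⟨⟨hM.zero, hS.zero⟩, ?_, ?_⟩
      · rintro x y ⟨h1, h2⟩ ⟨h3, h4⟩
        exact ⟨hM.add h1 h3, hS.add h2 h4⟩
      · rintro x ⟨h1, h2⟩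
        exact ⟨hM.neg h1, hS.neg h2⟩
    obtain ⟨_, h⟩ := x.2 _ hS' ⟨mp, h1⟩ ⟨mq, h2⟩ ⟨mr, h3⟩
    exact h
  obtain ⟨na, π, h1, h2, h3, h4⟩ := struct (a := (⟨a, ma⟩ : gen3 p q r)) hg (Subtype.ext hbr)
    (fun h => ha (congrArg Subtype.val h))
  refine ⟨fun x => if h : x ∈ gen3 p q r then π ⟨x, h⟩ else 0, ?_, ?_, ?_, ?_⟩
  · intro x hx y hy
    simp only [hx, hy, hM.add hx hy, dite_true]
    exact h1 ⟨x, hx⟩ ⟨y, hy⟩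
  · intro v
    obtain ⟨x, hx⟩ := h2 v
    exact ⟨x.1, x.2, by simp [hx]⟩
  · intro x hx y hy z hz
    have := congrArg Subtype.val (h3 ⟨x, hx⟩ ⟨y, hy⟩ ⟨z, hz⟩)
    rw [sm_coe] at this
    simp only [hx, hy, hz, dite_true]
    exact this
  · intro y hy z hz
    have := nuc_iff.1 na ⟨y, hy⟩ ⟨z, hz⟩
    exact congrArg Subtype.val this

theorem dep_of_det3 (u v : Fin 3 → ZMod 3) (hv : v ≠ 0) (h : ∀ w, det3 u v w = 0) :
    ∃ k : ZMod 3, u = k • v := by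
  have e0 := h ![1, 0, 0]
  have e1 := h ![0, 1, 0]
  have e2 := h ![0, 0, 1]
  simp [det3] at e0 e1 e2
  have key : ∀ a b c d e f : ZMod 3, (d ≠ 0 ∨ e ≠ 0 ∨ f ≠ 0) → a * e - b * d = 0 →
      a * f - c * d = 0 → b * f - c * e = 0 → ∃ k, a = k * d ∧ b = k * e ∧ c = k * f := by
    have sq : ∀ d : ZMod 3, d ≠ 0 → d * d = 1 := by decide
    intro a b c d e f h h1 h2 h3
    rcases h with h | h | h
    · exact ⟨a * d, by linear_combination (-a) * sq d h,
        by linear_combination (-b) * sq d h - d * h1, by linear_combination (-c) * sq d h - d * h2⟩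
    · exact ⟨b * e, by linear_combination (-a) * sq e h + e * h1,
        by linear_combination (-b) * sq e h, by linear_combination (-c) * sq e h - e * h3⟩
    · exact ⟨c * f, by linear_combination (-a) * sq f h + f * h2,
        by linear_combination (-b) * sq f h + f * h3, by linear_combination (-c) * sq f h⟩
  obtain ⟨k, h0, h1, h2⟩ := key (u 0) (u 1) (u 2) (v 0) (v 1) (v 2)
    (by
      by_contra hc
      push Not at hc
      apply hv; ext i; fin_cases i
      · exact hc.1
      · exact hc.2.1
      · exact hc.2.2)
    (by linear_combination e2) (by linear_combination -e1) (by linear_combination e0)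
  exact ⟨k, by ext i; fin_cases i <;> simpa⟩

theorem det3_add (u v w w' : Fin 3 → ZMod 3) : det3 u v (w + w') = det3 u v w + det3 u v w' := by
  simp only [det3, Pi.add_apply]; ring
theorem det3_smul (u v w : Fin 3 → ZMod 3) (k : ZMod 3) : det3 u v (k • w) = k * det3 u v w := by
  simp only [det3, Pi.smul_apply, smul_eq_mul]; ring
theorem det3_r (u v : Fin 3 → ZMod 3) : det3 u v v = 0 := by simp only [det3]; ring
theorem det3_l (u v : Fin 3 → ZMod 3) : det3 u v u = 0 := by simp only [det3]; ring
theorem det3_same (v w : Fin 3 → ZMod 3) : det3 v v w = 0 := by simp only [det3]; ring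
theorem det3_cyc (u v w : Fin 3 → ZMod 3) : det3 u v w = det3 v w u := by simp only [det3]; ring
theorem det3_addl (u u' v w : Fin 3 → ZMod 3) : det3 (u + u') v w = det3 u v w + det3 u' v w := by
  simp only [det3, Pi.add_apply]; ring

/-- Cramer expansion -/
theorem det3_exp (u v w x : Fin 3 → ZMod 3) (h : det3 u v w = 1) :
    x = det3 v w x • u + det3 w u x • v + det3 u v x • w := by
  have e : ∀ i, x i * det3 u v w =
      (det3 v w x • u + det3 w u x • v + det3 u v x • w) i := by
    intro i
    simp only [det3, Pi.add_apply, Pi.smul_apply, smul_eq_mul]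
    fin_cases i <;> simp only [Fin.zero_eta, Fin.mk_one, Fin.reduceFinMk] <;> ring
  ext i
  rw [← e, h, mul_one]

theorem Ibr_add {x y u v : Q} (h : br x y u = 0) : I x y (u + v) = u + (v + br x y v) := by
  rw [I_add, br_eq_zero.1 h, I_br]

section D

theorem M_card [Finite Q] (hc : Nat.card Q = 243) {p q r a : Q} (hbr : br p q r = a) (ha : a ≠ 0)
    {t0 : Q} (ht0 : t0 ∉ gen3 p q r) : Nat.card (gen3 p q r) = 81 ∧
    ∃ π : Q → (Fin 3 → ZMod 3), (∀ x ∈ gen3 p q r, ∀ y ∈ gen3 p q r, π (x + y) = π x + π y) ∧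
      (∀ v, ∃ x ∈ gen3 p q r, π x = v) ∧
      (∀ x ∈ gen3 p q r, ∀ y ∈ gen3 p q r, ∀ z ∈ gen3 p q r,
        br x y z = sm (det3 (π x) (π y) (π z)) a) ∧
      (∀ y ∈ gen3 p q r, ∀ z ∈ gen3 p q r, br a y z = 0) ∧
      (∀ x ∈ gen3 p q r, π x = 0 ↔ ∃ k, x = sm k a) := by
  classical
  obtain ⟨π, h1, h2, h3, h4⟩ := structM hbr ha
  have hM := gen3_sub p q r
  obtain ⟨mp, mq, mr⟩ := mem_gen3 p q r
  have ma : a ∈ gen3 p q r := by rw [← hbr]; exact br_mem hM mp mq mr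
  have t3 : a + (a + a) = 0 := by rw [← hbr]; exact br_three p q r
  have π0 : π 0 = 0 := by
    have := h1 0 hM.zero 0 hM.zero
    rw [zadd] at this; simpa using this
  have πneg : ∀ x ∈ gen3 p q r, π (-x) = - π x := by
    intro x hx
    have := h1 _ (hM.neg hx) x hx
    rw [nadd, π0] at this
    exact eq_neg_of_add_eq_zero_left this.symm
  have πa : π a = 0 := by
    by_contra hne
    obtain ⟨y, hy, ey⟩ := h2 (if π a 0 ≠ 0 then ![0, 1, 0] else if π a 1 ≠ 0 then ![0, 0, 1] else ![1, 0, 0])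
    obtain ⟨z, hz, ez⟩ := h2 (if π a 0 ≠ 0 then ![0, 0, 1] else if π a 1 ≠ 0 then ![1, 0, 0] else ![0, 1, 0])
    have e := h3 a ma y hy z hz
    rw [h4 y hy z hz] at e
    have := sm_eq_zero ha e.symm
    rw [ey, ez] at this
    by_cases c0 : π a 0 = 0
    · by_cases c1 : π a 1 = 0
      · by_cases c2 : π a 2 = 0
        · apply hne; ext i; fin_cases i
          · exact c0
          · exact c1
          · exact c2
        · simp [c0, c1, c2, det3] at this
      · simp [c0, c1, det3] at this
    · simp [c0, det3] at this
  have πsm : ∀ k, π (sm k a) = 0 := by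
    intro k
    rcases zmod3 k with rfl | rfl | rfl
    · rw [sm_zero, π0]
    · rw [sm_one, πa]
    · rw [sm_neg_one, πneg a ma, πa, neg_zero]
  choose s0 hs0 es0 using h2
  let s : (Fin 3 → ZMod 3) → Q := fun v => if v = 0 then 0 else s0 v
  have hs : ∀ v, s v ∈ gen3 p q r := by
    intro v; by_cases h : v = 0
    · simp only [s, h, if_true]; exact hM.zero
    · simp only [s, h, if_false]; exact hs0 v
  have es : ∀ v, π (s v) = v := by
    intro v; by_cases h : v = 0
    · simp only [s, h, if_true]; exact π0
    · simp only [s, h, if_false]; exact es0 v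
  let F : (Fin 3 → ZMod 3) × ZMod 3 → gen3 p q r := fun w =>
    ⟨s w.1 + sm w.2 a, hM.add (hs _) (sm_mem hM _ ma)⟩
  have πF : ∀ w, π (F w).1 = w.1 := by
    intro w
    simp only [F]
    rw [h1 _ (hs _) _ (sm_mem hM _ ma), πsm, es, add_zero]
  have Finj : Function.Injective F := by
    rintro ⟨v, k⟩ ⟨v', k'⟩ h
    have e := πF (v, k)
    rw [h, πF] at e
    simp only at e
    subst e
    have e2 := congrArg Subtype.val h
    simp only [F] at e2
    rw [sm_inj t3 ha (lcan e2)]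
  have c1 := Nat.card_le_card_of_injective F Finj
  have cV : Nat.card ((Fin 3 → ZMod 3) × ZMod 3) = 81 := by
    simp [Nat.card_eq_fintype_card]
  have c2 := sub_card hM (T := Set.univ) ⟨trivial, fun _ _ => trivial, fun _ => trivial⟩
    (Set.subset_univ _) (Set.mem_univ t0) ht0
  rw [Nat.card_univ, hc] at c2
  have cM : Nat.card (gen3 p q r) = 81 := by omega
  refine ⟨cM, π, h1, fun v => ⟨s v, hs v, es v⟩, h3, h4, ?_⟩
  intro x hx
  constructor
  · intro hx0
    have Fb : Function.Surjective F := ((Nat.bijective_iff_injective_and_card F).2 ⟨Finj, by rw [cV, cM]⟩).2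
    obtain ⟨w, hw⟩ := Fb ⟨x, hx⟩
    have e := πF w
    rw [hw] at e
    simp only [hx0] at e
    have e2 := congrArg Subtype.val hw
    simp only [F, ← e, s, if_true] at e2
    rw [zadd] at e2
    exact ⟨_, e2.symm⟩
  · rintro ⟨k, rfl⟩; exact πsm k

theorem fix_univ [Finite Q] (hc : Nat.card Q = 243) {p q r a : Q} (hbr : br p q r = a) (ha : a ≠ 0)
    {t0 : Q} (ht0 : t0 ∉ gen3 p q r) {S : Set Q} (hS : IsSub S) (hp : p ∈ S) (hq : q ∈ S) (hr : r ∈ S) {t : Q}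
    (ht : t ∈ S) (ht' : t ∉ gen3 p q r) (x : Q) : x ∈ S := by
  by_contra hx
  have c := (M_card hc hbr ha ht0).1
  have c1 := sub_card (gen3_sub p q r) hS (fun y hy => hy S hS hp hq hr) ht ht'
  have c2 := sub_card hS (T := Set.univ) ⟨trivial, fun _ _ => trivial, fun _ => trivial⟩
    (Set.subset_univ _) (Set.mem_univ x) hx
  rw [Nat.card_univ, hc] at c2
  omega

theorem fix_M [Finite Q] (hc : Nat.card Q = 243) {p q r a : Q} (hbr : br p q r = a) (ha : a ≠ 0)
    {t0 : Q} (ht0 : t0 ∉ gen3 p q r) {S : Set Q} (hS : IsSub S) (hp : p ∈ S) (hq : q ∈ S) (hr : r ∈ S) {t : Q}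
    (ht : t ∉ S) {x : Q} (hx : x ∈ S) : x ∈ gen3 p q r := by
  by_contra h
  exact ht (fix_univ hc hbr ha ht0 hS hp hq hr hx h t)

theorem lemD [Finite Q] (hc : Nat.card Q = 243) {p q r a : Q} (hbr : br p q r = a) (ha : a ≠ 0)
    {t0 : Q} (ht0 : t0 ∉ gen3 p q r) : Nuc a := by
  obtain ⟨cM, π, h1, h2, h3, h4, h5⟩ := M_card hc hbr ha ht0
  have hM := gen3_sub p q r
  obtain ⟨mp, mq, mr⟩ := mem_gen3 p q r
  have ma : a ∈ gen3 p q r := by rw [← hbr]; exact br_mem hM mp mq mr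
  have t3 : a + (a + a) = 0 := by rw [← hbr]; exact br_three p q r
  have nz : ∀ x y z : Q, br x y z = 0 → br y x z = 0 := by
    intro x y z h; rw [br_swap, h, nzero]
  have nz' : ∀ x y z : Q, br x y z = 0 → br x z y = 0 := by
    intro x y z h; rw [br_swap', h, nzero]
  have cz : ∀ x y z : Q, br x y z = 0 → br z x y = 0 := by
    intro x y z h; rw [← br_cyc, h]
  have π0 : π 0 = 0 := by
    have := h1 0 hM.zero 0 hM.zero
    rw [zadd] at this; simpa using this
  have πneg : ∀ x ∈ gen3 p q r, π (-x) = - π x := by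
    intro x hx
    have := h1 _ (hM.neg hx) x hx
    rw [nadd, π0] at this
    exact eq_neg_of_add_eq_zero_left this.symm
  have πsm : ∀ k, ∀ x ∈ gen3 p q r, π (sm k x) = k • π x := by
    intro k x hx
    rcases zmod3 k with rfl | rfl | rfl
    · rw [sm_zero, π0, zero_smul]
    · rw [sm_one, one_smul]
    · rw [sm_neg_one, πneg x hx]; simp
  have πa : π a = 0 := (h5 a ma).2 ⟨1, (sm_one a).symm⟩
  suffices key : ∀ t, ∀ m ∈ gen3 p q r, br a t m = 0 by
    rw [nuc_iff]
    intro t u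
    by_cases ht : t ∈ gen3 p q r
    · exact nz' _ _ _ (key u t ht)
    · have := fix_univ hc hbr ha ht0 (IsSub.fix a t) (br_eq_zero.1 (key t p mp))
        (br_eq_zero.1 (key t q mq)) (br_eq_zero.1 (key t r mr)) (t := t) (I_fix_right a t) ht u
      exact br_eq_zero.2 this
  intro t
  have Dm : ∀ m ∈ gen3 p q r, br a t m ∈ gen3 p q r := by
    intro m hm
    by_cases h0 : br a t m = 0
    · rw [h0]; exact hM.zero
    · refine fix_M hc hbr ha ht0 (IsSub.fix a m) (br_eq_zero.1 (h4 m hm p mp))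
        (br_eq_zero.1 (h4 m hm q mq)) (br_eq_zero.1 (h4 m hm r mr)) (t := t) ?_ (fixc a t m)
      intro h
      exact h0 (nz' _ _ _ (br_eq_zero.2 h))
  have Da : ∀ m ∈ gen3 p q r, π (br a t m) = 0 → br a t m = 0 := by
    intro m hm h
    obtain ⟨k, hk⟩ := (h5 _ (Dm m hm)).1 h
    rcases zmod3 k with rfl | rfl | rfl
    · rw [hk, sm_zero]
    · have f := fixb a t m
      rw [hk, sm_one] at f
      exact cz _ _ _ (br_eq_zero.2 f)
    · have f := fixb a t m
      rw [hk, sm_neg_one, I_neg] at f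
      exact cz _ _ _ (br_eq_zero.2 (neg_inj' f))
  have κM : ∀ m ∈ gen3 p q r, I a t m ∈ gen3 p q r := by
    intro m hm; rw [I_br]; exact hM.add hm (Dm m hm)
  have κπ : ∀ m ∈ gen3 p q r, π (I a t m) = π m + π (br a t m) := by
    intro m hm; rw [I_br, h1 _ hm _ (Dm m hm)]
  have κsm : ∀ k x, I a t (sm k x) = sm k (I a t x) := by
    intro k x
    rcases zmod3 k with rfl | rfl | rfl
    · rw [sm_zero, sm_zero, I_zero]
    · rw [sm_one, sm_one]
    · rw [sm_neg_one, sm_neg_one, I_neg]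
  have Eadd : ∀ x ∈ gen3 p q r, ∀ y ∈ gen3 p q r, π (br a t (x + y)) = π (br a t x) + π (br a t y) := by
    intro x hx y hy
    have e := κπ _ (hM.add hx hy)
    rw [I_add, h1 _ (κM x hx) _ (κM y hy), κπ x hx, κπ y hy, h1 x hx y hy] at e
    have : ∀ a b c d e : Fin 3 → ZMod 3, a + c + (b + d) = a + b + e → e = c + d := by
      intro a b c d e h
      have : a + b + (c + d) = a + b + e := by rw [← h]; abel
      exact (add_left_cancel this).symm
    exact this _ _ _ _ _ e
  have Esm : ∀ k, ∀ x ∈ gen3 p q r, π (br a t (sm k x)) = k • π (br a t x) := by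
    intro k x hx
    have e := κπ _ (sm_mem hM k hx)
    rw [κsm, πsm _ _ (κM x hx), κπ x hx, πsm _ _ hx, smul_add] at e
    exact (add_left_cancel e).symm
  have Eπ : ∀ x ∈ gen3 p q r, π x = 0 → br a t x = 0 := by
    intro x hx h
    obtain ⟨k, rfl⟩ := (h5 x hx).1 h
    rw [br_eq_zero, κsm, I_fix_left]
  have DD : ∀ m, br a t (br a t m) = 0 := fun m => br_eq_zero.2 (fixa a t m)
  intro x hx
  by_contra hd
  set d := br a t x with hdd
  have md : d ∈ gen3 p q r := Dm x hx
  have πd : π d ≠ 0 := fun h => hd (Da x hx h)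
  have hw : ∃ w, det3 (π x) (π d) w ≠ 0 := by
    by_contra hcon
    push Not at hcon
    obtain ⟨k, hk⟩ := dep_of_det3 _ _ πd hcon
    have m1 : x + sm (-k) d ∈ gen3 p q r := hM.add hx (sm_mem hM _ md)
    have e1 : π (x + sm (-k) d) = 0 := by
      rw [h1 _ hx _ (sm_mem hM _ md), πsm _ _ md, hk]; simp
    have e2 := Eπ _ m1 e1
    have e3 := Eadd x hx _ (sm_mem hM (-k) md)
    rw [e2, Esm _ _ md, DD, π0, smul_zero, add_zero] at e3
    exact πd e3.symm
  obtain ⟨w0, hw0⟩ := hw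
  obtain ⟨w, mw, ew⟩ := h2 (det3 (π x) (π d) w0 • w0)
  have dw : det3 (π x) (π d) (π w) = 1 := by
    rw [ew, det3_smul]
    revert hw0; generalize det3 (π x) (π d) w0 = k; revert k; decide
  set f := br a t w with hf
  have mf : f ∈ gen3 p q r := Dm w mw
  have brd : br x d w = a := by rw [h3 x hx d md w mw, dw, sm_one]
  have df : det3 (π x) (π d) (π f) = 0 := by
    have e : I a t (br x d w) = br (I a t x) (I a t d) (I a t w) := by
      have := congrArg (fun g : Perm Q => g w) (conj_I (I a t) (I_add a t) x d)
      simp only [Perm.mul_apply] at this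
      unfold br
      rw [I_add, I_neg, this]
    rw [brd, I_fix_left, br_eq_zero.1 (DD x), h3 _ (κM x hx) d md _ (κM w mw), κπ x hx, κπ w mw] at e
    have e2 := sm_inj t3 ha ((sm_one a).trans e)
    rw [det3_addl, det3_same, add_zero, det3_add, dw] at e2
    exact (left_eq_add.1 e2)
  have ef := det3_exp (π x) (π d) (π w) (π f) dw
  rw [df, zero_smul, add_zero] at ef
  set i := det3 (π d) (π w) (π f)
  set j := det3 (π w) (π x) (π f)
  have mxd : sm i x + sm j d ∈ gen3 p q r := hM.add (sm_mem hM _ hx) (sm_mem hM _ md)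
  have i0 : i = 0 := by
    have m1 : f + -(sm i x + sm j d) ∈ gen3 p q r := hM.add mf (hM.neg mxd)
    have e1 : π (f + -(sm i x + sm j d)) = 0 := by
      rw [h1 _ mf _ (hM.neg mxd), πneg _ mxd, h1 _ (sm_mem hM _ hx) _ (sm_mem hM _ md),
        πsm _ _ hx, πsm _ _ md, ef, add_neg_cancel]
    have e2 := Eπ _ m1 e1
    have e3 := Eadd _ m1 _ mxd
    have e4 : (f + -(sm i x + sm j d)) + (sm i x + sm j d) = f := by
      rw [CIP.comm, CIP.comm f, anc]
    rw [e4, e2, DD, π0, zero_add, Eadd _ (sm_mem hM _ hx) _ (sm_mem hM _ md), Esm _ _ hx,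
      Esm _ _ md, DD, π0, smul_zero, add_zero] at e3
    rcases smul_eq_zero.1 e3.symm with h | h
    · exact h
    · exact absurd h πd
  rw [i0, zero_smul, zero_add] at ef
  set w' := w + sm (-j) x with hw'
  have mw' : w' ∈ gen3 p q r := hM.add mw (sm_mem hM _ hx)
  have Dw' : br a t w' = 0 := by
    apply Da _ mw'
    rw [Eadd _ mw _ (sm_mem hM _ hx), Esm _ _ hx, ← hf, ef]; simp [← hdd]
  have brw' : br x d w' = a := by
    rw [h3 x hx d md w' mw', h1 _ mw _ (sm_mem hM _ hx), πsm _ _ hx, det3_add, det3_smul, det3_l,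
      dw, mul_zero, add_zero, sm_one]
  have brdt : br d x t = 0 := by
    have := fixb a t x
    rw [← hdd] at this
    exact nz' _ _ _ (cz _ _ _ (br_eq_zero.2 this))
  have e1 : br d x (w' + t) = -a := by
    unfold br
    rw [I_add, br_eq_zero.1 brdt, I_br, br_swap, brw']
    have e2 : I t w' (-a) = -a := by
      rw [I_neg, br_eq_zero.1 (cz _ _ _ (cz _ _ _ Dw'))]
    have e3 : (w' + -a) + t = (w' + t) + -a := by
      rw [CIP.comm _ t, add_I, e2, CIP.comm t]
    rw [e3, nac]
  have e4 : br a x (w' + t) = 0 := by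
    have := fixb d x (w' + t)
    rw [e1, I_neg] at this
    exact cz _ _ _ (br_eq_zero.2 (neg_inj' this))
  have e5 := br_eq_zero.1 e4
  rw [Ibr_add (h4 x hx w' mw')] at e5
  have e6 := lcan e5
  have e7 : br a x t = 0 := lcan (x := t) (by rw [e6, addz])
  exact hd (nz' _ _ _ e7)
end D

theorem lemD' [Finite Q] (hc : Nat.card Q = 243) (p q r : Q) : Nuc (br p q r) := by
  by_cases ha : br p q r = 0
  · rw [ha]; exact nuc_zero
  by_cases hu : ∃ t, t ∉ gen3 p q r
  · obtain ⟨t, ht⟩ := hu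
    exact lemD hc rfl ha ht
  · push Not at hu
    exact (struct (p := p) (q := q) (r := r) (fun S hS h1 h2 h3 _ x => hu x S hS h1 h2 h3) rfl ha).1

theorem exists_gen [Finite Q] (hc : Nat.card Q = 243) {p q r : Q} (ha : br p q r ≠ 0) :
    GenN p q r := by
  by_cases hu : ∃ t, t ∉ gen3 p q r
  swap
  · push Not at hu
    exact (fun S hS h1 h2 h3 _ x => hu x S hS h1 h2 h3)
  obtain ⟨t, ht⟩ := hu
  suffices h : ∃ n, Nuc n ∧ n ∉ gen3 p q r by
    obtain ⟨n, hn, hn'⟩ := h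
    intro S hS h1 h2 h3 h4 x
    exact fix_univ hc rfl ha ht hS h1 h2 h3 (h4 n hn) hn' x
  by_contra hcon
  push Not at hcon
  obtain ⟨cM, π, h1, h2, h3, h4, h5⟩ := M_card hc rfl ha ht
  set a := br p q r with haa
  have hM := gen3_sub p q r
  obtain ⟨mp, mq, mr⟩ := mem_gen3 p q r
  have ma : a ∈ gen3 p q r := br_mem hM mp mq mr
  have t3 : a + (a + a) = 0 := br_three p q r
  have nz : ∀ x y z : Q, br x y z = 0 → br y x z = 0 := by
    intro x y z h; rw [br_swap, h, nzero]
  have nz' : ∀ x y z : Q, br x y z = 0 → br x z y = 0 := by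
    intro x y z h; rw [br_swap', h, nzero]
  have cz : ∀ x y z : Q, br x y z = 0 → br z x y = 0 := by
    intro x y z h; rw [← br_cyc, h]
  have d1 : det3 (π p) (π q) (π r) = 1 := by
    have := h3 p mp q mq r mr
    rw [← haa] at this
    exact (sm_inj t3 ha ((sm_one a).trans this)).symm
  have hk : ∀ x ∈ gen3 p q r, ∀ y ∈ gen3 p q r, ∃ k, br x y t = sm k a := by
    intro x hx y hy
    have hn := lemD' hc x y t
    have hm := hcon _ hn
    rw [← h5 _ hm]
    have hz : ∀ y' ∈ gen3 p q r, ∀ z' ∈ gen3 p q r, det3 (π y') (π z') (π (br x y t)) = 0 := by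
      intro y' hy' z' hz'
      have e := h3 y' hy' z' hz' _ hm
      rw [br_cyc, nuc_iff.1 hn] at e
      exact sm_eq_zero ha e.symm
    rw [det3_exp _ _ _ (π (br x y t)) d1, hz _ mp _ mq, hz _ mq _ mr, hz _ mr _ mp]
    simp
  obtain ⟨k1, e1⟩ := hk q mq r mr
  obtain ⟨k2, e2⟩ := hk r mr p mp
  obtain ⟨k3, e3⟩ := hk p mp q mq
  obtain ⟨m, mm, em⟩ := h2 (k1 • π p + k2 • π q + k3 • π r)
  have na : Nuc a := lemD' hc p q r
  have d2 : det3 (π q) (π r) (π p) = 1 := by rw [← det3_cyc, d1]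
  have d3 : det3 (π r) (π p) (π q) = 1 := by rw [det3_cyc, d1]
  have f1 : br q r m = sm k1 a := by
    rw [h3 q mq r mr m mm, em]; simp only [det3_add, det3_smul, d2, det3_l, det3_r]; simp
  have f2 : br r p m = sm k2 a := by
    rw [h3 r mr p mp m mm, em]; simp only [det3_add, det3_smul, d3, det3_l, det3_r]; simp
  have f3 : br p q m = sm k3 a := by
    rw [h3 p mp q mq m mm, em]; simp only [det3_add, det3_smul, d1, det3_l, det3_r]; simp
  have g : ∀ x y k, br x y t = sm k a → br x y m = sm k a → br x y (t + -m) = 0 := by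
    intro x y k g1 g2
    have nk := nuc_sm na k
    rw [br_eq_zero, I_add, I_neg, I_br, I_br, g1, g2, CIP.neg_add', CIP.comm t, CIP.comm (-m), ← nk,
      nk.neg.r, anc]
  have z1 := g q r k1 e1 f1
  have z2 := g r p k2 e2 f2
  have z3 := g p q k3 e3 f3
  set t' := t + -m with ht'
  have mt' : t' ∉ gen3 p q r := by
    intro h
    apply ht
    have : t' + m = t := by rw [ht', CIP.comm, CIP.comm t, anc]
    rw [← this]
    exact hM.add h mm
  have FU : ∀ x, br x t' p = 0 → br x t' q = 0 → br x t' r = 0 → ∀ u, br x t' u = 0 := by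
    intro x u1 u2 u3 u
    exact br_eq_zero.2 (fix_univ hc haa.symm ha ht (IsSub.fix x t') (br_eq_zero.1 u1)
      (br_eq_zero.1 u2) (br_eq_zero.1 u3) (t := t') (I_fix_right x t') mt' u)
  have up := FU p (br_same3 _ _) (nz' _ _ _ z3) (nz' _ _ _ (nz _ _ _ z2))
  have uq := FU q (nz' _ _ _ (nz _ _ _ z3)) (br_same3 _ _) (nz' _ _ _ z1)
  have ur := FU r (nz' _ _ _ z2) (nz' _ _ _ (nz _ _ _ z1)) (br_same3 _ _)
  apply mt'
  apply hcon
  rw [nuc_iff]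
  intro x y
  apply nz
  have sw : ∀ p x, br p t' x = 0 → br x t' p = 0 := by
    intro p x h
    exact nz _ _ _ (cz _ _ _ (cz _ _ _ h))
  exact FU x (sw _ _ (up x)) (sw _ _ (uq x)) (sw _ _ (ur x)) y

end OCML


abbrev V3 := Fin 3 → ZMod 3
def DD (x y : V3) : ZMod 3 := (x 2 - y 2) * (x 0 * y 1 - x 1 * y 0)

/-- Linear presentation of a trimedial quasigroup of order 243. -/
structure QRep (G : Type) [AddCommGroup G] where
  π : G →+ V3
  τ : Fin 3 → G →+ G
  a : ZMod 3 →+ G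
  c : G
  πsurj : Function.Surjective π
  πτ : ∀ i x, π (τ i x) = 0
  τa : ∀ i k, τ i (a k) = 0
  πa : ∀ k, π (a k) = 0
  πc : π c = 0
  ainj : Function.Injective a
  comm : ∀ i j x, τ i (τ j x) = τ j (τ i x)
  three : ∀ x, τ 1 x + τ 2 x - τ 0 x = x + x + x
  inj1 : ∀ x, τ 1 x = x → x = 0
  inj2 : ∀ x, τ 2 x = x → x = 0
  card : Nat.card G = 243

def QRep.mul {G : Type} [AddCommGroup G] (R : QRep G) (x y : G) : G :=
  (R.τ 1 x - x) + (R.τ 2 y - y) + R.c + R.a (DD (R.π x) (R.π y))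

theorem z3three (x : ZMod 3) : x + x + x = 0 := by revert x; decide

theorem DD_symm (x y : V3) : DD x y = DD y x := by unfold DD; ring
theorem DD_assoc (x y z : V3) :
    OCML.det3 x y z + (DD y z + DD x (y + z)) = DD x y + DD (x + y) z := by
  simp only [DD, OCML.det3, Pi.add_apply]
  have h : (3 : ZMod 3) = 0 := by decide
  linear_combination (-(x 0 * y 2 * z 1) + y 2 * x 1 * z 0) * h
theorem DD_neg (x y : V3) : DD (-x) (-y) = - DD x y := by
  simp only [DD, Pi.neg_apply]; ring
theorem DD_zero_left (y : V3) : DD 0 y = 0 := by simp [DD]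
theorem DD_zero_right (y : V3) : DD y 0 = 0 := by simp [DD]
theorem DD_neg_self (x : V3) : DD (-x) x = 0 := by simp only [DD, Pi.neg_apply]; ring

namespace CML
open CIP Equiv
variable {Q : Type}

@[reducible] def toOCML [i : CML Q] [Finite Q] (hc : Nat.card Q = 243) : OCML Q :=
  { i with
    odd := by
      intro t ht
      classical
      have := Fintype.ofFinite Q
      let T : Function.End Q := fun x => t + x
      have h2 : T ^ (2 ^ 1) = 1 := by
        rw [pow_one, pow_two]
        funext x
        change t + (t + x) = x
        rw [← add_self_add, ht, zadd]
      have := Fact.mk Nat.prime_two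
      have h := Equiv.Perm.card_fixedPoints_modEq (p := 2) h2
      have h3 : Fintype.card Q = 243 := by rw [← Nat.card_eq_fintype_card, hc]
      rw [h3] at h
      have h4 : Fintype.card (Function.fixedPoints T) ≠ 0 := by
        intro h0; rw [h0] at h; revert h; decide
      replace h4 := Fintype.card_pos_iff.1 (Nat.pos_of_ne_zero h4)
      obtain ⟨x, hx⟩ := h4
      have hx : t + x = x := hx
      exact rcan (x := x) (by rw [hx, zadd]) }
end CML

theorem mk_rep {G : Type} [AddCommGroup G] (card : Nat.card G = 243) (π : G → V3)
    (πadd : ∀ x y, π (x + y) = π x + π y) (πsurj : Function.Surjective π) (Φ Ψ : Equiv.Perm G)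
    (Φa : ∀ x y, Φ (x + y) = Φ x + Φ y) (Ψa : ∀ x y, Ψ (x + y) = Ψ x + Ψ y)
    (πΦ : ∀ x, π (Φ x) = - π x) (πΨ : ∀ x, π (Ψ x) = - π x) (ΦΨ : ∀ x, Φ (Ψ x) = Ψ (Φ x))
    (s : ZMod 3 → G) (s0 : s 0 = 0) (sadd : ∀ k l, s (k + l) = s k + s l) (sinj : ∀ k l, s k = s l → k = l)
    (πs : ∀ k, π (s k) = 0) (Φs : ∀ k, Φ (s k) = s (-k)) (Ψs : ∀ k, Ψ (s k) = s (-k))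
    (c : G) (πc : π c = 0) :
    ∃ R : QRep G, ∀ x y, R.mul x y = Φ x + Ψ y + c + s (DD (π x) (π y)) := by
  have hpi3 : ∀ v : V3, v + v + v = 0 := by
    intro v; ext i; exact z3three (v i)
  let p : G →+ V3 := AddMonoidHom.mk' π πadd
  let A : G →+ G := AddMonoidHom.mk' Φ Φa + AddMonoidHom.id G
  let B : G →+ G := AddMonoidHom.mk' Ψ Ψa + AddMonoidHom.id G
  let C : G →+ G := A + B - (AddMonoidHom.id G + AddMonoidHom.id G + AddMonoidHom.id G)
  have hA : ∀ x, A x = Φ x + x := fun _ => rfl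
  have hB : ∀ x, B x = Ψ x + x := fun _ => rfl
  have hC : ∀ x, C x = A x + B x - (x + x + x) := fun _ => rfl
  have sn : ∀ k, s (-k) + s k = 0 := fun k => by rw [← sadd, neg_add_cancel, s0]
  have πA : ∀ x, p (A x) = 0 := by
    intro x; rw [hA, map_add]; change π (Φ x) + π x = 0; rw [πΦ, neg_add_cancel]
  have πB : ∀ x, p (B x) = 0 := by
    intro x; rw [hB, map_add]; change π (Ψ x) + π x = 0; rw [πΨ, neg_add_cancel]
  have sA : ∀ k, A (s k) = 0 := by intro k; rw [hA, Φs, sn]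
  have sB : ∀ k, B (s k) = 0 := by intro k; rw [hB, Ψs, sn]
  have s3 : ∀ k, s k + s k + s k = 0 := by
    intro k; rw [← sadd, ← sadd, z3three, s0]
  have AB : ∀ x, A (B x) = B (A x) := by
    intro x; rw [hA, hB, hB, hA, Φa, Ψa, ΦΨ]; abel
  have AC : ∀ x, A (C x) = C (A x) := by
    intro x; simp only [hC, map_add, map_sub, AB]
  have BC : ∀ x, B (C x) = C (B x) := by
    intro x; simp only [hC, map_add, map_sub, AB]
  have Φz : Φ 0 = 0 := by simpa using Φa 0 0
  have Ψz : Ψ 0 = 0 := by simpa using Ψa 0 0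
  refine ⟨{ π := p, τ := ![C, A, B], a := AddMonoidHom.mk' s sadd, c := c, πsurj := πsurj
            πτ := ?_, τa := ?_, πa := πs, πc := πc, ainj := fun k l h => sinj k l h
            comm := ?_, three := ?_, inj1 := ?_, inj2 := ?_, card := card }, ?_⟩
  · intro i x
    fin_cases i
    · change p (C x) = 0
      rw [hC, map_sub, map_add, map_add, map_add, hpi3, πA, πB]; simp
    · exact πA x
    · exact πB x
  · intro i k
    fin_cases i
    · change C (s k) = 0
      rw [hC, sA, sB, s3]; simp
    · exact sA k
    · exact sB k
  · intro i j x
    fin_cases i <;> fin_cases j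
    · rfl
    · exact (AC x).symm
    · exact (BC x).symm
    · exact AC x
    · rfl
    · exact AB x
    · exact BC x
    · exact (AB x).symm
    · rfl
  · intro x
    change A x + B x - C x = _
    rw [hC]; abel
  · intro x h
    have h : Φ x + x = x := h
    apply Φ.injective
    rw [Φz]; exact add_eq_right.1 h
  · intro x h
    have h : Ψ x + x = x := h
    apply Ψ.injective
    rw [Ψz]; exact add_eq_right.1 h
  · intro x y
    change (Φ x + x - x) + (Ψ y + y - y) + c + s (DD (π x) (π y)) = _
    rw [add_sub_cancel_right, add_sub_cancel_right]

namespace OCML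
open CIP CML
variable {Q : Type} [OCML Q]

theorem det3_nondeg (u : V3) (h : ∀ v w, det3 u v w = 0) : u = 0 := by
  have h0 := h ![0, 1, 0] ![0, 0, 1]
  have h1 := h ![0, 0, 1] ![1, 0, 0]
  have h2 := h ![1, 0, 0] ![0, 1, 0]
  simp [det3] at h0 h1 h2
  ext i; fin_cases i
  · exact h0
  · exact h1
  · exact h2

/-- main structure theorem, abelian group form -/
theorem to_rep {Φ Ψ : Equiv.Perm Q} {c : Q} (hc : Nat.card Q = 243)
    (Φa : ∀ x y, Φ (x + y) = Φ x + Φ y) (Ψa : ∀ x y, Ψ (x + y) = Ψ x + Ψ y)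
    (ΦΨ : ∀ x, Φ (Ψ x) = Ψ (Φ x)) (nc : Nuc c) (h1 : ∀ x, Nuc (Ψ x + -Φ x))
    (h2 : ∀ x, Nuc (Φ (Ψ (Φ x + Ψ x)) + -Φ (Φ x))) {p q r : Q} (hbr : br p q r ≠ 0) :
    ∃ (_ : AddCommGroup Q) (R : QRep Q), ∀ x y, R.mul x y = (CIP.toAdd.add c (CIP.toAdd.add (Φ x) (Ψ y))) := by
  have fin : Finite Q := Nat.finite_of_card_ne_zero (by rw [hc]; norm_num)
  obtain ⟨na, π, πadd, πsurj, hdet, hker⟩ := struct (exists_gen hc hbr) rfl hbr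
  have t3 : br p q r + (br p q r + br p q r) = 0 := br_three p q r
  have Φbr : ∀ (Θ : Equiv.Perm Q), (∀ x y, Θ (x + y) = Θ x + Θ y) → ∀ x y z,
      Θ (br x y z) = br (Θ x) (Θ y) (Θ z) := by
    intro Θ Θa x y z
    have h0 : Θ 0 = 0 := lcan (x := Θ 0) (by rw [← Θa, addz, addz])
    have hn : ∀ x, Θ (-x) = - Θ x := fun x => eq_neg_of (by rw [← Θa, nadd, h0])
    unfold br
    simp only [I_apply, Θa, hn]
  set a := br p q r with haa
  have π0 : π 0 = 0 := by
    have := πadd 0 0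
    rw [zadd] at this; simpa using this
  have πneg : ∀ x, π (-x) = - π x := by
    intro x
    have := πadd (-x) x
    rw [nadd, π0] at this
    exact eq_neg_of_add_eq_zero_left this.symm
  have πnuc : ∀ n, Nuc n → π n = 0 := by
    intro n hn
    apply det3_nondeg
    intro v w
    obtain ⟨y, rfl⟩ := πsurj v
    obtain ⟨z, rfl⟩ := πsurj w
    have := hdet n y z
    rw [nuc_iff.1 hn] at this
    exact sm_eq_zero hbr this.symm
  have nucΘ : ∀ (Θ : Equiv.Perm Q), (∀ x y, Θ (x + y) = Θ x + Θ y) → ∀ x, Nuc (Θ x) → Nuc x := by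
    intro Θ Θa x hx y z
    apply Θ.injective
    rw [Θa, Θa, Θa, Θa]; exact hx _ _
  have πΨ : ∀ x, π (Ψ x) = π (Φ x) := by
    intro x
    have := πnuc _ (h1 x)
    rw [πadd, πneg] at this
    exact add_neg_eq_zero.1 this
  have πΦinj : ∀ x y, π (Φ x) = π (Φ y) → π x = π y := by
    intro x y h
    have e : π (Φ (x + -y)) = 0 := by
      have hn : Φ (-y) = - Φ y := by
        have h0 : Φ 0 = 0 := lcan (x := Φ 0) (by rw [← Φa, addz, addz])
        exact eq_neg_of (by rw [← Φa, nadd, h0])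
      rw [Φa, hn, πadd, πneg, h, add_neg_cancel]
    have := πnuc _ (nucΘ Φ Φa _ (hker _ e))
    rw [πadd, πneg] at this
    exact add_neg_eq_zero.1 this
  have πΦ : ∀ x, π (Φ x) = - π x := by
    intro x
    have e := πnuc _ (h2 x)
    rw [πadd, πneg] at e
    have e := πΦinj _ _ (add_neg_eq_zero.1 e)
    rw [πΨ] at e
    have e := πΦinj _ _ e
    rw [πadd, πΨ] at e
    rw [← e]
    have : ∀ v : V3, v = -(v + v) := by
      intro v
      have := fun i => z3three (v i)
      ext i
      have := this i
      simp only [Pi.neg_apply, Pi.add_apply]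
      linear_combination this
    exact this _
  have πΨ' : ∀ x, π (Ψ x) = - π x := fun x => by rw [πΨ, πΦ]
  have Θsm : ∀ (Θ : Equiv.Perm Q), (∀ x y, Θ (x + y) = Θ x + Θ y) → (∀ x, π (Θ x) = - π x) →
      ∀ k, Θ (sm k a) = sm (-k) a := by
    intro Θ Θa hπ k
    have h0 : Θ 0 = 0 := lcan (x := Θ 0) (by rw [← Θa, addz, addz])
    have hn : ∀ x, Θ (-x) = - Θ x := fun x => eq_neg_of (by rw [← Θa, nadd, h0])
    have ea : Θ a = - a := by
      rw [haa, Φbr Θ Θa, hdet, hπ, hπ, hπ, ← sm_neg_one]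
      have d1 : det3 (π p) (π q) (π r) = 1 := by
        have := hdet p q r
        rw [← haa] at this
        exact (sm_inj t3 hbr ((sm_one a).trans this)).symm
      rw [← d1]; congr 1; simp only [det3, Pi.neg_apply]; ring
    rcases zmod3 k with rfl | rfl | rfl
    · rw [neg_zero, sm_zero, h0]
    · rw [sm_one, ea, sm_neg_one]
    · rw [sm_neg_one, hn, ea, nn, neg_neg, sm_one]
  have πsm : ∀ k, π (sm k a) = 0 := fun k => πnuc _ (nuc_sm na k)
  have ns : ∀ k, Nuc (sm k a) := nuc_sm na
  let pl : Q → Q → Q := fun x y => (x + y) + sm (DD (π x) (π y)) a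
  have πpl : ∀ x y, π (pl x y) = π x + π y := by
    intro x y; simp only [pl]; rw [πadd, πadd, πsm, add_zero]
  have plc : ∀ x y, pl x y = pl y x := by
    intro x y; simp only [pl]; rw [CIP.comm x y, DD_symm]
  have shift : ∀ k l x, (x + sm k a) + sm l a = x + sm (k + l) a := by
    intro k l x
    rw [sm_add t3, CIP.comm _ (sm l a), CIP.comm x, (ns l) _ _, CIP.comm (sm l a), CIP.comm]
  have plass : ∀ x y z, pl (pl x y) z = pl x (pl y z) := by
    intro x y z
    have e1 : pl (pl x y) z = ((x + y) + z) + sm (DD (π x) (π y) + DD (π x + π y) (π z)) a := by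
      change (pl x y + z) + sm (DD (π (pl x y)) (π z)) a = _
      rw [πpl, ← shift]
      simp only [pl]
      rw [CIP.comm (x + y) (sm _ a), ← ns, CIP.comm (sm _ a)]
    have e2 : pl x (pl y z) = (x + (y + z)) + sm (DD (π y) (π z) + DD (π x) (π y + π z)) a := by
      change (x + pl y z) + sm (DD (π x) (π (pl y z))) a = _
      rw [πpl, ← shift]
      simp only [pl]
      rw [CIP.comm (y + z) (sm _ a), (ns _).r, CIP.comm (sm _ a)]
    rw [e1, e2, add_I, I_br, hdet, CIP.comm z, (ns _).r, CIP.comm (sm _ a), shift, DD_assoc]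
  have pl0 : ∀ x, pl 0 x = x := by
    intro x; simp only [pl]; rw [π0, DD_zero_left, sm_zero, zadd, addz]
  have pln : ∀ x, pl (-x) x = 0 := by
    intro x; simp only [pl]; rw [πneg, DD_neg_self, sm_zero, nadd, addz]
  have Θpl : ∀ (Θ : Equiv.Perm Q), (∀ x y, Θ (x + y) = Θ x + Θ y) → (∀ x, π (Θ x) = - π x) →
      ∀ x y, Θ (pl x y) = pl (Θ x) (Θ y) := by
    intro Θ Θa hπ x y
    simp only [pl]
    rw [Θa, Θa, Θsm Θ Θa hπ, hπ, hπ, DD_neg]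
  have Φpl := Θpl Φ Φa πΦ
  have Ψpl := Θpl Ψ Ψa πΨ'
  have nucpl : ∀ n x, π n = 0 → pl n x = n + x := by
    intro n x h; simp only [pl]; rw [h, DD_zero_left, sm_zero, addz]
  have hmul : ∀ x y, c + (Φ x + Ψ y) = pl (pl (pl (Φ x) (Ψ y)) c) (sm (DD (π x) (π y)) a) := by
    intro x y
    rw [plc _ (sm _ a), nucpl _ _ (πsm _), plc _ c, nucpl _ _ (πnuc c nc)]
    simp only [pl]
    rw [πΦ, πΨ', DD_neg, CIP.comm (Φ x + Ψ y), nc.r, (ns _) _ _, ← sm_add t3, add_neg_cancel, sm_zero, zadd]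
  have smpl : ∀ k l, sm (k + l) a = pl (sm k a) (sm l a) := by
    intro k l; rw [nucpl _ _ (πsm _), sm_add t3]
  have hpi3 : ∀ v : V3, v + v + v = 0 := by
    intro v; ext i; exact z3three (v i)
  have smi : ∀ k l, sm k a = sm l a → k = l := fun k l h => sm_inj t3 hbr h
  change ∃ (_ : AddCommGroup Q) (R : QRep Q), ∀ x y, R.mul x y = c + (Φ x + Ψ y)
  have smz := sm_zero a
  simp only [hmul]
  have πc := πnuc c nc
  clear_value pl
  let G : AddCommGroup Q :=
    { add := pl, zero := 0, neg := fun x => -x, add_assoc := plass, zero_add := pl0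
      add_zero := fun x => by
        change pl x 0 = x
        rw [plc, pl0]
      neg_add_cancel := pln, add_comm := plc, nsmul := @nsmulRec Q ⟨0⟩ ⟨pl⟩, zsmul := @zsmulRec Q ⟨0⟩ ⟨pl⟩ ⟨fun x => -x⟩ (@nsmulRec Q ⟨0⟩ ⟨pl⟩) }
  exact ⟨G, @mk_rep Q G hc π πpl πsurj Φ Ψ Φpl Ψpl πΦ πΨ' ΦΨ (fun k => sm k a) smz smpl smi πsm
    (Θsm Φ Φa πΦ) (Θsm Ψ Ψa πΨ') c πc⟩
end OCML

open Quasigroup in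
theorem exists_rep {Q : Type} (q : Quasigroup Q) (hc : Nat.card Q = 243) (ht : Trimedial q)
    (hm : ¬ Medial q) : ∃ (_ : AddCommGroup Q) (R : QRep Q), ∀ x y, R.mul x y = q.mul x y := by
  have fin : Finite Q := Nat.finite_of_card_ne_zero (by rw [hc]; norm_num)
  have ne : Nonempty Q := by
    by_contra h
    rw [not_nonempty_iff] at h
    rw [Nat.card_of_isEmpty] at hc; omega
  obtain ⟨e⟩ := ne
  obtain ⟨i1, Φ, Ψ, c, Φa, Ψa, ΦΨ, nc, hmul, h1, h2⟩ := Toy.affine2 q ht e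
  letI := CML.toOCML hc
  by_cases hb : ∃ p q r : Q, OCML.br p q r ≠ 0
  · obtain ⟨p, q, r, hb⟩ := hb
    obtain ⟨g, R, hR⟩ := OCML.to_rep hc Φa Ψa ΦΨ nc h1 h2 hb
    refine ⟨g, R, fun x y => ?_⟩
    rw [hR, hmul]; rfl
  · exfalso
    push Not at hb
    apply hm
    have as : ∀ x y z : Q, (x + y) + z = x + (y + z) := by
      intro x y z
      rw [CML.add_I, OCML.br_eq_zero.1 (hb x y z)]
    haveI : Std.Associative (α := Q) (· + ·) := ⟨as⟩
    haveI : Std.Commutative (α := Q) (· + ·) := ⟨CIP.comm⟩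
    intro x y u v
    simp only [hmul, Φa, Ψa, ΦΨ]
    ac_rfl


/-- The linear map with columns `g 0, g 1, g 2`. -/
def app (g : Fin 3 → V3) (v : V3) : V3 := fun i => v 0 * g 0 i + v 1 * g 1 i + v 2 * g 2 i
def dt (g : Fin 3 → V3) : ZMod 3 := OCML.det3 (g 0) (g 1) (g 2)
def NN (o S : V3) : ZMod 3 := S 2 * (S 0 * o 1 - S 1 * o 0)
def del (g : Fin 3 → V3) (x : V3) : ZMod 3 :=
    0 + g 0 0 * g 0 2 * g 1 1 * x 0 * x 0 * x 1 - g 0 0 * g 1 1 * g 1 2 * x 0 * x 1 * x 1 + g 0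
      0 * g 0 2 * g 2 1 * x 0 * x 0 * x 2 + g 0 0 * g 1 2 * g 2 1 * x 0 * x 1 * x 2 - g 0 0 * g
      2 1 * g 2 2 * x 0 * x 2 * x 2 - g 0 1 * g 0 2 * g 1 0 * x 0 * x 0 * x 1 + g 0 1 * g 1 0 *
      g 1 2 * x 0 * x 1 * x 1 + g 0 2 * g 1 0 * g 2 1 * x 0 * x 1 * x 2 + g 1 0 * g 1 2 * g 2 1
      * x 1 * x 1 * x 2 - g 1 0 * g 2 1 * g 2 2 * x 1 * x 2 * x 2 - g 0 1 * g 0 2 * g 2 0 * x 0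
      * x 0 * x 2 - g 0 1 * g 1 2 * g 2 0 * x 0 * x 1 * x 2 + g 0 1 * g 2 0 * g 2 2 * x 0 * x 2
      * x 2 - g 0 2 * g 1 1 * g 2 0 * x 0 * x 1 * x 2 - g 1 1 * g 1 2 * g 2 0 * x 1 * x 1 * x 2
      + g 1 1 * g 2 0 * g 2 2 * x 1 * x 2 * x 2

theorem app_add (g x y) : app g (x + y) = app g x + app g y := by
  funext i; simp only [app, Pi.add_apply]; ring
theorem app_neg (g x) : app g (-x) = - app g x := by
  funext i; simp only [app, Pi.neg_apply]; ring
theorem app_zero (g) : app g 0 = 0 := by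
  funext i; simp [app]
theorem det3_app (g u v w) :
    OCML.det3 (app g u) (app g v) (app g w) = dt g * OCML.det3 u v w := by
  simp only [app, dt, OCML.det3]; ring
theorem app_inj {g} (hg : dt g ≠ 0) {x} (h : app g x = 0) : x = 0 := by
  apply OCML.det3_nondeg
  intro v w
  have := det3_app g x v w
  rw [h] at this
  have h0 : OCML.det3 0 (app g v) (app g w) = 0 := by simp [OCML.det3]
  rw [h0] at this
  exact (mul_eq_zero.1 this.symm).resolve_left hg
theorem del_neg (g x) : del g (-x) = - del g x := by
  simp only [del, Pi.neg_apply]; ring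
theorem del_zero (g) : del g 0 = 0 := by simp [del]
theorem NN_neg (o x) : NN o (-x) = NN o x := by
  simp only [NN, Pi.neg_apply]; ring
theorem NN_zero (o) : NN o 0 = 0 := by simp [NN]
set_option maxHeartbeats 1000000 in
theorem del_add (g x y) :
    del g (x + y) = del g x + del g y + DD (app g x) (app g y) - dt g * DD x y := by
  have h : (3 : ZMod 3) = 0 := by decide
  simp only [del, DD, app, dt, OCML.det3, Pi.add_apply]
  linear_combination (
    0 + g 0 0 * g 0 2 * g 1 1 * x 0 * x 1 * y 0 + g 0 0 * g 0 2 * g 1 1 * x 0 * y 0 * y 1 - g 0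
      0 * g 1 1 * g 1 2 * x 0 * x 1 * y 1 - g 0 0 * g 1 1 * g 1 2 * x 1 * y 0 * y 1 + g 0 0 * g
      0 2 * g 2 1 * x 0 * x 2 * y 0 + g 0 0 * g 0 2 * g 2 1 * x 0 * y 0 * y 2 + g 0 0 * g 1 2 *
      g 2 1 * x 0 * y 1 * y 2 + g 0 0 * g 1 2 * g 2 1 * x 1 * x 2 * y 0 - g 0 0 * g 2 1 * g 2 2
      * x 0 * x 2 * y 2 - g 0 0 * g 2 1 * g 2 2 * x 2 * y 0 * y 2 - g 0 1 * g 0 2 * g 1 0 * x 0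
      * x 1 * y 0 - g 0 1 * g 0 2 * g 1 0 * x 0 * y 0 * y 1 + g 0 1 * g 1 0 * g 1 2 * x 0 * x 1
      * y 1 + g 0 1 * g 1 0 * g 1 2 * x 1 * y 0 * y 1 + g 0 2 * g 1 0 * g 2 1 * x 0 * x 2 * y 1
      + g 0 2 * g 1 0 * g 2 1 * x 1 * y 0 * y 2 + g 1 0 * g 1 2 * g 2 1 * x 1 * x 2 * y 1 + g 1
      0 * g 1 2 * g 2 1 * x 1 * y 1 * y 2 - g 1 0 * g 2 1 * g 2 2 * x 1 * x 2 * y 2 - g 1 0 * g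
      2 1 * g 2 2 * x 2 * y 1 * y 2 - g 0 1 * g 0 2 * g 2 0 * x 0 * x 2 * y 0 - g 0 1 * g 0 2 *
      g 2 0 * x 0 * y 0 * y 2 - g 0 1 * g 1 2 * g 2 0 * x 0 * y 1 * y 2 - g 0 1 * g 1 2 * g 2 0
      * x 1 * x 2 * y 0 + g 0 1 * g 2 0 * g 2 2 * x 0 * x 2 * y 2 + g 0 1 * g 2 0 * g 2 2 * x 2
      * y 0 * y 2 - g 0 2 * g 1 1 * g 2 0 * x 0 * x 2 * y 1 - g 0 2 * g 1 1 * g 2 0 * x 1 * y 0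
      * y 2 - g 1 1 * g 1 2 * g 2 0 * x 1 * x 2 * y 1 - g 1 1 * g 1 2 * g 2 0 * x 1 * y 1 * y 2
      + g 1 1 * g 2 0 * g 2 2 * x 1 * x 2 * y 2 + g 1 1 * g 2 0 * g 2 2 * x 2 * y 1 * y 2
    ) * h
theorem DD_shift (o x y) :
    DD (o + x) (o + y) = DD x y - NN o (x + y) - NN o x - NN o y := by
  have h : (3 : ZMod 3) = 0 := by decide
  simp only [DD, NN, Pi.add_apply]
  linear_combination (
    0 + o 1 * x 0 * x 2 - o 0 * x 1 * x 2 - o 0 * y 1 * y 2 + o 1 * y 0 * y 2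
    ) * h
theorem DD_shift1 (o x) : DD (o + x) o = NN o x := by
  simp only [DD, NN, Pi.add_apply]; ring
theorem DD_shift2 (o x) : DD o (o + x) = NN o x := by rw [DD_symm, DD_shift1]
theorem DD_self (x : V3) : DD x x = 0 := by simp [DD]
theorem DD_medial (x y u v : V3) :
    DD x y + DD u v + DD (x + y) (u + v) =
      DD x u + DD y v + DD (x + u) (y + v) + OCML.det3 (y - x) (u - x) (v - x) := by
  have h : (3 : ZMod 3) = 0 := by decide
  simp only [DD, OCML.det3, Pi.add_apply, Pi.sub_apply]
  linear_combination (
    0 + u 1 * x 2 * y 0 - u 0 * x 2 * y 1 + v 1 * x 0 * y 2 - v 0 * x 1 * y 2 - u 2 * v 1 * x 0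
      + u 2 * v 0 * x 1 - u 1 * v 2 * y 0 + u 0 * v 2 * y 1
    ) * h

theorem app_of_add (h : V3 → V3) (ha : ∀ x y, h (x + y) = h x + h y) (x : V3) :
    h x = app (fun j => h (Pi.single j 1)) x := by
  let H : V3 →ₗ[ZMod 3] V3 := (AddMonoidHom.mk' h ha).toZModLinearMap 3
  have := LinearMap.pi_apply_eq_sum_univ H x
  have e : h x = H x := rfl
  rw [e, this, Fin.sum_univ_three]
  funext i
  simp only [Pi.add_apply, Pi.smul_apply, smul_eq_mul, app]
  have e2 : ∀ j : Fin 3, (fun k => if j = k then (1:ZMod 3) else 0) = Pi.single j 1 := by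
    intro j; funext k; simp [Pi.single_apply, eq_comm]
  simp only [e2]; rfl

namespace QRep
variable {G : Type} [AddCommGroup G] (R : QRep G)

theorem fin (R : QRep G) : Finite G := Nat.finite_of_card_ne_zero (by rw [R.card]; norm_num)

theorem π_mul (x y : G) : R.π (R.mul x y) = - R.π x - R.π y := by
  simp only [QRep.mul, map_add, map_sub, R.πτ, R.πc, R.πa]; abel

theorem mul_inj_right {x y y' : G} (h : R.mul x y = R.mul x y') : y = y' := by
  have h1 := congrArg R.π h
  rw [π_mul, π_mul] at h1
  have h2 : R.π y = R.π y' := sub_right_injective h1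
  unfold QRep.mul at h
  rw [h2] at h
  have h3 := R.inj2 (y - y') (by
    rw [map_sub]
    have : R.τ 2 y - y = R.τ 2 y' - y' := by simpa using h
    linear_combination (norm := module) this)
  exact sub_eq_zero.1 h3

theorem mul_inj_left {x y y' : G} (h : R.mul y x = R.mul y' x) : y = y' := by
  have h1 := congrArg R.π h
  rw [π_mul, π_mul] at h1
  have h2 : R.π y = R.π y' := by simpa using h1
  unfold QRep.mul at h
  rw [h2] at h
  have h3 := R.inj1 (y - y') (by
    rw [map_sub]
    have : R.τ 1 y - y = R.τ 1 y' - y' := by simpa using h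
    linear_combination (norm := module) this)
  exact sub_eq_zero.1 h3

/-- The quasigroup of a linear presentation. -/
def toQ : Quasigroup G where
  mul := R.mul
  leftBij x := by
    have := R.fin
    exact Finite.injective_iff_bijective.1 fun y y' h => R.mul_inj_right h
  rightBij x := by
    have := R.fin
    exact Finite.injective_iff_bijective.1 fun y y' h => R.mul_inj_left h

theorem medial_iff (x y u v : G) :
    R.mul (R.mul x y) (R.mul u v) = R.mul (R.mul x u) (R.mul y v) ↔
      OCML.det3 (R.π y - R.π x) (R.π u - R.π x) (R.π v - R.π x) = 0 := by
  have key : R.mul (R.mul x y) (R.mul u v) +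
      R.a (OCML.det3 (R.π y - R.π x) (R.π u - R.π x) (R.π v - R.π x)) =
      R.mul (R.mul x u) (R.mul y v) := by
    have h := congrArg R.a (DD_medial (R.π x) (R.π y) (R.π u) (R.π v))
    have e1 : DD (R.π (R.mul x y)) (R.π (R.mul u v)) =
        - DD (R.π x + R.π y) (R.π u + R.π v) := by
      rw [← DD_neg, π_mul, π_mul]; congr 1 <;> abel
    have e2 : DD (R.π (R.mul x u)) (R.π (R.mul y v)) =
        - DD (R.π x + R.π u) (R.π y + R.π v) := by
      rw [← DD_neg, π_mul, π_mul]; congr 1 <;> abel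
    rw [QRep.mul, e1, QRep.mul.eq_1 R (R.mul x u), e2]
    simp only [QRep.mul, map_add, map_sub, map_neg, R.τa] at h ⊢
    rw [R.comm 2 1 u, R.comm 2 1 y]
    linear_combination (norm := module) (-1 : ℤ) • h
  rw [← key]
  constructor
  · intro h
    have h2 : R.a _ = R.a 0 := (by simpa using h : R.a _ = 0).trans (map_zero _).symm
    exact R.ainj h2
  · intro h; rw [h]; simp

open Quasigroup

theorem det3_span (a b x y u v : V3) (i j : Fin 4 → ZMod 3) (hx : x = i 0 • a + j 0 • b)
    (hy : y = i 1 • a + j 1 • b) (hu : u = i 2 • a + j 2 • b) (hv : v = i 3 • a + j 3 • b) :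
    OCML.det3 (y - x) (u - x) (v - x) = 0 := by
  subst hx hy hu hv
  simp only [OCML.det3, Pi.add_apply, Pi.sub_apply, Pi.smul_apply, smul_eq_mul]; ring

theorem trimedial : Trimedial R.toQ := by
  intro p q r
  let S : Set G := {x | ∃ i j : ZMod 3, R.π x - R.π p = i • (R.π q - R.π p) + j • (R.π r - R.π p)}
  have three : ∀ v : V3, v + v + v = 0 := fun v => by funext i; exact z3three _
  have key : ∀ x ∈ S, ∀ y ∈ S, ∀ z, R.π z = - R.π x - R.π y → z ∈ S := by
    rintro x ⟨i, j, h⟩ y ⟨i', j', h'⟩ z hz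
    refine ⟨-i - i', -j - j', ?_⟩
    rw [hz]
    have := three (R.π p)
    simp only [sub_smul, neg_smul]
    linear_combination (norm := module) (-1 : ℤ) • h + (-1 : ℤ) • h' + (-1 : ℤ) • this
  have hS : IsSubquasigroup R.toQ S := by
    refine ⟨fun x hx y hy => key x hx y hy _ (R.π_mul x y), fun x hx z hz y h => ?_,
      fun y hy z hz x h => ?_⟩
    · refine key x hx z hz y ?_
      rw [← h]; change _ = _ - R.π (R.mul x y); rw [R.π_mul]; abel
    · refine key y hy z hz x ?_
      rw [← h]; change _ = _ - R.π (R.mul x y); rw [R.π_mul]; abel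
  have hsub : genSet R.toQ p q r ⊆ S := by
    apply Set.sInter_subset_of_mem
    exact ⟨hS, ⟨0, 0, by simp⟩, ⟨1, 0, by simp⟩, ⟨0, 1, by simp⟩⟩
  intro x hx y hy u hu v hv
  obtain ⟨i0, j0, h0⟩ := hsub hx
  obtain ⟨i1, j1, h1⟩ := hsub hy
  obtain ⟨i2, j2, h2⟩ := hsub hu
  obtain ⟨i3, j3, h3⟩ := hsub hv
  apply (R.medial_iff x y u v).2
  have := det3_span _ _ _ _ _ _ ![i0, i1, i2, i3] ![j0, j1, j2, j3] h0 h1 h2 h3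
  rw [← this]
  congr 1 <;> abel

theorem exists_det (k : ZMod 3) : ∃ x y z : G, OCML.det3 (R.π x) (R.π y) (R.π z) = k := by
  obtain ⟨x, hx⟩ := R.πsurj ![k, 0, 0]
  obtain ⟨y, hy⟩ := R.πsurj ![0, 1, 0]
  obtain ⟨z, hz⟩ := R.πsurj ![0, 0, 1]
  exact ⟨x, y, z, by rw [hx, hy, hz]; simp [OCML.det3]⟩

theorem not_medial : ¬ Medial R.toQ := by
  intro h
  obtain ⟨x, y, z, hd⟩ := R.exists_det 1
  have := (R.medial_iff 0 x y z).1 (h 0 x y z)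
  simp only [map_zero, sub_zero, hd] at this
  exact absurd this (by decide)

variable {G' : Type} [AddCommGroup G'] (R' : QRep G')

/-- Linear form of an isomorphism. -/
def LIso : Prop := ∃ (F : G →+ G') (g : Fin 3 → V3) (w : G'), Function.Bijective F ∧
  (∀ x, R'.π (F x) = app g (R.π x)) ∧ (∀ i x, F (R.τ i x) = R'.τ i (F x)) ∧
  (∀ k, F (R.a k) = R'.a (dt g * k)) ∧ F R.c = R'.c + R'.τ 0 w

variable {R R'}
theorem LIso.iso (h : LIso R R') : Iso R.toQ R'.toQ := by
  obtain ⟨F, g, w, hb, hπ, hτ, ha, hc⟩ := h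
  let o := R'.π w
  let ρ : V3 → ZMod 3 := fun x => - NN o (app g x) - del g x
  let f : G → G' := fun z => w + F z + R'.a (ρ (R.π z))
  have πf : ∀ z, R'.π (f z) = o + app g (R.π z) := by
    intro z; simp only [f, map_add, hπ, R'.πa, add_zero]; rfl
  have τf : ∀ i z, R'.τ i (f z) = R'.τ i w + F (R.τ i z) := by
    intro i z; simp only [f, map_add, R'.τa, add_zero, hτ]
  have hmul : ∀ x y, f (R.mul x y) = R'.mul (f x) (f y) := by
    intro x y
    rw [QRep.mul.eq_1 R', τf, τf, πf, πf, DD_shift]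
    have e : f (R.mul x y) = w + F (R.mul x y) +
      R'.a (- NN o (app g (R.π x) + app g (R.π y)) + del g (R.π x + R.π y)) := by
      simp only [f, ρ, π_mul]
      rw [show - R.π x - R.π y = - (R.π x + R.π y) by abel, app_neg, NN_neg, del_neg, app_add,
        sub_neg_eq_add]
    rw [e, del_add]
    simp only [QRep.mul, f, ρ, map_add, map_sub, map_neg, ha, hc]
    have h3 := R'.three w
    linear_combination (norm := module) (-1 : ℤ) • h3
  have finj : Function.Injective f := by
    intro x y h
    have h1 := congrArg R'.π h
    rw [πf, πf] at h1
    have h1 := add_left_cancel h1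
    have hg : dt g ≠ 0 := by
      intro h0
      have := ha 1
      rw [h0, zero_mul, map_zero] at this
      have h2 := R.ainj (hb.1 (this.trans (map_zero F).symm) |>.trans (map_zero R.a).symm)
      exact absurd h2 (by decide)
    have h2 : R.π x = R.π y := by
      rw [← sub_eq_zero]
      apply app_inj hg
      rw [sub_eq_add_neg, app_add, app_neg, h1]; abel
    apply hb.1
    simp only [f, h2] at h
    simpa using h
  have := R.fin
  have := R'.fin
  have hbij : Function.Bijective f := finj.bijective_of_nat_card_le (by rw [R.card, R'.card])
  exact ⟨Equiv.ofBijective f hbij, hmul⟩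

theorem LIso.of_iso (h : Iso R.toQ R'.toQ) : LIso R R' := by
  obtain ⟨f, hf⟩ := h
  have hf : ∀ x y, f (R.mul x y) = R'.mul (f x) (f y) := hf
  let o := R'.π (f 0)
  let F0 : G → G' := fun u => f (u + R.c) - f R.c
  let p : G → V3 := fun u => R'.π (F0 u)
  let F1 : G → G' := fun u => F0 u + R'.a (NN o (p u))
  have have1 := R.fin
  have have2 := R'.fin
  have sφ : ∀ u, ∃ s, R.τ 1 s - s = u := by
    have : Function.Injective (R.τ 1 - AddMonoidHom.id G) := by
      rw [injective_iff_map_eq_zero]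
      intro s hs; exact R.inj1 s (sub_eq_zero.1 hs)
    exact Finite.injective_iff_surjective.1 this
  have sψ : ∀ u, ∃ s, R.τ 2 s - s = u := by
    have : Function.Injective (R.τ 2 - AddMonoidHom.id G) := by
      rw [injective_iff_map_eq_zero]
      intro s hs; exact R.inj2 s (sub_eq_zero.1 hs)
    exact Finite.injective_iff_surjective.1 this
  have m0 : ∀ s, R.mul s 0 = R.τ 1 s - s + R.c := by
    intro s; simp [QRep.mul, DD_zero_right]
  have m1 : ∀ s, R.mul 0 s = R.τ 2 s - s + R.c := by
    intro s; simp [QRep.mul, DD_zero_left]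
  have m2 : R.mul 0 0 = R.c := by rw [m0]; simp
  have H0 : ∀ u v, F0 (u + v - R.a (DD (R.π u) (R.π v))) = F0 u + F0 v +
      R'.a (- DD (p u) (p v) - NN o (p u + p v) + NN o (p u) + NN o (p v)) := by
    intro u v
    obtain ⟨s, rfl⟩ := sφ u
    obtain ⟨t, rfl⟩ := sψ v
    have es : p (R.τ 1 s - s) = o - R'.π (f s) := by
      simp only [p, F0, map_sub]
      rw [← m0, hf, π_mul, ← m2, hf, π_mul]; simp only [o]; abel
    have et : p (R.τ 2 t - t) = o - R'.π (f t) := by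
      simp only [p, F0, map_sub]
      rw [← m1, hf, π_mul, ← m2, hf, π_mul]; simp only [o]; abel
    set P := p (R.τ 1 s - s)
    set T := p (R.τ 2 t - t)
    have es' : R'.π (f s) = o + -P := by rw [es]; abel
    have et' : R'.π (f t) = o + -T := by rw [et]; abel
    have e1 : f (R.τ 1 s - s + R.c) = R'.mul (f s) (f 0) := by rw [← hf, m0]
    have e2 : f (R.τ 2 t - t + R.c) = R'.mul (f 0) (f t) := by rw [← hf, m1]
    have e3 : f R.c = R'.mul (f 0) (f 0) := by rw [← hf, m2]
    have e4 : f (R.τ 1 s - s + (R.τ 2 t - t) -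
        R.a (DD (R.π (R.τ 1 s - s)) (R.π (R.τ 2 t - t))) + R.c) = R'.mul (f s) (f t) := by
      rw [← hf]; congr 1
      simp only [map_sub, R.πτ, zero_sub, DD_neg, QRep.mul, map_neg]; abel
    simp only [F0]
    rw [e1, e2, e3, e4]
    simp only [QRep.mul]
    rw [es', et', show R'.π (f 0) = o from rfl, DD_shift, DD_shift1, DD_shift2, DD_self, DD_neg,
      NN_neg, NN_neg, ← neg_add, NN_neg]
    have h1 := congrArg R'.a (z3three (NN o P))
    have h2 := congrArg R'.a (z3three (NN o T))
    simp only [map_add, map_sub, map_neg, map_zero] at h1 h2 ⊢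
    linear_combination (norm := module) (-1 : ℤ) • h1 + (-1 : ℤ) • h2
  have pF : ∀ u, R'.π (F1 u) = p u := by
    intro u; simp only [F1, map_add, R'.πa, add_zero]; rfl
  have pop : ∀ u v, p (u + v - R.a (DD (R.π u) (R.π v))) = p u + p v := by
    intro u v
    have := congrArg R'.π (H0 u v)
    rw [map_add, R'.πa, add_zero, map_add] at this
    exact this
  have H1 : ∀ u v, F1 (u + v - R.a (DD (R.π u) (R.π v))) = F1 u + F1 v - R'.a (DD (p u) (p v)) := by
    intro u v
    simp only [F1, pop, H0, map_add, map_sub, map_neg]; abel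
  have F00 : F0 0 = 0 := by simp [F0]
  have p0 : p 0 = 0 := by simp [p, F00]
  have psurj : Function.Surjective p := by
    intro v
    obtain ⟨z, hz⟩ := R'.πsurj (v + R'.π (f R.c))
    refine ⟨f.symm z - R.c, ?_⟩
    simp [p, F0, hz]
  have A1 : ∀ u v w, F1 (R.a (- OCML.det3 (R.π u) (R.π v) (R.π w))) =
        - R'.a (OCML.det3 (p u) (p v) (p w)) ∧
      p (R.a (- OCML.det3 (R.π u) (R.π v) (R.π w))) = 0 := by
    intro u v w
    set k := OCML.det3 (R.π u) (R.π v) (R.π w) with hk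
    have h1 := H1 (u + v - R.a (DD (R.π u) (R.π v))) w
    have h2 := H1 u (v + w - R.a (DD (R.π v) (R.π w)))
    rw [H1 u v, pop u v] at h1
    rw [H1 v w, pop v w] at h2
    have h3 := H1 (u + (v + w - R.a (DD (R.π v) (R.π w))) -
      R.a (DD (R.π u) (R.π (v + w - R.a (DD (R.π v) (R.π w)))))) (R.a (- k))
    rw [h2, R.πa, DD_zero_right, map_zero, sub_zero] at h3
    simp only [map_sub, map_add, R.πa, sub_zero] at h1 h3
    have e := congrArg R.a (DD_assoc (R.π u) (R.π v) (R.π w))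
    have e' := congrArg R'.a (DD_assoc (p u) (p v) (p w))
    rw [← hk] at e
    simp only [map_add] at e e'
    have e2 : u + (v + w - R.a (DD (R.π v) (R.π w))) - R.a (DD (R.π u) (R.π v + R.π w)) +
      R.a (-k) = u + v - R.a (DD (R.π u) (R.π v)) + w - R.a (DD (R.π u + R.π v) (R.π w)) := by
      rw [map_neg]
      linear_combination (norm := module) (-1 : ℤ) • e
    rw [e2, h1] at h3
    have hp : p (R.a (-k)) = 0 := by
      have := congrArg R'.π h3
      simp only [map_add, map_sub, R'.πa, pF, sub_zero] at this
      have h4 : p u + p v + p w + 0 = p u + p v + p w + p (R.a (-k)) := by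
        rw [add_zero]; exact this.trans (by abel)
      exact (add_left_cancel h4).symm
    refine ⟨?_, hp⟩
    rw [hp, DD_zero_right, map_zero, sub_zero] at h3
    linear_combination (norm := module) (-1 : ℤ) • h3 + e'
  have pa : ∀ k, p (R.a k) = 0 := by
    intro k
    obtain ⟨x, y, z, hd⟩ := R.exists_det (-k)
    have := (A1 x y z).2
    rwa [hd, neg_neg] at this
  have F1a : ∀ u k, F1 (u + R.a k) = F1 u + F1 (R.a k) := by
    intro u k
    have := H1 u (R.a k)
    rwa [R.πa, pa, DD_zero_right, DD_zero_right, map_zero, map_zero, sub_zero, sub_zero] at this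
  have padd : ∀ u v, p (u + v) = p u + p v := by
    intro u v
    have := F1a (u + v - R.a (DD (R.π u) (R.π v))) (DD (R.π u) (R.π v))
    have := congrArg R'.π this
    rwa [pF, map_add, pF, pF, pop, pa, add_zero, sub_add_cancel] at this
  have pker : ∀ u, R.π u = 0 → p u = 0 := by
    intro u hu
    apply OCML.det3_nondeg
    intro v w
    obtain ⟨v, rfl⟩ := psurj v
    obtain ⟨w, rfl⟩ := psurj w
    have := (A1 u v w).1
    have h0 : OCML.det3 (R.π u) (R.π v) (R.π w) = 0 := by rw [hu]; simp [OCML.det3]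
    rw [h0, neg_zero, map_zero] at this
    have h1 : F1 0 = 0 := by simp [F1, p0, F00, NN_zero]
    rw [h1] at this
    apply R'.ainj
    rw [map_zero]
    exact neg_eq_zero.1 this.symm
  let sec := Function.surjInv R.πsurj
  have hsec : ∀ v, R.π (sec v) = v := Function.surjInv_eq R.πsurj
  let P : G →+ V3 := AddMonoidHom.mk' p padd
  have pcong : ∀ x y, R.π x = R.π y → p x = p y := by
    intro x y h
    have : P (x - y) = 0 := pker _ (by rw [map_sub, h, sub_self])
    rw [map_sub] at this
    exact sub_eq_zero.1 this
  obtain ⟨g, hg⟩ : ∃ g, ∀ x, p x = app g (R.π x) := by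
    refine ⟨fun j => p (sec (Pi.single j 1)), fun x => ?_⟩
    rw [← app_of_add (fun v => p (sec v)) (fun v w => by
      rw [← padd]; apply pcong; rw [map_add, hsec, hsec, hsec])]
    exact pcong _ _ (hsec _).symm
  have Fa : ∀ k, F1 (R.a k) = R'.a (dt g * k) := by
    intro k
    obtain ⟨x, y, z, hd⟩ := R.exists_det (-k)
    have := (A1 x y z).1
    rw [hg, hg, hg, det3_app, hd, neg_neg] at this
    rw [this, ← map_neg]; congr 1; ring
  have Fadd : ∀ u v, F1 (u + v) + R'.a (del g (R.π (u + v))) =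
      F1 u + R'.a (del g (R.π u)) + (F1 v + R'.a (del g (R.π v))) := by
    intro u v
    have h1 := F1a (u + v - R.a (DD (R.π u) (R.π v))) (DD (R.π u) (R.π v))
    rw [sub_add_cancel, Fa, H1, hg, hg] at h1
    rw [h1, map_add, del_add]
    simp only [map_add, map_sub]; abel
  let F : G →+ G' := AddMonoidHom.mk' (fun u => F1 u + R'.a (del g (R.π u))) Fadd
  have hF : ∀ u, F u = F1 u + R'.a (del g (R.π u)) := fun _ => rfl
  let ρ : V3 → ZMod 3 := fun x => - NN o (app g x) - del g x
  have ρ0 : ρ 0 = 0 := by simp [ρ, app_zero, NN_zero, del_zero]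
  have ff : ∀ z, f z = f 0 + F z + R'.a (ρ (R.π z)) := by
    have h1 : ∀ z, f z = f R.c - F R.c + F z + R'.a (ρ (R.π z)) := by
      intro z
      have : F (z - R.c) = F z - F R.c := map_sub _ _ _
      rw [hF] at this
      simp only [F1, F0, sub_add_cancel, hg, map_sub, R.πc, sub_zero] at this
      simp only [ρ, map_sub, map_neg]
      linear_combination (norm := module) this
    intro z
    have h2 := h1 0
    rw [map_zero F, map_zero R.π, ρ0, map_zero R'.a, add_zero, add_zero] at h2
    rw [h2, ← h1]
  have Fπ : ∀ x, R'.π (F x) = app g (R.π x) := by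
    intro x; rw [hF, map_add, pF, R'.πa, add_zero, hg]
  have πf : ∀ z, R'.π (f z) = o + app g (R.π z) := by
    intro z; rw [ff]; simp only [map_add, Fπ, R'.πa, add_zero]; rfl
  have Fc : F R.c = R'.c + R'.τ 0 (f 0) := by
    have h1 := hf 0 0
    rw [m2, ff R.c, R.πc, ρ0, map_zero R'.a, add_zero, QRep.mul, DD_self, map_zero R'.a, add_zero] at h1
    have h3 := R'.three (f 0)
    linear_combination (norm := module) h1 + h3
  have ρ2 : ∀ x, ρ (-x) + ρ x = NN o (app g x) := by
    intro x
    simp only [ρ, app_neg, NN_neg, del_neg]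
    linear_combination (-1) * z3three (NN o (app g x))
  have F1τ : ∀ s, F (R.τ 1 s) = R'.τ 1 (F s) := by
    intro s
    have h1 := hf s 0
    rw [m0, ff, QRep.mul, πf, πf, map_zero R.π, app_zero, add_zero, DD_shift1] at h1
    simp only [map_add, map_sub, R.πτ, R.πc, zero_sub, add_zero] at h1
    rw [ff s] at h1
    rw [Fc] at h1
    have h2 := congrArg R'.a (ρ2 (R.π s))
    have h3 := R'.three (f 0)
    simp only [map_add, R'.τa] at h1 h2
    linear_combination (norm := module) h1 + (-1 : ℤ) • h2 + h3
  have F2τ : ∀ s, F (R.τ 2 s) = R'.τ 2 (F s) := by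
    intro s
    have h1 := hf 0 s
    rw [m1, ff, QRep.mul, πf, πf, map_zero R.π, app_zero, add_zero, DD_shift2] at h1
    simp only [map_add, map_sub, R.πτ, R.πc, zero_sub, add_zero] at h1
    rw [ff s] at h1
    rw [Fc] at h1
    have h2 := congrArg R'.a (ρ2 (R.π s))
    have h3 := R'.three (f 0)
    simp only [map_add, R'.τa] at h1 h2
    linear_combination (norm := module) h1 + (-1 : ℤ) • h2 + h3
  have F0τ : ∀ s, F (R.τ 0 s) = R'.τ 0 (F s) := by
    intro s
    have h1 := congrArg F (R.three s)
    simp only [map_add, map_sub, F1τ, F2τ] at h1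
    have h3 := R'.three (F s)
    linear_combination (norm := module) (-1 : ℤ) • h1 + h3
  have F0inj : ∀ x, F0 x = 0 → x = 0 := by
    intro x hx
    have : f (x + R.c) = f R.c := sub_eq_zero.1 hx
    simpa using f.injective this
  have hdt : dt g ≠ 0 := by
    intro h
    have h1 := Fa 1
    simp only [F1, pa, NN_zero, map_zero, add_zero, h, zero_mul] at h1
    have h2 := R.ainj ((F0inj _ h1).trans (map_zero R.a).symm)
    exact absurd h2 (by decide)
  have Finj : Function.Injective F := by
    rw [injective_iff_map_eq_zero]
    intro x hx
    have h1 := Fπ x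
    rw [hx, map_zero] at h1
    have h2 := app_inj hdt h1.symm
    have h3 := hF x
    simp only [F1, pker x h2, NN_zero, h2, del_zero, map_zero, add_zero, hx] at h3
    exact F0inj x h3.symm
  refine ⟨F, g, f 0, ?_, Fπ, ?_, ?_, Fc⟩
  · exact Finj.bijective_of_nat_card_le (by rw [R.card, R'.card])
  · intro i x
    fin_cases i
    · exact F0τ x
    · exact F1τ x
    · exact F2τ x
  · intro k
    rw [hF, Fa, R.πa, del_zero, map_zero, add_zero]
end QRep


/-! Balanced representatives and carries. -/
def bal (x : ZMod 3) : ℤ := if x = 0 then 0 else if x = 1 then 1 else -1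
def kap (x y : ZMod 3) : ℤ := (bal x + bal y - bal (x + y)) / 3

theorem bal_add : ∀ x y, bal x + bal y = bal (x + y) + 3 * kap x y := by decide
theorem kap_symm : ∀ x y, kap x y = kap y x := by decide
theorem kap_assoc : ∀ x y z, kap x y + kap (x + y) z = kap y z + kap x (y + z) := by decide
theorem kap_zero : ∀ x, kap 0 x = 0 := by decide
theorem kap_self : ∀ x, kap x x + kap (x + x) x = bal x := by decide
theorem bal_zero : bal 0 = 0 := by decide
theorem bal_one : bal 1 = 1 := by decide
theorem bal_mul : ∀ x y, bal (x * y) = bal x * bal y := by decide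
theorem bal_neg : ∀ x, bal (-x) = - bal x := by decide
theorem bal_cast : ∀ x, ((bal x : ℤ) : ZMod 3) = x := by decide

/-- The balanced combination. -/
def comb {M : Type} [AddCommGroup M] (v : V3) (m : Fin 3 → M) : M :=
  bal (v 0) • m 0 + bal (v 1) • m 1 + bal (v 2) • m 2
def carry {M : Type} [AddCommGroup M] (v v' : V3) (m : Fin 3 → M) : M :=
  kap (v 0) (v' 0) • m 0 + kap (v 1) (v' 1) • m 1 + kap (v 2) (v' 2) • m 2

section
variable {M N : Type} [AddCommGroup M] [AddCommGroup N]
theorem comb_add (v v' : V3) (m n : Fin 3 → M) (h : ∀ j, n j = m j + m j + m j) :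
    comb v m + comb v' m = comb (v + v') m + carry v v' n := by
  have h0 := bal_add (v 0) (v' 0)
  have h1 := bal_add (v 1) (v' 1)
  have h2 := bal_add (v 2) (v' 2)
  simp only [comb, carry, h, Pi.add_apply]
  have e : ∀ (j : Fin 3), bal (v j) • m j + bal (v' j) • m j = bal (v j + v' j) • m j +
      kap (v j) (v' j) • (m j + m j + m j) := by
    intro j
    rw [← add_smul, bal_add]
    module
  have e0 := e 0
  have e1 := e 1
  have e2 := e 2
  linear_combination (norm := module) e0 + e1 + e2
theorem comb_map (F : M →+ N) (v : V3) (m : Fin 3 → M) :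
    F (comb v m) = comb v (fun j => F (m j)) := by
  simp only [comb, map_add, map_zsmul]
theorem carry_map (F : M →+ N) (v v' : V3) (m : Fin 3 → M) :
    F (carry v v' m) = carry v v' (fun j => F (m j)) := by
  simp only [carry, map_add, map_zsmul]
theorem comb_zero (m : Fin 3 → M) : comb 0 m = 0 := by simp [comb, bal_zero]
theorem comb_single (m : Fin 3 → M) (j : Fin 3) : comb (Pi.single j 1) m = m j := by
  fin_cases j <;> simp [comb, bal_zero, bal_one]
theorem comb_app (g : Fin 3 → V3) (v : V3) : comb v g = app g v := by
  funext i
  have e : ∀ (n : ℤ) (x : V3), (n • x) i = (n : ZMod 3) * x i := fun n x => by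
    rw [Pi.smul_apply, zsmul_eq_mul]
  simp only [comb, app, Pi.add_apply, e, bal_cast]
end

/-- A normalized symmetric cocycle. -/
structure Coc (A B : Type) [AddCommGroup A] [AddCommGroup B] where
  c : A → A → B
  symm : ∀ x y, c x y = c y x
  assoc : ∀ x y z, c x y + c (x + y) z = c y z + c x (y + z)
  zero : ∀ x, c 0 x = 0

@[ext] structure CE {A B : Type} [AddCommGroup A] [AddCommGroup B] (k : Coc A B) where
  fst : A
  snd : B

namespace CE
variable {A B : Type} [AddCommGroup A] [AddCommGroup B] (k : Coc A B)
instance : Zero (CE k) := ⟨⟨0, 0⟩⟩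
instance : Add (CE k) := ⟨fun x y => ⟨x.fst + y.fst, x.snd + y.snd + k.c x.fst y.fst⟩⟩
instance : Neg (CE k) := ⟨fun x => ⟨- x.fst, - x.snd - k.c (-x.fst) x.fst⟩⟩
variable {k}
@[simp] theorem fst_zero : (0 : CE k).fst = 0 := rfl
@[simp] theorem snd_zero : (0 : CE k).snd = 0 := rfl
@[simp] theorem fst_add (x y : CE k) : (x + y).fst = x.fst + y.fst := rfl
theorem snd_add (x y : CE k) : (x + y).snd = x.snd + y.snd + k.c x.fst y.fst := rfl
instance : AddCommGroup (CE k) where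
  add_assoc x y z := by
    ext
    · exact add_assoc _ _ _
    · simp only [snd_add, fst_add]
      have := k.assoc x.fst y.fst z.fst
      linear_combination (norm := module) this
  zero_add x := by
    ext
    · exact zero_add _
    · simp [snd_add, k.zero]
  add_zero x := by
    ext
    · exact add_zero _
    · rw [snd_add, k.symm]; simp [k.zero]
  neg_add_cancel x := by
    ext
    · exact neg_add_cancel _
    · change - x.snd - k.c (-x.fst) x.fst + x.snd + k.c (-x.fst) x.fst = 0
      abel
  add_comm x y := by
    ext
    · exact add_comm _ _
    · simp only [snd_add]; rw [k.symm, add_comm x.snd]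
  nsmul := nsmulRec
  zsmul := zsmulRec
def toProd : CE k ≃ A × B := ⟨fun x => (x.fst, x.snd), fun x => ⟨x.1, x.2⟩, fun _ => rfl, fun _ => rfl⟩
def fstHom : CE k →+ A := AddMonoidHom.mk' (fun x => x.fst) fun _ _ => rfl
def inr : B →+ CE k := AddMonoidHom.mk' (fun x => ⟨0, x⟩) fun x y => by
  ext
  · simp
  · simp [snd_add, k.zero]
@[simp] theorem fst_inr (x : B) : (inr x : CE k).fst = 0 := rfl
@[simp] theorem snd_inr (x : B) : (inr x : CE k).snd = x := rfl
@[simp] theorem fstHom_apply (x : CE k) : fstHom x = x.fst := rfl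
theorem inr_inj : Function.Injective (inr : B → CE k) := fun x y h => congrArg CE.snd h
theorem eq_inr {x : CE k} (h : x.fst = 0) : x = inr x.snd := CE.ext h rfl
end CE

/-- The structure carried by the kernel of `π`. -/
structure ZD (Z : Type) [AddCommGroup Z] where
  τ : Fin 3 → Z →+ Z
  a : ZMod 3 →+ Z
  τa : ∀ i k, τ i (a k) = 0
  ainj : Function.Injective a
  comm : ∀ i j x, τ i (τ j x) = τ j (τ i x)
  three : ∀ x, τ 1 x + τ 2 x - τ 0 x = x + x + x
  inj1 : ∀ x, τ 1 x = x → x = 0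
  inj2 : ∀ x, τ 2 x = x → x = 0
  card : Nat.card Z = 9

namespace ZD
variable {Z : Type} [AddCommGroup Z] (D : ZD Z)

def Good (T : Fin 3 → Fin 3 → Z) : Prop := ∀ i k j, D.τ i (T k j) = D.τ k (T i j)
def T3 (T : Fin 3 → Fin 3 → Z) (j : Fin 3) : Z := T 1 j + T 2 j - T 0 j

def mcoc (T : Fin 3 → Fin 3 → Z) : Coc V3 Z where
  c v v' := carry v v' (T3 T)
  symm v v' := by simp only [carry, kap_symm]
  assoc x y z := by
    have e : ∀ j, (kap (x j) (y j) + kap (x j + y j) (z j)) • T3 T j =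
      (kap (y j) (z j) + kap (x j) (y j + z j)) • T3 T j := fun j => by rw [kap_assoc]
    have e0 := e 0
    have e1 := e 1
    have e2 := e 2
    simp only [carry, Pi.add_apply]
    linear_combination (norm := module) e0 + e1 + e2
  zero x := by simp [carry, kap_zero]

theorem three_T {T : Fin 3 → Fin 3 → Z} (hT : D.Good T) (i j) :
    D.τ i (T3 T j) = T i j + T i j + T i j := by
  rw [T3, map_sub, map_add, hT i 1, hT i 2, hT i 0, D.three]

/-- The model attached to `(T, γ)`. -/
def model (T : Fin 3 → Fin 3 → Z) (γ : Z) (hT : D.Good T) : QRep (CE (mcoc T)) where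
  π := CE.fstHom
  τ i := AddMonoidHom.mk' (fun x => CE.inr (comb x.fst (T i) + D.τ i x.snd)) fun x y => by
    rw [← map_add]
    congr 1
    rw [CE.fst_add, CE.snd_add, map_add, map_add]
    have e := comb_add x.fst y.fst (T i) _ (D.three_T hT i)
    rw [← carry_map] at e
    change _ + (_ + (D.τ i (carry x.fst y.fst (T3 T)))) = _
    linear_combination (norm := module) (-1 : ℤ) • e
  a := CE.inr.comp D.a
  c := CE.inr γ
  πsurj v := ⟨⟨v, 0⟩, rfl⟩
  πτ i x := rfl
  τa i k := by
    change CE.inr (comb 0 (T i) + D.τ i (D.a k)) = 0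
    rw [comb_zero, D.τa, add_zero, map_zero]
  πa k := rfl
  πc := rfl
  ainj := CE.inr_inj.comp D.ainj
  comm i j x := by
    change CE.inr (comb 0 (T i) + D.τ i (comb x.fst (T j) + D.τ j x.snd)) =
      CE.inr (comb 0 (T j) + D.τ j (comb x.fst (T i) + D.τ i x.snd))
    rw [comb_zero, comb_zero, map_add (D.τ i), map_add (D.τ j), D.comm i j, comb_map, comb_map]
    simp only [hT i j]
  three x := by
    change CE.inr (comb x.fst (T 1) + D.τ 1 x.snd) + CE.inr (comb x.fst (T 2) + D.τ 2 x.snd) -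
      CE.inr (comb x.fst (T 0) + D.τ 0 x.snd) = x + x + x
    rw [← map_add, ← map_sub]
    apply CE.ext
    · funext i; exact (z3three _).symm
    · have h := D.three x.snd
      change comb x.fst (T 1) + D.τ 1 x.snd + (comb x.fst (T 2) + D.τ 2 x.snd) -
        (comb x.fst (T 0) + D.τ 0 x.snd) = x.snd + x.snd + carry x.fst x.fst (T3 T) + x.snd +
        carry (x.fst + x.fst) x.fst (T3 T)
      have e : ∀ j, bal (x.fst j) • T3 T j = (kap (x.fst j) (x.fst j) +
        kap (x.fst j + x.fst j) (x.fst j)) • T3 T j := fun j => by rw [kap_self]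
      have e0 := e 0
      have e1 := e 1
      have e2 := e 2
      simp only [carry, comb, Pi.add_apply]
      simp only [T3] at e0 e1 e2 ⊢
      linear_combination (norm := module) h + e0 + e1 + e2
  inj1 x h := by
    have h1 : x.fst = 0 := (congrArg CE.fst h).symm
    have h2 : comb x.fst (T 1) + D.τ 1 x.snd = x.snd := congrArg CE.snd h
    rw [h1, comb_zero, zero_add] at h2
    exact CE.ext h1 (D.inj1 _ h2)
  inj2 x h := by
    have h1 : x.fst = 0 := (congrArg CE.fst h).symm
    have h2 : comb x.fst (T 2) + D.τ 2 x.snd = x.snd := congrArg CE.snd h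
    rw [h1, comb_zero, zero_add] at h2
    exact CE.ext h1 (D.inj2 _ h2)
  card := by
    rw [Nat.card_congr CE.toProd, Nat.card_prod, D.card]
    simp

variable {D}
theorem model_τ {T : Fin 3 → Fin 3 → Z} {γ : Z} (hT : D.Good T) (i) (x : CE (mcoc T)) :
    (D.model T γ hT).τ i x = CE.inr (comb x.fst (T i) + D.τ i x.snd) := rfl

variable {G : Type} [AddCommGroup G] {R : QRep G}

theorem liso_model {T : Fin 3 → Fin 3 → Z} {γ : Z} (hT : D.Good T) (ι : Z →+ G) (w : Fin 3 → G)
    (u : G) (hι : Function.Injective ι) (hπ : ∀ z, R.π (ι z) = 0)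
    (hτ : ∀ i z, ι (D.τ i z) = R.τ i (ι z))
    (ha : ∀ k, ι (D.a k) = R.a (dt (fun j => R.π (w j)) * k))
    (hw : ∀ i j, ι (T i j) = R.τ i (w j)) (hc : ι γ = R.c + R.τ 0 u) :
    QRep.LIso (D.model T γ hT) R := by
  have h3 : ∀ j, ι (T3 T j) = w j + w j + w j := by
    intro j
    rw [T3, map_sub, map_add, hw, hw, hw, R.three]
  let F : CE (mcoc T) →+ G := AddMonoidHom.mk' (fun x => comb x.fst w + ι x.snd) fun x y => by
    have e := comb_add x.fst y.fst w _ h3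
    rw [← carry_map] at e
    rw [CE.snd_add, map_add, map_add]
    change comb (x.fst + y.fst) w + (ι x.snd + ι y.snd + ι (carry x.fst y.fst (T3 T))) = _
    linear_combination (norm := module) (-1 : ℤ) • e
  have hF : ∀ x, F x = comb x.fst w + ι x.snd := fun _ => rfl
  have Fπ : ∀ x, R.π (F x) = app (fun j => R.π (w j)) x.fst := by
    intro x
    rw [hF, map_add, hπ, add_zero, comb_map, comb_app]
  have hr : ∀ z, F (CE.inr z) = ι z := by
    intro z; rw [hF]; simp [comb_zero]
  have hdt : dt (fun j => R.π (w j)) ≠ 0 := by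
    intro h
    have := ha 1
    rw [h, zero_mul, map_zero] at this
    have h2 := D.ainj ((hι (this.trans (map_zero ι).symm)).trans (map_zero D.a).symm)
    exact absurd h2 (by decide)
  have Finj : Function.Injective F := by
    rw [injective_iff_map_eq_zero]
    intro x hx
    have h1 := Fπ x
    rw [hx, map_zero] at h1
    have h2 := app_inj hdt h1.symm
    have h3 := hF x
    rw [h2, comb_zero, zero_add, hx] at h3
    exact CE.ext h2 (hι (h3.symm.trans (map_zero ι).symm))
  have := R.fin
  have := (D.model T γ hT).fin
  refine ⟨F, fun j => R.π (w j), u, ?_, Fπ, ?_, ?_, ?_⟩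
  · exact Finj.bijective_of_nat_card_le (by rw [R.card, (D.model T γ hT).card])
  · intro i x
    rw [model_τ, hr, hF, map_add, map_add, hτ, comb_map, comb_map]
    simp only [hw]
  · intro k
    exact (hr _).trans (ha k)
  · exact (hr _).trans hc

theorem of_liso_model {T : Fin 3 → Fin 3 → Z} {γ : Z} (hT : D.Good T)
    (h : QRep.LIso (D.model T γ hT) R) : ∃ (ι : Z →+ G) (w : Fin 3 → G) (u : G),
    Function.Injective ι ∧ (∀ z, R.π (ι z) = 0) ∧ (∀ i z, ι (D.τ i z) = R.τ i (ι z)) ∧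
    (∀ k, ι (D.a k) = R.a (dt (fun j => R.π (w j)) * k)) ∧
    (∀ i j, ι (T i j) = R.τ i (w j)) ∧ ι γ = R.c + R.τ 0 u := by
  obtain ⟨F, g, u, hb, hπ, hτ, ha, hc⟩ := h
  have hg : ∀ j, R.π (F ⟨Pi.single j 1, 0⟩) = g j := by
    intro j
    rw [hπ]
    change app g (Pi.single j 1) = _
    rw [← comb_app, comb_single]
  refine ⟨F.comp CE.inr, fun j => F ⟨Pi.single j 1, 0⟩, u, hb.1.comp CE.inr_inj, ?_, ?_, ?_, ?_, hc⟩
  · intro z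
    exact (hπ _).trans (app_zero g)
  · intro i z
    have := hτ i (CE.inr z)
    rw [model_τ] at this
    simpa [comb_zero] using this
  · intro k
    simp only [hg]
    exact ha k
  · intro i j
    have := hτ i ⟨Pi.single j 1, 0⟩
    rw [model_τ] at this
    simpa [comb_single] using this

variable {Z' : Type} [AddCommGroup Z'] {D' : ZD Z'}

/-- Explicit form of an isomorphism between models. -/
theorem model_iff {T : Fin 3 → Fin 3 → Z} {γ : Z} (hT : D.Good T) {T' : Fin 3 → Fin 3 → Z'}
    {γ' : Z'} (hT' : D'.Good T') :
    QRep.LIso (D.model T γ hT) (D'.model T' γ' hT') ↔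
    ∃ (θ : Z →+ Z') (g : Fin 3 → V3) (y : Fin 3 → Z') (n : V3) (y' : Z'),
      Function.Injective θ ∧ (∀ i z, θ (D.τ i z) = D'.τ i (θ z)) ∧
      (∀ k, θ (D.a k) = D'.a (dt g * k)) ∧
      (∀ i j, θ (T i j) = comb (g j) (T' i) + D'.τ i (y j)) ∧
      θ γ = γ' + (comb n (T' 0) + D'.τ 0 y') := by
  constructor
  · intro h
    obtain ⟨ι, w, u, hι, hπ, hτ, ha, hw, hc⟩ := of_liso_model hT h
    let θ : Z →+ Z' := AddMonoidHom.mk' (fun z => (ι z).snd) fun x y => by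
      rw [map_add, CE.snd_add]
      change _ + _ + carry (ι x).fst _ _ = _
      have : (ι x).fst = 0 := hπ x
      rw [this]
      simp [carry, kap_zero]
    have hθ : ∀ z, ι z = CE.inr (θ z) := fun z => CE.eq_inr (hπ z)
    refine ⟨θ, fun j => (w j).fst, fun j => (w j).snd, u.fst, u.snd, ?_, ?_, ?_, ?_, ?_⟩
    · intro x y h
      apply hι
      rw [hθ, hθ, h]
    · intro i z
      have := hτ i z
      rw [hθ, hθ, model_τ] at this
      simpa [comb_zero] using CE.inr_inj this
    · intro k
      have := ha k
      rw [hθ] at this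
      exact CE.inr_inj this
    · intro i j
      have := hw i j
      rw [hθ, model_τ] at this
      exact CE.inr_inj this
    · rw [hθ, model_τ] at hc
      change _ = CE.inr γ' + _ at hc
      rw [← map_add] at hc
      exact CE.inr_inj hc
  · rintro ⟨θ, g, y, n, y', hθ, hτ, ha, hT2, hc⟩
    refine liso_model hT (CE.inr.comp θ) (fun j => ⟨g j, y j⟩) ⟨n, y'⟩ (CE.inr_inj.comp hθ) ?_ ?_ ?_
      ?_ ?_
    · intro z; rfl
    · intro i z
      rw [model_τ]
      simp [comb_zero, hτ]
    · intro k
      exact congrArg CE.inr (ha k)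
    · intro i j
      exact congrArg CE.inr (hT2 i j)
    · rw [model_τ]
      change _ = CE.inr γ' + _
      rw [← map_add]
      exact congrArg CE.inr hc
end ZD


theorem kap_dmul : ∀ d x y : ZMod 3, ((kap (d * x) (d * y) : ℤ) : ZMod 3) = d * (kap x y : ℤ) := by
  decide

def Nrm (z : V3) : Prop := z 0 = 1 ∨ (z 0 = 0 ∧ (z 1 = 1 ∨ (z 1 = 0 ∧ z 2 = 1)))
instance : DecidablePred Nrm := fun z => by unfold Nrm; infer_instance

theorem z3cases (x : ZMod 3) : x = 0 ∨ x = 1 ∨ x = -1 := by revert x; decide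
theorem z3sq {x : ZMod 3} (h : x ≠ 0) : x * x = 1 := by revert x; decide

theorem nrm_or {v : V3} (h : v ≠ 0) : Nrm v ∨ Nrm (-v) := by
  unfold Nrm
  simp only [Pi.neg_apply, neg_eq_zero]
  have hn : ∀ x : ZMod 3, -x = 1 ↔ x = -1 := by decide
  simp only [hn]
  have h0 := z3cases (v 0)
  have h1 := z3cases (v 1)
  have h2 := z3cases (v 2)
  by_contra hc
  apply h
  funext i
  fin_cases i <;> simp <;> tauto
theorem nrm_ne {v : V3} (h : Nrm v) : v ≠ 0 := by
  rintro rfl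
  revert h; decide
theorem nrm_eq {v w : V3} (hv : Nrm v) (hw : Nrm w) {d : ZMod 3} (h : ∀ i, w i = d * v i) :
    d = 1 := by
  have e : ∀ d : ZMod 3, d = 0 ∨ d = 1 ∨ d = -1 := by decide
  rcases hv with h0 | ⟨h0, h1 | ⟨h1, h2⟩⟩ <;> rcases hw with g0 | ⟨g0, g1 | ⟨g1, g2⟩⟩ <;>
  have e0 := h 0 <;> have e1 := h 1 <;> have e2 := h 2 <;>
  simp_all <;> exact absurd g0 (by decide)

structure Par where
  r : V3
  z : V3
  h0 : r 0 = r 1 + r 2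
  h1 : r 1 ≠ 1
  h2 : r 2 ≠ 1
  hz : r = 0 ∨ z = 0

def zcoc (k : ZMod 3) : Coc (ZMod 3) (ZMod 3) where
  c f f' := (kap f f' : ℤ) * k
  symm x y := by rw [kap_symm]
  assoc x y z := by
    have := congrArg (fun n : ℤ => (n : ZMod 3) * k) (kap_assoc x y z)
    simp only [Int.cast_add] at this
    linear_combination this
  zero x := by simp [kap_zero]

namespace Par
variable (p : Par)
def k : ZMod 3 := p.z 1 + p.z 2 - p.z 0
abbrev Z := CE (zcoc p.k)

theorem rk (i : Fin 3) (x y : ZMod 3) : ((kap (p.r i * x) (p.r i * y) : ℤ) : ZMod 3) * p.k = 0 := by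
  rw [kap_dmul]
  rcases p.hz with h | h
  · simp [h]
  · simp [k, h]

def D : ZD p.Z where
  τ i := AddMonoidHom.mk' (fun x => ⟨p.r i * x.fst, p.z i * x.fst⟩) fun x y => by
    apply CE.ext
    · simp only [CE.fst_add]; ring
    · rw [CE.snd_add]
      change p.z i * (x.fst + y.fst) = p.z i * x.fst + p.z i * y.fst +
        ((kap (p.r i * x.fst) (p.r i * y.fst) : ℤ) : ZMod 3) * p.k
      rw [p.rk]; ring
  a := CE.inr
  τa i k := by
    apply CE.ext
    · exact mul_zero _
    · exact mul_zero _
  ainj := CE.inr_inj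
  comm i j x := by
    apply CE.ext
    · change p.r i * (p.r j * x.fst) = p.r j * (p.r i * x.fst); ring
    · change p.z i * (p.r j * x.fst) = p.z j * (p.r i * x.fst)
      rcases p.hz with h | h <;> simp [h]
  three x := by
    rw [sub_eq_iff_eq_add]
    apply CE.ext
    · change p.r 1 * x.fst + p.r 2 * x.fst = x.fst + x.fst + x.fst + p.r 0 * x.fst
      rw [z3three, p.h0]; ring
    · change p.z 1 * x.fst + p.z 2 * x.fst + ((kap (p.r 1 * x.fst) (p.r 2 * x.fst) : ℤ) : ZMod 3) * p.k
        = x.snd + x.snd + (kap x.fst x.fst : ℤ) * p.k + x.snd +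
          (kap (x.fst + x.fst) x.fst : ℤ) * p.k + p.z 0 * x.fst +
          (kap (x.fst + x.fst + x.fst) (p.r 0 * x.fst) : ℤ) * p.k
      have e : ((kap (p.r 1 * x.fst) (p.r 2 * x.fst) : ℤ) : ZMod 3) * p.k = 0 := by
        rcases p.hz with h | h
        · simp [h, kap_zero]
        · simp [h, k]
      have e2 := congrArg (fun n : ℤ => (n : ZMod 3) * p.k) (kap_self x.fst)
      have e3 := z3three x.snd
      simp only [Int.cast_add, bal_cast] at e2
      rw [e, z3three x.fst, kap_zero, Int.cast_zero]
      have e4 : p.k = p.z 1 + p.z 2 - p.z 0 := rfl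
      linear_combination (-1) * e2 - e3 - x.fst * e4
  inj1 x h := by
    have a1 : p.r 1 * x.fst = x.fst := congrArg CE.fst h
    have a2 : p.z 1 * x.fst = x.snd := congrArg CE.snd h
    have : (p.r 1 - 1) * x.fst = 0 := by linear_combination a1
    have := (mul_eq_zero.1 this).resolve_left (sub_ne_zero.2 p.h1)
    exact CE.ext this (by rw [← a2, this]; simp)
  inj2 x h := by
    have a1 : p.r 2 * x.fst = x.fst := congrArg CE.fst h
    have a2 : p.z 2 * x.fst = x.snd := congrArg CE.snd h
    have : (p.r 2 - 1) * x.fst = 0 := by linear_combination a1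
    have := (mul_eq_zero.1 this).resolve_left (sub_ne_zero.2 p.h2)
    exact CE.ext this (by rw [← a2, this]; simp)
  card := by
    rw [Nat.card_congr CE.toProd, Nat.card_prod]
    simp

variable {p}
@[simp] theorem τ_fst (i) (x : p.Z) : (p.D.τ i x).fst = p.r i * x.fst := rfl
@[simp] theorem τ_snd (i) (x : p.Z) : (p.D.τ i x).snd = p.z i * x.fst := rfl
theorem a_eq (k) : p.D.a k = (⟨0, k⟩ : p.Z) := rfl

/-- homomorphisms between the kernels -/
theorem hom_form {p q : Par} {θ : p.Z →+ q.Z} {ε : ZMod 3} (hθ : Function.Injective θ)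
    (hτ : ∀ i z, θ (p.D.τ i z) = q.D.τ i (θ z)) (ha : ∀ k, θ (p.D.a k) = q.D.a (ε * k)) :
    ∃ d t : ZMod 3, d ≠ 0 ∧ (∀ x, θ x = ⟨d * x.fst, ε * x.snd + t * x.fst⟩) ∧ q.r = p.r ∧
      ∀ i, ε * p.z i + t * p.r i = d * q.z i := by
  let e : p.Z := ⟨1, 0⟩
  obtain ⟨d, t, hdt⟩ : ∃ d t, θ e = ⟨d, t⟩ := ⟨_, _, rfl⟩
  have form : ∀ x, θ x = ⟨d * x.fst, ε * x.snd + t * x.fst⟩ := by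
    intro x
    have key : ∀ f : ZMod 3, θ ⟨f, 0⟩ = ⟨d * f, t * f⟩ := by
      intro f
      rcases z3cases f with rfl | rfl | rfl
      · change θ 0 = _
        rw [map_zero, mul_zero, mul_zero]; rfl
      · rw [mul_one, mul_one]; exact hdt
      · have e1 : (⟨-1, 0⟩ : p.Z) = - e := by
          rw [eq_neg_iff_add_eq_zero]
          apply CE.ext
          · exact neg_add_cancel _
          · change 0 + 0 + ((kap (-1) 1 : ℤ) : ZMod 3) * p.k = 0
            rw [show kap (-1) 1 = 0 by decide]; simp
        rw [e1, map_neg, hdt, neg_eq_iff_add_eq_zero]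
        apply CE.ext
        · change d + d * (-1) = 0; ring
        · change t + t * (-1) + ((kap d (d * (-1)) : ℤ) : ZMod 3) * q.k = 0
          have : ∀ d, kap d (d * (-1)) = 0 := by decide
          rw [this]; push_cast; ring
    have e2 : x = ⟨x.fst, 0⟩ + p.D.a x.snd := by
      apply CE.ext
      · exact (add_zero _).symm
      · change _ = 0 + x.snd + ((kap x.fst 0 : ℤ) : ZMod 3) * p.k
        rw [kap_symm, kap_zero]; simp
    rw [e2, map_add, key, ha, ← e2]
    apply CE.ext
    · exact add_zero _
    · change t * x.fst + ε * x.snd + ((kap (d * x.fst) 0 : ℤ) : ZMod 3) * q.k = _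
      rw [kap_symm, kap_zero]; push_cast; ring
  have hd : d ≠ 0 := by
    rintro rfl
    have hε : ε ≠ 0 := by
      rintro rfl
      have := ha 1
      rw [zero_mul, map_zero] at this
      have := congrArg CE.snd (hθ (this.trans (map_zero θ).symm))
      exact absurd (show (1 : ZMod 3) = 0 from this) (by decide)
    have h1 := ha (ε * t)
    rw [← mul_assoc, z3sq hε, one_mul] at h1
    have h2 : θ e = q.D.a t := hdt
    have := congrArg CE.fst (hθ (h2.trans h1.symm))
    exact absurd (show (1 : ZMod 3) = 0 from this) (by decide)
  refine ⟨d, t, hd, form, ?_, ?_⟩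
  · funext i
    have := congrArg CE.fst (hτ i e)
    rw [form, form] at this
    change d * (p.r i * 1) = q.r i * (d * 1) at this
    exact (mul_left_cancel₀ hd (by linear_combination this)).symm
  · intro i
    have := congrArg CE.snd (hτ i e)
    rw [form, form] at this
    change ε * (p.z i * 1) + t * (p.r i * 1) = q.z i * (d * 1) at this
    linear_combination this

theorem exists_hom (p : Par) {d t ε : ZMod 3} (hd : d ≠ 0) (hε : ε ≠ 0)
    (h : ∀ i, ε * p.z i + t * p.r i = d * p.z i) : ∃ θ : p.Z →+ p.Z, Function.Injective θ ∧
    (∀ i z, θ (p.D.τ i z) = p.D.τ i (θ z)) ∧ (∀ k, θ (p.D.a k) = p.D.a (ε * k)) ∧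
    (∀ x, θ x = ⟨d * x.fst, ε * x.snd + t * x.fst⟩) := by
  have hk : ε * p.k = d * p.k := by
    have a0 := h 0
    have a1 := h 1
    have a2 := h 2
    unfold k
    linear_combination a1 + a2 - a0 + t * p.h0
  let θ : p.Z →+ p.Z := AddMonoidHom.mk' (fun x => ⟨d * x.fst, ε * x.snd + t * x.fst⟩) fun x y => by
    apply CE.ext
    · exact mul_add _ _ _
    · change ε * (x.snd + y.snd + ((kap x.fst y.fst : ℤ) : ZMod 3) * p.k) + t * (x.fst + y.fst) =
        ε * x.snd + t * x.fst + (ε * y.snd + t * y.fst) +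
        ((kap (d * x.fst) (d * y.fst) : ℤ) : ZMod 3) * p.k
      rw [kap_dmul]
      linear_combination ((kap x.fst y.fst : ℤ) : ZMod 3) * hk
  refine ⟨θ, ?_, ?_, ?_, fun _ => rfl⟩
  · rw [injective_iff_map_eq_zero]
    intro x hx
    have h1 : d * x.fst = 0 := congrArg CE.fst hx
    have h2 : ε * x.snd + t * x.fst = 0 := congrArg CE.snd hx
    have h3 := (mul_eq_zero.1 h1).resolve_left hd
    rw [h3, mul_zero, add_zero] at h2
    exact CE.ext h3 ((mul_eq_zero.1 h2).resolve_left hε)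
  · intro i x
    apply CE.ext
    · change d * (p.r i * x.fst) = p.r i * (d * x.fst); ring
    · change ε * (p.z i * x.fst) + t * (p.r i * x.fst) = p.z i * (d * x.fst)
      linear_combination x.fst * h i
  · intro k
    apply CE.ext
    · exact mul_zero _
    · change ε * k + t * 0 = ε * k; ring
end Par


/-! Classification of the kernel of `π`. -/

/-- Index set of the possible kernels. -/
abbrev Idx := Fin 3 ⊕ Unit ⊕ {z : V3 // Nrm z}

def rI : Fin 3 → V3 := ![![-1, -1, 0], ![-1, 0, -1], ![1, -1, -1]]

theorem rI_inj : ∀ i j : Fin 3, rI i = rI j → i = j := by decide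
theorem rI_ne : ∀ i : Fin 3, rI i 0 ≠ 0 := by decide
theorem rI_surj (r : V3) (h0 : r 0 = r 1 + r 2) (h1 : r 1 ≠ 1) (h2 : r 2 ≠ 1) (h : r ≠ 0) :
    ∃ i, rI i = r := by
  have e : ∀ x y : ZMod 3, x ≠ 1 → y ≠ 1 → (x = 0 ∧ y = 0) ∨
      ∃ i : Fin 3, rI i 0 = x + y ∧ rI i 1 = x ∧ rI i 2 = y := by decide
  rcases e _ _ h1 h2 with ⟨a, b⟩ | ⟨i, a, b, c⟩
  · exfalso; apply h
    funext i
    fin_cases i <;> simp [h0, a, b]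
  · refine ⟨i, ?_⟩
    funext j
    fin_cases j
    · exact a.trans h0.symm
    · exact b
    · exact c

def par : Idx → Par
  | .inl i => ⟨rI i, 0, by revert i; decide, by revert i; decide, by revert i; decide, Or.inr rfl⟩
  | .inr (.inl _) => ⟨0, 0, by decide, by decide, by decide, Or.inr rfl⟩
  | .inr (.inr z) => ⟨0, z.1, by decide, by decide, by decide, Or.inl rfl⟩

theorem par_inj (i j : Idx) {d ε t : ZMod 3} (hd : d ≠ 0) (hε : ε ≠ 0)
    (hr : (par j).r = (par i).r) (hz : ∀ l, ε * (par i).z l + t * (par i).r l = d * (par j).z l) :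
    i = j := by
  have ri : ∀ i, rI i ≠ 0 := fun i h => rI_ne i (by rw [h]; rfl)
  rcases i with i | i | i <;> rcases j with j | j | j
  · rw [rI_inj i j hr.symm]
  · exact absurd hr.symm (ri i)
  · exact absurd hr.symm (ri i)
  · exact absurd hr (ri j)
  · rfl
  · exfalso
    apply nrm_ne j.2
    funext l
    have := hz l
    change ε * 0 + t * 0 = d * j.1 l at this
    simpa [hd] using this
  · exact absurd hr (ri j)
  · exfalso
    apply nrm_ne i.2
    funext l
    have := hz l
    change ε * i.1 l + t * 0 = d * 0 at this
    simpa [hε] using this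
  · have e : ∀ l, j.1 l = (d * ε) * i.1 l := by
      intro l
      have := hz l
      change ε * i.1 l + t * 0 = d * j.1 l at this
      have h2 := z3sq hd
      linear_combination (-d) * this - j.1 l * h2
    have := nrm_eq i.2 j.2 e
    have : i = j := by
      apply Subtype.ext
      funext l
      rw [e l, this, one_mul]
    rw [this]

section
variable {G : Type} [AddCommGroup G] (R : QRep G)

theorem QRep.ker_card : Nat.card R.π.ker = 9 := by
  have h := AddSubgroup.card_eq_card_quotient_mul_card_addSubgroup R.π.ker
  rw [R.card, Nat.card_congr (QuotientAddGroup.quotientKerEquivOfSurjective R.π R.πsurj).toEquiv] at h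
  have : Nat.card V3 = 27 := by simp
  rw [this] at h
  omega

theorem QRep.a_mul (f z : ZMod 3) : R.a (f * z) = bal f • R.a z := by
  rw [← map_zsmul, zsmul_eq_mul, bal_cast]
theorem QRep.ker_fin : Finite R.π.ker := Nat.finite_of_card_ne_zero (by rw [R.ker_card]; norm_num)

/-- builder of an embedding of a standard kernel -/
theorem build (p : Par) (b : G) (hb : R.π b = 0) (hn : ∀ k, R.a k ≠ b)
    (h3 : b + b + b = R.a p.k)
    (hτ : ∀ i, R.τ i b = bal (p.r i) • b + R.a (p.z i)) :
    ∃ ι : p.Z →+ G, Function.Injective ι ∧ (∀ z, R.π (ι z) = 0) ∧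
      (∀ i z, ι (p.D.τ i z) = R.τ i (ι z)) ∧ (∀ k, ι (p.D.a k) = R.a k) ∧
      (∀ x, R.π x = 0 → ∃ z, ι z = x) := by
  let ι : p.Z →+ G := AddMonoidHom.mk' (fun x => bal x.fst • b + R.a x.snd) fun x y => by
    rw [CE.fst_add, CE.snd_add]
    change _ + R.a (_ + (kap x.fst y.fst : ℤ) * p.k) = _
    have e1 := bal_add x.fst y.fst
    have e2 : R.a ((kap x.fst y.fst : ℤ) * p.k) = kap x.fst y.fst • R.a p.k := by
      rw [← map_zsmul, zsmul_eq_mul]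
    have e3 : bal (x.fst + y.fst) = bal x.fst + bal y.fst - 3 * kap x.fst y.fst := by omega
    rw [map_add, map_add, e2, ← h3, e3]
    module
  have hι : ∀ x, ι x = bal x.fst • b + R.a x.snd := fun _ => rfl
  have hinj : Function.Injective ι := by
    rw [injective_iff_map_eq_zero]
    intro x hx
    rw [hι] at hx
    have e : x.fst = 0 := by
      rcases z3cases x.fst with h | h | h
      · exact h
      · rw [h, bal_one, one_smul] at hx
        exact absurd (by rw [map_neg, neg_eq_iff_add_eq_zero, add_comm]; exact hx) (hn (-x.snd))
      · rw [h, bal_neg, bal_one] at hx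
        exact absurd (by linear_combination (norm := module) hx) (hn (x.snd))
    rw [e, bal_zero, zero_smul, zero_add] at hx
    exact CE.ext e (R.ainj (hx.trans (map_zero R.a).symm))
  have hπ : ∀ z, R.π (ι z) = 0 := by
    intro z
    rw [hι, map_add, map_zsmul, hb, R.πa, smul_zero, zero_add]
  refine ⟨ι, hinj, hπ, ?_, ?_, ?_⟩
  · intro i z
    rw [hι, hι, map_add, map_zsmul, R.τa, hτ, Par.τ_fst, Par.τ_snd, bal_mul, mul_comm (p.z i),
      R.a_mul]
    module
  · intro k
    rw [hι]
    change bal 0 • b + R.a k = _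
    rw [bal_zero, zero_smul, zero_add]
  · intro x hx
    have := R.ker_fin
    have : Finite p.Z := Nat.finite_of_card_ne_zero (by rw [p.D.card]; norm_num)
    let j : p.Z → R.π.ker := fun z => ⟨ι z, hπ z⟩
    have hj : Function.Injective j := fun x y h => hinj (congrArg Subtype.val h)
    have := (hj.bijective_of_nat_card_le (by rw [R.ker_card, p.D.card])).2 ⟨x, hx⟩
    obtain ⟨z, hz⟩ := this
    exact ⟨z, congrArg Subtype.val hz⟩

theorem exists_par : ∃ (i : Idx) (ι : (par i).Z →+ G), Function.Injective ι ∧ (∀ z, R.π (ι z) = 0) ∧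
      (∀ l z, ι ((par i).D.τ l z) = R.τ l (ι z)) ∧ (∀ k, ι ((par i).D.a k) = R.a k) ∧
      (∀ x, R.π x = 0 → ∃ z, ι z = x) := by
  have := R.ker_fin
  obtain ⟨b, hb, hn⟩ : ∃ b, R.π b = 0 ∧ ∀ k, R.a k ≠ b := by
    by_contra hc
    push Not at hc
    let j : ZMod 3 → R.π.ker := fun k => ⟨R.a k, R.πa k⟩
    have hj : Function.Surjective j := fun x => by
      obtain ⟨k, hk⟩ := hc x.1 x.2
      exact ⟨k, Subtype.ext hk⟩
    have := Nat.card_le_card_of_surjective j hj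
    rw [R.ker_card] at this
    simp at this
  have h9 : (9 : ℤ) • b = 0 := by
    have h := card_nsmul_eq_zero' (G := R.π.ker) (x := ⟨b, hb⟩)
    rw [R.ker_card] at h
    have := congrArg Subtype.val h
    change 9 • b = 0 at this
    rw [← this]; module
  have hA : ∀ (n : ℤ) (k : ZMod 3), n • b = R.a k → (3 : ℤ) ∣ n := by
    intro n k h
    by_contra hd
    have hc : IsCoprime n 9 := by
      have h3 : IsCoprime (3 : ℤ) n := (Int.prime_three.coprime_iff_not_dvd).2 hd
      have := h3.pow_left (m := 2)
      exact this.symm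
    obtain ⟨u, v, huv⟩ := hc
    apply hn (u • k)
    rw [map_zsmul, ← h]
    have : b = (u * n + v * 9) • b := by rw [huv, one_smul]
    conv_rhs => rw [this]
    rw [add_smul, mul_smul, mul_smul, h9, smul_zero, add_zero]
  have hbal : ∀ m m' : ZMod 3, (3 : ℤ) ∣ bal m - bal m' → m = m' := by decide
  have hex : ∀ x, R.π x = 0 → ∃ m k, x = bal m • b + R.a k := by
    intro x hx
    let j : ZMod 3 × ZMod 3 → R.π.ker := fun q => ⟨bal q.1 • b + R.a q.2, by
      change R.π _ = 0
      rw [map_add, map_zsmul, hb, R.πa, smul_zero, zero_add]⟩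
    have hj : Function.Injective j := by
      rintro ⟨m, k⟩ ⟨m', k'⟩ h
      have h := congrArg Subtype.val h
      change bal m • b + R.a k = bal m' • b + R.a k' at h
      have hm := hbal m m' (hA _ (k' - k) (by
        rw [map_sub]; linear_combination (norm := module) h))
      subst hm
      rw [R.ainj (add_left_cancel h)]
    obtain ⟨⟨m, k⟩, h⟩ := (hj.bijective_of_nat_card_le (by rw [R.ker_card]; simp)).2 ⟨x, hx⟩
    exact ⟨m, k, (congrArg Subtype.val h).symm⟩
  choose r z hτ using fun i => hex (R.τ i b) (R.πτ i b)
  have r1 : r 1 ≠ 1 := by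
    intro h
    have e := hτ 1
    rw [h, bal_one, one_smul] at e
    have := R.inj1 (b + R.a (z 1)) (by rw [map_add, R.τa, e, add_zero])
    exact hn (-z 1) (by rw [map_neg]; linear_combination (norm := module) (-1 : ℤ) • this)
  have r2 : r 2 ≠ 1 := by
    intro h
    have e := hτ 2
    rw [h, bal_one, one_smul] at e
    have := R.inj2 (b + R.a (z 2)) (by rw [map_add, R.τa, e, add_zero])
    exact hn (-z 2) (by rw [map_neg]; linear_combination (norm := module) (-1 : ℤ) • this)
  have r0 : r 0 = r 1 + r 2 := by
    have e := R.three b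
    rw [hτ, hτ, hτ] at e
    have := hA (bal (r 1) + bal (r 2) - bal (r 0) - 3) (z 0 - z 1 - z 2) (by
      rw [map_sub, map_sub]; linear_combination (norm := module) e)
    have := (ZMod.intCast_zmod_eq_zero_iff_dvd _ 3).2 (by exact_mod_cast this)
    push_cast at this
    simp only [bal_cast] at this
    have h3 : (3 : ZMod 3) = 0 := by decide
    linear_combination (-1) * this - h3
  have h3 : ∃ k, b + b + b = R.a k := by
    obtain ⟨m, k, h⟩ := hex (b + b + b) (by rw [map_add, map_add, hb]; simp)
    have := hA (3 - bal m) k (by linear_combination (norm := module) h)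
    have : m = 0 := hbal _ _ (by rw [bal_zero]; omega)
    refine ⟨k, ?_⟩
    rw [h, this, bal_zero, zero_smul, zero_add]
  by_cases hr : r = 0
  · have hτ0 : ∀ i, R.τ i b = R.a (z i) := by
      intro i
      rw [hτ, hr]; simp [bal_zero]
    have h3 : b + b + b = R.a (z 1 + z 2 - z 0) := by
      rw [← R.three b, hτ0, hτ0, hτ0, map_sub, map_add]
    by_cases hz : z = 0
    · refine ⟨.inr (.inl ()), build R (par (.inr (.inl ()))) b hb hn ?_ ?_⟩
      · rw [h3, hz]; rfl
      · intro i
        rw [hτ0, hz]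
        change R.a 0 = bal 0 • b + R.a 0
        rw [bal_zero, zero_smul, zero_add]
    rcases nrm_or hz with h | h
    · refine ⟨.inr (.inr ⟨z, h⟩), build R (par (.inr (.inr ⟨z, h⟩))) b hb hn h3 ?_⟩
      intro i
      rw [hτ0]
      change _ = bal 0 • b + _
      rw [bal_zero, zero_smul, zero_add]; rfl
    · refine ⟨.inr (.inr ⟨-z, h⟩), build R (par (.inr (.inr ⟨-z, h⟩))) (-b) (by rw [map_neg, hb, neg_zero])
        ?_ ?_ ?_⟩
      · intro k hk
        exact hn (-k) (by rw [map_neg, hk, neg_neg])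
      · have : (par (.inr (.inr ⟨-z, h⟩))).k = - (z 1 + z 2 - z 0) := by
          change -z 1 + -z 2 - -z 0 = _
          ring
        rw [this, map_neg, ← h3]; abel
      · intro i
        rw [map_neg, hτ0]
        change _ = bal 0 • (-b) + R.a (- z i)
        rw [bal_zero, zero_smul, zero_add, map_neg]
  · obtain ⟨i, hi⟩ := rI_surj r r0 r1 r2 hr
    obtain ⟨l, hl⟩ : ∃ l, r l ≠ 0 := by
      by_contra hc; push Not at hc; exact hr (funext hc)
    obtain ⟨k, h3⟩ := h3
    refine ⟨.inl i, build R (par (.inl i)) (R.τ l b) (R.πτ l b) ?_ ?_ ?_⟩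
    · intro k hk
      rw [hτ] at hk
      have := hA (bal (r l)) (k - z l) (by rw [map_sub, hk]; abel)
      exact hl (hbal _ _ (by rw [bal_zero, sub_zero]; exact this))
    · have : (par (.inl i)).k = 0 := by change (0 : ZMod 3) + 0 - 0 = 0; decide
      rw [this, ← map_add, ← map_add, h3, R.τa, map_zero]
    · intro j
      rw [R.comm, hτ j, map_add, map_zsmul, R.τa, ← hi]
      change _ = _ + R.a 0
      rw [map_zero]; rfl

/-- every representation is isomorphic to a model -/
theorem exists_model : ∃ (i : Idx) (T : Fin 3 → Fin 3 → (par i).Z) (γ : (par i).Z)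
    (hT : (par i).D.Good T), QRep.LIso ((par i).D.model T γ hT) R := by
  obtain ⟨i, ι, hι, hπ, hτ, ha, hs⟩ := exists_par R
  choose w hw using fun j : Fin 3 => R.πsurj (Pi.single j 1)
  choose T hT using fun l j => hs (R.τ l (w j)) (R.πτ _ _)
  obtain ⟨γ, hγ⟩ := hs R.c R.πc
  have hG : (par i).D.Good T := by
    intro l k j
    apply hι
    rw [hτ, hτ, hT, hT, R.comm]
  refine ⟨i, T, γ, hG, ZD.liso_model hG ι w 0 hι hπ hτ ?_ hT ?_⟩
  · intro k
    rw [ha]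
    simp only [hw]
    have : dt (fun j => (Pi.single j 1 : V3)) = 1 := by decide
    rw [this, one_mul]
  · rw [hγ, map_zero, add_zero]
end


/-! Counting classes of relations. -/
noncomputable def NC {X : Type} (r : X → X → Prop) : ℕ := Nat.card (Quot r)

theorem NC_congr {X : Type} {r s : X → X → Prop} (h : ∀ x y, r x y ↔ s x y) : NC r = NC s := by
  have : r = s := by funext x y; exact propext (h x y)
  rw [this]

theorem quot_eq_iff {X : Type} {r : X → X → Prop} (hr : Equivalence r) {x y : X} :
    Quot.mk r x = Quot.mk r y ↔ r x y :=
  ⟨fun h => hr.eqvGen_iff.1 (Quot.eqvGen_exact h), Quot.sound⟩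

theorem NC_pull {X Y : Type} {r : X → X → Prop} (hr : Equivalence r) {r' : Y → Y → Prop} (F : Y → X)
    (h : ∀ y y', r' y y' ↔ r (F y) (F y')) (hc : ∀ x, ∃ y, r x (F y)) : NC r = NC r' := by
  refine (Nat.card_congr (Equiv.ofBijective
    (Quot.map F (fun a b => (h a b).1) : Quot r' → Quot r) ⟨?_, ?_⟩)).symm
  · rintro ⟨x⟩ ⟨y⟩ hxy
    exact Quot.sound ((h x y).2 ((quot_eq_iff hr).1 hxy))
  · rintro ⟨x⟩
    obtain ⟨y, hy⟩ := hc x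
    exact ⟨Quot.mk _ y, (Quot.sound hy).symm⟩

theorem NC_sum {X Y : Type} [Finite X] [Finite Y] (r : X → X → Prop) (s : Y → Y → Prop) :
    NC (Sum.LiftRel r s) = NC r + NC s := by
  have e : Quot (Sum.LiftRel r s) ≃ Quot r ⊕ Quot s := {
    toFun := Quot.lift (Sum.map (Quot.mk r) (Quot.mk s)) (by
      rintro _ _ (h | h)
      · exact congrArg Sum.inl (Quot.sound h)
      · exact congrArg Sum.inr (Quot.sound h))
    invFun := Sum.elim (Quot.map Sum.inl fun _ _ h => .inl h) (Quot.map Sum.inr fun _ _ h => .inr h)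
    left_inv := by rintro ⟨x | x⟩ <;> rfl
    right_inv := by rintro (⟨⟨x⟩⟩ | ⟨⟨x⟩⟩) <;> rfl }
  unfold NC
  rw [Nat.card_congr e, Nat.card_sum]

theorem NC_sigma {I : Type} [Fintype I] {Y : I → Type} [∀ i, Finite (Y i)]
    {s : (Σ i, Y i) → (Σ i, Y i) → Prop} (hs : Equivalence s) (hne : ∀ x y, s x y → x.1 = y.1) :
    NC s = ∑ i, NC fun y y' : Y i => s ⟨i, y⟩ ⟨i, y'⟩ := by
  have e : (Σ i, Quot fun y y' : Y i => s ⟨i, y⟩ ⟨i, y'⟩) ≃ Quot s := by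
    refine Equiv.ofBijective (fun q => Quot.map (Sigma.mk q.1) (fun _ _ h => h) q.2) ⟨?_, ?_⟩
    · rintro ⟨i, ⟨x⟩⟩ ⟨j, ⟨y⟩⟩ h
      have h := (quot_eq_iff hs).1 h
      have hij : i = j := hne _ _ h
      subst hij
      congr 1
      exact Quot.sound h
    · rintro ⟨⟨i, x⟩⟩
      exact ⟨⟨i, Quot.mk _ x⟩, rfl⟩
  unfold NC
  rw [← Nat.card_congr e, Nat.card_sigma]

theorem NC_act {G X : Type} [Group G] [Fintype G] [MulAction G X] [Finite X]
    {r : X → X → Prop} (h : ∀ x y, r x y ↔ ∃ g : G, y = g • x) :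
    ∑ g : G, Nat.card (MulAction.fixedBy X g) = NC r * Fintype.card G := by
  classical
  have := Fintype.ofFinite X
  have : Fintype (MulAction.orbitRel.Quotient G X) := Fintype.ofFinite _
  have b := MulAction.sum_card_fixedBy_eq_card_orbits_mul_card_group G X
  simp only [Nat.card_eq_fintype_card]
  rw [b]
  congr 1
  unfold NC
  rw [← Nat.card_eq_fintype_card]
  refine Nat.card_congr (Quot.congrRight ?_)
  intro x y
  rw [h]
  change x ∈ MulAction.orbit G y ↔ _
  constructor
  · rintro ⟨g, hg⟩
    exact ⟨g⁻¹, by rw [← hg]; simp⟩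
  · rintro ⟨g, rfl⟩
    exact ⟨g⁻¹, by simp⟩


/-! Kernel sizes of 3 by 3 matrices over `ZMod 3`, and their distribution over `SL₃`. -/

abbrev M33 := Matrix (Fin 3) (Fin 3) (ZMod 3)
noncomputable def kerc (N : M33) : ℕ := Nat.card {v : V3 // N.mulVec v = 0}

theorem pl9 : ∀ a b c : ZMod 3, ¬ (a = 0 ∧ b = 0 ∧ c = 0) →
    (Finset.univ.filter fun v : V3 => a * v 0 + b * v 1 + c * v 2 = 0).card = 9 := by decide +kernel
theorem ln3 : ∀ a b c : ZMod 3, ¬ (a = 0 ∧ b = 0 ∧ c = 0) →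
    (Finset.univ.filter fun v : V3 => v 1 * c - v 2 * b = 0 ∧ v 2 * a - v 0 * c = 0 ∧
      v 0 * b - v 1 * a = 0).card = 3 := by decide +kernel
theorem par3 : ∀ a b c x y z : ZMod 3, ¬ (a = 0 ∧ b = 0 ∧ c = 0) →
    y * c - z * b = 0 → z * a - x * c = 0 → x * b - y * a = 0 →
    ∃ k, x = k * a ∧ y = k * b ∧ z = k * c := by decide +kernel

def MM (a b c d e f g h i : ZMod 3) : M33 := !![a, b, c; d, e, f; g, h, i]

theorem MM_ker (a b c d e f g h i : ZMod 3) (v : V3) : (MM a b c d e f g h i).mulVec v = 0 ↔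
    a * v 0 + b * v 1 + c * v 2 = 0 ∧ d * v 0 + e * v 1 + f * v 2 = 0 ∧
    g * v 0 + h * v 1 + i * v 2 = 0 := by
  rw [funext_iff, Fin.forall_fin_succ, Fin.forall_fin_succ, Fin.forall_fin_succ]
  simp [MM, Matrix.mulVec, dotProduct, Fin.sum_univ_succ, add_assoc]

theorem kerc_of {N : M33} {p : V3 → Prop} [DecidablePred p] (h : ∀ v, N.mulVec v = 0 ↔ p v) :
    kerc N = (Finset.univ.filter p).card := by
  unfold kerc
  simp only [h]
  rw [Nat.card_eq_fintype_card, Fintype.card_subtype]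

section
variable (a b c d e f g h i : ZMod 3)
theorem kerc27 : kerc (MM 0 0 0 0 0 0 0 0 0) = 27 := by
  rw [kerc_of (p := fun _ => True) (by intro v; rw [MM_ker]; simp)]
  simp

variable {a b c d e f g h i}
/-- one row spans -/
theorem kerc9_aux (u v w : ZMod 3) (k l m : ZMod 3) (hn : ¬ (u = 0 ∧ v = 0 ∧ w = 0))
    (hk : k = 1 ∨ l = 1 ∨ m = 1) :
    kerc (MM (k * u) (k * v) (k * w) (l * u) (l * v) (l * w) (m * u) (m * v) (m * w)) = 9 := by
  rw [← pl9 u v w hn]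
  apply kerc_of
  intro x
  rw [MM_ker]
  constructor
  · rintro ⟨h1, h2, h3⟩
    rcases hk with rfl | rfl | rfl
    · linear_combination h1
    · linear_combination h2
    · linear_combination h3
  · intro h
    exact ⟨by linear_combination k * h, by linear_combination l * h, by linear_combination m * h⟩

theorem kerc9 (hn : ¬ (a = 0 ∧ b = 0 ∧ c = 0 ∧ d = 0 ∧ e = 0 ∧ f = 0 ∧ g = 0 ∧ h = 0 ∧ i = 0))
    (h1 : e * i - f * h = 0) (h2 : d * i - f * g = 0) (h3 : d * h - e * g = 0)
    (h4 : b * i - c * h = 0) (h5 : a * i - c * g = 0) (h6 : a * h - b * g = 0)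
    (h7 : b * f - c * e = 0) (h8 : a * f - c * d = 0) (h9 : a * e - b * d = 0) :
    kerc (MM a b c d e f g h i) = 9 := by
  by_cases ha : a = 0 ∧ b = 0 ∧ c = 0
  · by_cases hd : d = 0 ∧ e = 0 ∧ f = 0
    · have hg : ¬ (g = 0 ∧ h = 0 ∧ i = 0) := by tauto
      obtain ⟨rfl, rfl, rfl⟩ := ha
      obtain ⟨rfl, rfl, rfl⟩ := hd
      simpa using kerc9_aux g h i 0 0 1 hg (by tauto)
    · obtain ⟨k, rfl, rfl, rfl⟩ := par3 d e f g h i hd (by linear_combination (-1) * h1)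
        (by linear_combination h2) (by linear_combination (-1) * h3)
      obtain ⟨rfl, rfl, rfl⟩ := ha
      simpa using kerc9_aux d e f 0 1 k hd (by tauto)
  · obtain ⟨k, rfl, rfl, rfl⟩ := par3 a b c g h i ha (by linear_combination (-1) * h4)
        (by linear_combination h5) (by linear_combination (-1) * h6)
    obtain ⟨l, rfl, rfl, rfl⟩ := par3 a b c d e f ha (by linear_combination (-1) * h7)
        (by linear_combination h8) (by linear_combination (-1) * h9)
    simpa using kerc9_aux a b c 1 l k ha (by tauto)

theorem kerc3 (hd : a * (e * i - f * h) - b * (d * i - f * g) + c * (d * h - e * g) = 0)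
    (hn : ¬ (e * i - f * h = 0 ∧ d * i - f * g = 0 ∧ d * h - e * g = 0 ∧
    b * i - c * h = 0 ∧ a * i - c * g = 0 ∧ a * h - b * g = 0 ∧
    b * f - c * e = 0 ∧ a * f - c * d = 0 ∧ a * e - b * d = 0)) :
    kerc (MM a b c d e f g h i) = 3 := by
  by_cases h1 : e * i - f * h = 0 ∧ f * g - d * i = 0 ∧ d * h - e * g = 0
  · by_cases h2 : b * i - c * h = 0 ∧ c * g - a * i = 0 ∧ a * h - b * g = 0
    · have h3 : ¬ (b * f - c * e = 0 ∧ c * d - a * f = 0 ∧ a * e - b * d = 0) := by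
        rintro ⟨p, q, r⟩
        apply hn
        refine ⟨h1.1, ?_, h1.2.2, h2.1, ?_, h2.2.2, p, ?_, r⟩
        · linear_combination -h1.2.1
        · linear_combination -h2.2.1
        · linear_combination -q
      rw [← ln3 _ _ _ h3]
      apply kerc_of
      intro v
      rw [MM_ker]
      constructor
      · rintro ⟨p, q, r⟩
        refine ⟨?_, ?_, ?_⟩
        · linear_combination a * q - d * p
        · linear_combination b * q - e * p
        · linear_combination c * q - f * p
      · rintro ⟨p, q, r⟩
        obtain ⟨k, hk0, hk1, hk2⟩ := par3 _ _ _ (v 0) (v 1) (v 2) h3 p q r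
        rw [hk0, hk1, hk2]
        refine ⟨by ring, by ring, by linear_combination k * hd⟩
    · rw [← ln3 _ _ _ h2]
      apply kerc_of
      intro v
      rw [MM_ker]
      constructor
      · rintro ⟨p, q, r⟩
        refine ⟨?_, ?_, ?_⟩
        · linear_combination a * r - g * p
        · linear_combination b * r - h * p
        · linear_combination c * r - i * p
      · rintro ⟨p, q, r⟩
        obtain ⟨k, hk0, hk1, hk2⟩ := par3 _ _ _ (v 0) (v 1) (v 2) h2 p q r
        rw [hk0, hk1, hk2]
        refine ⟨by ring, by linear_combination (-k) * hd, by ring⟩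
  · rw [← ln3 _ _ _ h1]
    apply kerc_of
    intro v
    rw [MM_ker]
    constructor
    · rintro ⟨p, q, r⟩
      refine ⟨?_, ?_, ?_⟩
      · linear_combination d * r - g * q
      · linear_combination e * r - h * q
      · linear_combination f * r - i * q
    · rintro ⟨p, q, r⟩
      obtain ⟨k, hk0, hk1, hk2⟩ := par3 _ _ _ (v 0) (v 1) (v 2) h1 p q r
      rw [hk0, hk1, hk2]
      refine ⟨by linear_combination k * hd, by ring, by ring⟩

theorem kerc1 (hd : a * (e * i - f * h) - b * (d * i - f * g) + c * (d * h - e * g) ≠ 0) :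
    kerc (MM a b c d e f g h i) = 1 := by
  have key : ∀ v : V3, (MM a b c d e f g h i).mulVec v = 0 ↔ v = 0 := by
    intro v
    rw [MM_ker]
    constructor
    · rintro ⟨p, q, r⟩
      funext j
      have h0 : ∀ j, v j = 0 → v j = (0 : V3) j := fun j h => h
      apply h0
      apply (mul_eq_zero.1 (_ : (a * (e * i - f * h) - b * (d * i - f * g) + c * (d * h - e * g)) *
        v j = 0)).resolve_left hd
      fin_cases j
      · change _ * v 0 = 0
        linear_combination (e * i - f * h) * p + (h * c - i * b) * q + (b * f - c * e) * r
      · change _ * v 1 = 0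
        linear_combination (f * g - d * i) * p + (i * a - g * c) * q + (c * d - a * f) * r
      · change _ * v 2 = 0
        linear_combination (d * h - e * g) * p + (g * b - h * a) * q + (a * e - b * d) * r
    · rintro rfl; simp
  rw [kerc_of key, Finset.filter_eq', if_pos (Finset.mem_univ _), Finset.card_singleton]
end

/-! natural number versions, fast in the kernel -/
namespace Fast
def s3 (F : ℕ → ℕ) : ℕ := Nat.add (Nat.add (F 0) (F 1)) (F 2)
def d2 (a b c d : ℕ) : ℕ := Nat.add (Nat.mul a d) (Nat.mul 2 (Nat.mul b c))
def d3 (a b c d e f g h i : ℕ) : ℕ :=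
  Nat.mod (Nat.add (Nat.mul a (d2 e f h i)) (Nat.add (Nat.mul b (d2 f d i g))
    (Nat.mul c (d2 d e g h)))) 3
def z (n : ℕ) : Bool := Nat.beq (Nat.mod n 3) 0
def adj0 (a b c d e f g h i : ℕ) : Bool :=
  and (z (d2 e f h i)) (and (z (d2 d f g i)) (and (z (d2 d e g h)) (and (z (d2 b c h i))
  (and (z (d2 a c g i)) (and (z (d2 a b g h))
  (and (z (d2 b c e f)) (and (z (d2 a c d f)) (z (d2 a b d e)))))))))
def mat0 (a b c d e f g h i : ℕ) : Bool :=
  and (z a) (and (z b) (and (z c) (and (z d) (and (z e) (and (z f) (and (z g)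
  (and (z h) (z i))))))))
def kp (a b c d e f g h i : ℕ) : ℕ :=
  cond (Nat.beq (d3 a b c d e f g h i) 0) (cond (adj0 a b c d e f g h i)
    (cond (mat0 a b c d e f g h i) 27 9) 3) 1
def dot (a b c d e f : ℕ) : ℕ :=
  Nat.mod (Nat.add (Nat.mul a d) (Nat.add (Nat.mul b e) (Nat.mul c f))) 3
def kq (a b c d e f g h i : ℕ) : ℕ :=
  kp (dot a b c a d g) (dot a b c b e h) (dot a b c c f i) (dot d e f a d g) (dot d e f b e h)
    (dot d e f c f i) (dot g h i a d g) (dot g h i b e h) (dot g h i c f i)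

def B : ℕ := 100000000000000
def w1 (x y m : ℕ) : ℕ := x ^ 6 + 2 * y ^ 3 + 3 * (x * m) ^ 3
def w2 (x y m : ℕ) : ℕ := 4 * x ^ 5 + 2 * (x * y ^ 2) + 3 * ((x + m) * (x * m) ^ 2)
def w3 (x _y m : ℕ) : ℕ := x ^ 4 + (x * m) ^ 2
def w4 (x _y _m : ℕ) : ℕ := x ^ 3
def w5 (x _y _m : ℕ) : ℕ := x ^ 2
/-- all the weights at once -/
def pk (x y m : ℕ) : ℕ :=
  1 + B * (w1 x y m + B * (w2 x y m + B * (w3 x y m + B * (w4 x y m + B * w5 x y m))))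
def leaf (a b c d e f g h i : ℕ) : ℕ :=
  cond (Nat.beq (d3 a b c d e f g h i) 1)
    (pk (kp (Nat.add a 2) b c d (Nat.add e 2) f g h (Nat.add i 2))
      (kq (Nat.add a 2) b c d (Nat.add e 2) f g h (Nat.add i 2))
      (kp (Nat.succ a) b c d (Nat.succ e) f g h (Nat.succ i))) 0
def tot : ℕ := s3 fun a => s3 fun b => s3 fun c => s3 fun d => s3 fun e => s3 fun f =>
  s3 fun g => s3 fun h => s3 fun i => leaf a b c d e f g h i
set_option maxRecDepth 100000 in
theorem tot_eq : tot = 5616 + B * (6 * 5616 * 13623 + B * ((6 * 5616 * 2562 + 3 * (2 * 5616 * 143)) +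
    B * (2 * 5616 * 143 + B * (29 * 5616 + B * (6 * 5616))))) := by decide +kernel

theorem z_iff (n : ℕ) : z n = true ↔ (n : ZMod 3) = 0 := by
  rw [ZMod.natCast_eq_zero_iff, z]
  change Nat.beq (n % 3) 0 = true ↔ _
  rw [Nat.beq_eq]
  omega
theorem three0 : (3 : ZMod 3) = 0 := by decide
theorem d2_cast (a b c d : ℕ) : ((d2 a b c d : ℕ) : ZMod 3) = a * d - b * c := by
  change ((a * d + 2 * (b * c) : ℕ) : ZMod 3) = _
  push_cast
  linear_combination (b * c : ZMod 3) * three0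
theorem modc (n : ℕ) : ((n % 3 : ℕ) : ZMod 3) = n := by simp
theorem d3_cast (a b c d e f g h i : ℕ) : ((d3 a b c d e f g h i : ℕ) : ZMod 3) =
    a * (e * i - f * h) - b * (d * i - f * g) + c * (d * h - e * g) := by
  change (((a * d2 e f h i + (b * d2 f d i g + c * d2 d e g h)) % 3 : ℕ) : ZMod 3) = _
  rw [modc]
  push_cast
  simp only [d2_cast]
  ring
theorem d3_lt (a b c d e f g h i : ℕ) : d3 a b c d e f g h i < 3 := Nat.mod_lt _ (by norm_num)
theorem d3_iff (a b c d e f g h i k : ℕ) (hk : k < 3) : Nat.beq (d3 a b c d e f g h i) k = true ↔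
    (a * (e * i - f * h) - b * (d * i - f * g) + c * (d * h - e * g) : ZMod 3) = k := by
  rw [← d3_cast, Nat.beq_eq, ZMod.natCast_eq_natCast_iff']
  have := d3_lt a b c d e f g h i
  rw [Nat.mod_eq_of_lt this, Nat.mod_eq_of_lt hk]

theorem kp_eq (a b c d e f g h i : ℕ) : kerc (MM a b c d e f g h i) = kp a b c d e f g h i := by
  unfold kp
  by_cases hd : Nat.beq (d3 a b c d e f g h i) 0 = true
  · rw [hd]
    have hd2 := (d3_iff _ _ _ _ _ _ _ _ _ _ (by norm_num)).1 hd
    rw [Nat.cast_zero] at hd2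
    have ha : adj0 a b c d e f g h i = true ↔ ((e * i - f * h : ZMod 3) = 0 ∧ (d * i - f * g : ZMod 3) = 0 ∧
        (d * h - e * g : ZMod 3) = 0 ∧ (b * i - c * h : ZMod 3) = 0 ∧ (a * i - c * g : ZMod 3) = 0 ∧
        (a * h - b * g : ZMod 3) = 0 ∧
        (b * f - c * e : ZMod 3) = 0 ∧ (a * f - c * d : ZMod 3) = 0 ∧ (a * e - b * d : ZMod 3) = 0) := by
      simp only [adj0, Bool.and_eq_true, z_iff, d2_cast]
    have hm : mat0 a b c d e f g h i = true ↔ ((a : ZMod 3) = 0 ∧ (b : ZMod 3) = 0 ∧ (c : ZMod 3) = 0 ∧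
        (d : ZMod 3) = 0 ∧ (e : ZMod 3) = 0 ∧ (f : ZMod 3) = 0 ∧ (g : ZMod 3) = 0 ∧ (h : ZMod 3) = 0 ∧
        (i : ZMod 3) = 0) := by
      simp only [mat0, Bool.and_eq_true, z_iff]
    cases h1 : adj0 a b c d e f g h i
    · refine kerc3 hd2 ?_
      rw [← ha, h1]; simp
    · cases h2 : mat0 a b c d e f g h i
      · obtain ⟨e1, e2, e3, e4, e5, e6, e7, e8, e9⟩ := ha.1 h1
        exact kerc9 (by rw [← hm, h2]; simp) e1 e2 e3 e4 e5 e6 e7 e8 e9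
      · obtain ⟨e1, e2, e3, e4, e5, e6, e7, e8, e9⟩ := hm.1 h2
        rw [e1, e2, e3, e4, e5, e6, e7, e8, e9]
        exact kerc27
  · rw [Bool.not_eq_true] at hd
    rw [hd]
    refine kerc1 fun h0 => ?_
    rw [← Nat.cast_zero, ← d3_iff _ _ _ _ _ _ _ _ _ _ (by norm_num), hd] at h0
    exact absurd h0 (by decide)

theorem kp_le (a b c d e f g h i : ℕ) : kp a b c d e f g h i ≤ 27 := by
  unfold kp
  cases Nat.beq (d3 a b c d e f g h i) 0 <;> cases adj0 a b c d e f g h i <;>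
    cases mat0 a b c d e f g h i <;> decide

theorem dot_cast (a b c d e f : ℕ) : ((dot a b c d e f : ℕ) : ZMod 3) = a * d + b * e + c * f := by
  change (((a * d + (b * e + c * f)) % 3 : ℕ) : ZMod 3) = _
  rw [modc]
  push_cast
  ring

theorem kq_eq (a b c d e f g h i : ℕ) : kerc (MM a b c d e f g h i * MM a b c d e f g h i) =
    kq a b c d e f g h i := by
  rw [kq, ← kp_eq]
  congr 1
  simp only [dot_cast]
  ext r s
  fin_cases r <;> fin_cases s <;> simp [MM, Matrix.mul_apply, Fin.sum_univ_succ] <;> ring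
end Fast

abbrev SL := Matrix.SpecialLinearGroup (Fin 3) (ZMod 3)
noncomputable def κ1 (h : SL) : ℕ := kerc (h.1 - 1)
noncomputable def κ2 (h : SL) : ℕ := kerc ((h.1 - 1) * (h.1 - 1))
noncomputable def κm (h : SL) : ℕ := kerc (h.1 + 1)

def MM_equiv : (ZMod 3 × ZMod 3 × ZMod 3 × ZMod 3 × ZMod 3 × ZMod 3 × ZMod 3 × ZMod 3 × ZMod 3) ≃ M33 where
  toFun p := MM p.1 p.2.1 p.2.2.1 p.2.2.2.1 p.2.2.2.2.1 p.2.2.2.2.2.1 p.2.2.2.2.2.2.1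
    p.2.2.2.2.2.2.2.1 p.2.2.2.2.2.2.2.2
  invFun M := (M 0 0, M 0 1, M 0 2, M 1 0, M 1 1, M 1 2, M 2 0, M 2 1, M 2 2)
  left_inv p := rfl
  right_inv M := by
    ext r s
    fin_cases r <;> fin_cases s <;> rfl

open Classical in
theorem sum_SL (F : M33 → ℕ) (L : ℕ → ℕ → ℕ → ℕ → ℕ → ℕ → ℕ → ℕ → ℕ → ℕ)
    (hF : ∀ a b c d e f g h i : ℕ, (if (MM a b c d e f g h i).det = 1 then F (MM a b c d e f g h i) else 0) =
      L a b c d e f g h i) :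
    ∑ h : SL, F h.1 = Fast.s3 fun a => Fast.s3 fun b => Fast.s3 fun c => Fast.s3 fun d => Fast.s3 fun e =>
      Fast.s3 fun f => Fast.s3 fun g => Fast.s3 fun h => Fast.s3 fun i => L a b c d e f g h i := by
  have h1 : ∑ h : SL, F h.1 = ∑ M : M33, if M.det = 1 then F M else 0 := by
    rw [← Finset.sum_filter]
    refine Finset.sum_bij (fun h _ => h.1) ?_ ?_ ?_ ?_
    · intro h _; simpa using h.2
    · intro h _ h' _ e; exact Subtype.ext e
    · intro M hM; exact ⟨⟨M, by simpa using hM⟩, Finset.mem_univ _, rfl⟩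
    · intros; rfl
  have h2 : ∀ f : ZMod 3 → ℕ, ∑ x, f x = Fast.s3 fun n => f (n : ZMod 3) := by
    intro f
    exact (Fin.sum_univ_three (fun x : Fin 3 => f x)).trans rfl
  rw [h1, ← MM_equiv.sum_comp]
  simp only [Fintype.sum_prod_type, h2]
  simp only [← hF]
  rfl

theorem MM_det (a b c d e f g h i : ZMod 3) : (MM a b c d e f g h i).det =
    a * (e * i - f * h) - b * (d * i - f * g) + c * (d * h - e * g) := by
  rw [Matrix.det_fin_three]
  simp [MM]
  ring
theorem MM_sub (a b c d e f g h i : ℕ) : MM a b c d e f g h i - 1 =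
    MM ((a + 2 : ℕ)) b c d ((e + 2 : ℕ)) f g h ((i + 2 : ℕ)) := by
  have : ∀ x : ZMod 3, x - 1 = x + 2 := by decide
  ext r s
  fin_cases r <;> fin_cases s <;> simp [MM, this]
theorem MM_add (a b c d e f g h i : ℕ) : MM a b c d e f g h i + 1 =
    MM ((a + 1 : ℕ)) b c d ((e + 1 : ℕ)) f g h ((i + 1 : ℕ)) := by
  ext r s
  fin_cases r <;> fin_cases s <;> simp [MM]

open Fast in
theorem pk_sum : ∑ h : SL, pk (κ1 h) (κ2 h) (κm h) = tot := by
  classical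
  apply sum_SL (fun M => pk (kerc (M - 1)) (kerc ((M - 1) * (M - 1))) (kerc (M + 1)))
  intro a b c d e f g h i
  have hd := d3_iff a b c d e f g h i 1 (by norm_num)
  rw [← MM_det, Nat.cast_one] at hd
  rw [MM_sub, MM_add, kp_eq, kq_eq, kp_eq]
  unfold leaf
  by_cases h1 : (MM a b c d e f g h i).det = 1
  · rw [if_pos h1, hd.2 h1]
    rfl
  · rw [if_neg h1, Bool.eq_false_iff.2 (fun h => h1 (hd.1 h))]
    rfl

theorem kerc_le (N : M33) : kerc N ≤ 27 := by
  unfold kerc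
  refine (Nat.card_le_card_of_injective (fun v => v.1) Subtype.val_injective).trans ?_
  simp

theorem digit_step {B s t s' t' : ℕ} (h : s + B * t = s' + B * t') (hs : s < B) (hs' : s' < B) :
    s = s' ∧ t = t' := by
  have h1 : (s + B * t) % B = s := by rw [Nat.add_mul_mod_self_left, Nat.mod_eq_of_lt hs]
  have h2 : (s' + B * t') % B = s' := by rw [Nat.add_mul_mod_self_left, Nat.mod_eq_of_lt hs']
  have h3 : s = s' := by rw [← h1, ← h2, h]
  subst h3
  exact ⟨rfl, Nat.eq_of_mul_eq_mul_left (by omega) (Nat.add_left_cancel h)⟩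

open Fast in
theorem unpack {S : Type} [Fintype S] (x y m : S → ℕ) (hx : ∀ h, x h ≤ 27) (hy : ∀ h, y h ≤ 27)
    (hm : ∀ h, m h ≤ 27) (hc : Fintype.card S ≤ 19683)
    (key : ∑ h : S, pk (x h) (y h) (m h) = 5616 + B * (6 * 5616 * 13623 + B *
    ((6 * 5616 * 2562 + 3 * (2 * 5616 * 143)) +
    B * (2 * 5616 * 143 + B * (29 * 5616 + B * (6 * 5616)))))) :
    Fintype.card S = 5616 ∧
    ∑ h : S, w1 (x h) (y h) (m h) = 6 * 5616 * 13623 ∧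
    ∑ h : S, w2 (x h) (y h) (m h) = 6 * 5616 * 2562 + 3 * (2 * 5616 * 143) ∧
    ∑ h : S, w3 (x h) (y h) (m h) = 2 * 5616 * 143 ∧
    ∑ h : S, w4 (x h) (y h) (m h) = 29 * 5616 ∧
    ∑ h : S, w5 (x h) (y h) (m h) = 6 * 5616 := by
  have hb : ∀ w : ℕ → ℕ → ℕ → ℕ, (∀ u v n, u ≤ 27 → v ≤ 27 → n ≤ 27 → w u v n ≤ 5000000000) →
      ∑ h : S, w (x h) (y h) (m h) < 100000000000000 := by
    intro w hw
    calc ∑ h : S, w (x h) (y h) (m h) ≤ ∑ _h : S, 5000000000 :=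
        Finset.sum_le_sum fun h _ => hw _ _ _ (hx _) (hy _) (hm _)
      _ < _ := by
        rw [Finset.sum_const, Finset.card_univ, smul_eq_mul]
        omega
  have b1 := hb w1 fun u v n hu hv hn => by
    calc w1 u v n ≤ w1 27 27 27 := by unfold w1; gcongr
      _ ≤ _ := by decide
  have b2 := hb w2 fun u v n hu hv hn => by
    calc w2 u v n ≤ w2 27 27 27 := by unfold w2; gcongr
      _ ≤ _ := by decide
  have b3 := hb w3 fun u v n hu hv hn => by
    calc w3 u v n ≤ w3 27 27 27 := by unfold w3; gcongr
      _ ≤ _ := by decide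
  have b4 := hb w4 fun u v n hu hv hn => by
    calc w4 u v n ≤ w4 27 27 27 := by unfold w4; gcongr
      _ ≤ _ := by decide
  have b5 := hb w5 fun u v n hu hv hn => by
    calc w5 u v n ≤ w5 27 27 27 := by unfold w5; gcongr
      _ ≤ _ := by decide
  simp only [pk, Finset.sum_add_distrib, ← Finset.mul_sum] at key
  have e1 : ∑ _h : S, 1 = Fintype.card S := by simp
  rw [e1] at key
  have hB : Fast.B = 100000000000000 := rfl
  rw [← hB] at b1 b2 b3 b4 b5
  generalize Fast.B = B at hB key b1 b2 b3 b4 b5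
  obtain ⟨k0, key⟩ := digit_step key (by rw [hB]; omega) (by rw [hB]; norm_num)
  obtain ⟨k1, key⟩ := digit_step key b1 (by rw [hB]; norm_num)
  obtain ⟨k2, key⟩ := digit_step key b2 (by rw [hB]; norm_num)
  obtain ⟨k3, key⟩ := digit_step key b3 (by rw [hB]; norm_num)
  obtain ⟨k4, key⟩ := digit_step key b4 (by rw [hB]; norm_num)
  exact ⟨k0, k1, k2, k3, k4, key⟩

theorem SL_card_le : Fintype.card SL ≤ 19683 := by
  have h := Fintype.card_le_of_injective (fun h : SL => h.1) Subtype.val_injective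
  refine h.trans ?_
  rw [← Fintype.card_congr MM_equiv]
  simp

open Fast in
theorem SL_sums : Fintype.card SL = 5616 ∧
    ∑ h : SL, w1 (κ1 h) (κ2 h) (κm h) = 6 * 5616 * 13623 ∧
    ∑ h : SL, w2 (κ1 h) (κ2 h) (κm h) = 6 * 5616 * 2562 + 3 * (2 * 5616 * 143) ∧
    ∑ h : SL, w3 (κ1 h) (κ2 h) (κm h) = 2 * 5616 * 143 ∧
    ∑ h : SL, w4 (κ1 h) (κ2 h) (κm h) = 29 * 5616 ∧
    ∑ h : SL, w5 (κ1 h) (κ2 h) (κm h) = 6 * 5616 :=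
  unpack κ1 κ2 κm (fun _ => kerc_le _) (fun _ => kerc_le _) (fun _ => kerc_le _) SL_card_le
    (pk_sum.trans tot_eq)

open Matrix

/-! Burnside counts. -/
theorem NC_act' {G X : Type} [Group G] [Fintype G] [Finite X] {r : X → X → Prop} (act : G → X → X)
    (h1 : ∀ x, act 1 x = x) (hm : ∀ g k x, act (g * k) x = act g (act k x))
    (h : ∀ x y, r x y ↔ ∃ g, y = act g x) :
    ∑ g, Nat.card {x // act g x = x} = NC r * Fintype.card G := by
  letI : MulAction G X := { smul := act, one_smul := h1, mul_smul := hm }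
  exact NC_act h

theorem fix_pi {X : Type} (m : ℕ) (f : X → X) :
    Nat.card {x : Fin m → X // (fun i => f (x i)) = x} = Nat.card {x // f x = x} ^ m := by
  rw [Nat.card_congr ((Equiv.subtypeEquivRight fun x : Fin m → X =>
    (funext_iff : (fun i => f (x i)) = x ↔ ∀ i, f (x i) = x i)).trans
    (Equiv.subtypePiEquivPi (p := fun _ x => f x = x)))]
  simp [Nat.card_pi]

theorem fix_prod {X Y : Type} (f : X → X) (g : Y → Y) :
    Nat.card {x : X × Y // (f x.1, g x.2) = x} =
      Nat.card {x // f x = x} * Nat.card {x // g x = x} := by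
  rw [← Nat.card_prod]
  refine Nat.card_congr ((Equiv.subtypeEquivRight fun x => ?_).trans
    (Equiv.subtypeProdEquivProd (p := fun x => f x = x) (q := fun y => g y = y)))
  rw [Prod.ext_iff]

theorem fix1 (h : SL) : Nat.card {v : V3 // h.1 *ᵥ v = v} = κ1 h :=
  Nat.card_congr (Equiv.subtypeEquivRight fun v => by
    rw [sub_mulVec, one_mulVec, sub_eq_zero])

theorem SL_act_one (v : V3) : (1 : SL).1 *ᵥ v = v := by simp
theorem SL_act_mul (h k : SL) (v : V3) : (h * k).1 *ᵥ v = h.1 *ᵥ (k.1 *ᵥ v) := by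
  rw [mulVec_mulVec]; rfl

def RM (m : ℕ) (x y : Fin m → V3) : Prop := ∃ h : SL, y = fun i => h.1 *ᵥ x i

theorem RM_sum (m : ℕ) : ∑ h, κ1 h ^ m = NC (RM m) * Fintype.card SL := by
  rw [← NC_act' (r := RM m) (fun (h : SL) x i => h.1 *ᵥ x i)
    (fun x => funext fun i => SL_act_one _) (fun g k x => funext fun i => SL_act_mul _ _ _)
    (fun x y => Iff.rfl)]
  refine Finset.sum_congr rfl fun h _ => ?_
  rw [fix_pi, fix1]

theorem NC_RM3 : NC (RM 3) = 29 := by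
  obtain ⟨hc, -, -, -, h4, -⟩ := SL_sums
  have := RM_sum 3
  rw [hc] at this
  have e : ∑ h, κ1 h ^ 3 = 29 * 5616 := h4
  rw [e] at this
  exact (Nat.eq_of_mul_eq_mul_right (by norm_num) this).symm
theorem NC_RM2 : NC (RM 2) = 6 := by
  obtain ⟨hc, -, -, -, -, h4⟩ := SL_sums
  have := RM_sum 2
  rw [hc] at this
  have e : ∑ h, κ1 h ^ 2 = 6 * 5616 := h4
  rw [e] at this
  exact (Nat.eq_of_mul_eq_mul_right (by norm_num) this).symm

abbrev U3 := (ZMod 3)ˣ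

@[ext] structure STg where
  s : U3
  t : ZMod 3

namespace STg
def equiv : STg ≃ U3 × ZMod 3 := ⟨fun x => (x.s, x.t), fun x => ⟨x.1, x.2⟩, fun _ => rfl, fun _ => rfl⟩
instance : Fintype STg := Fintype.ofEquiv _ equiv.symm
instance : One STg := ⟨⟨1, 0⟩⟩
instance : Mul STg := ⟨fun x y => ⟨x.s * y.s, y.t + x.t * y.s⟩⟩
instance : Inv STg := ⟨fun x => ⟨x.s⁻¹, - (x.t * (x.s⁻¹ : U3))⟩⟩
theorem mul_s (x y : STg) : (x * y).s = x.s * y.s := rfl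
theorem mul_t (x y : STg) : (x * y).t = y.t + x.t * y.s := rfl
instance : Group STg := Group.ofLeftAxioms
  (fun x y z => by
    ext
    · simp [mul_s, mul_assoc]
    · simp [mul_s, mul_t]; ring)
  (fun x => by
    ext
    · change ((1 * x.s : U3) : ZMod 3) = x.s
      simp
    · change x.t + 0 * _ = x.t
      simp)
  (fun x => by
    ext
    · change ((x.s⁻¹ * x.s : U3) : ZMod 3) = (1 : U3)
      simp
    · change x.t + -(x.t * ((x.s⁻¹ : U3) : ZMod 3)) * x.s = 0
      have : ((x.s⁻¹ : U3) : ZMod 3) * x.s = 1 := by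
        rw [← Units.val_mul, inv_mul_cancel, Units.val_one]
      linear_combination (-x.t) * this)
theorem sum_eq (f : STg → ℕ) : ∑ σ, f σ = f ⟨1, 0⟩ + f ⟨1, 1⟩ + f ⟨1, -1⟩ +
    (f ⟨-1, 0⟩ + f ⟨-1, 1⟩ + f ⟨-1, -1⟩) := by
  rw [← equiv.symm.sum_comp, Fintype.sum_prod_type]
  have ht : ∀ k : ZMod 3 → ℕ, ∑ x, k x = k 0 + k 1 + k (-1) := fun k => Fin.sum_univ_three k
  have hu : (Finset.univ : Finset U3) = {1, -1} := by decide
  rw [hu, Finset.sum_pair (by decide), ht, ht]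
  rfl
theorem card : Fintype.card STg = 6 := by
  rw [Fintype.card_congr equiv, Fintype.card_prod]; rfl
end STg

abbrev PY := V3 × V3
abbrev GG := SL × STg

def pact (g : GG) (p : PY) : PY :=
  (g.1.1 *ᵥ (p.1 + g.2.t • p.2), (g.2.s : ZMod 3) • (g.1.1 *ᵥ p.2))

theorem pact_one (p : PY) : pact 1 p = p := by
  have : (1 : GG) = (1, ⟨1, 0⟩) := rfl
  rw [this]
  simp [pact]
theorem pact_mul (g k : GG) (p : PY) : pact (g * k) p = pact g (pact k p) := by
  simp only [pact, Prod.fst_mul, Prod.snd_mul, STg.mul_s, STg.mul_t, SL_act_mul, Prod.mk.injEq,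
    mulVec_add, mulVec_smul]
  constructor
  · module
  · push_cast; module

theorem pact_zero (g : GG) : pact g 0 = 0 := by simp [pact]

/-- Fixed points on pairs. -/
noncomputable def pf (g : GG) : ℕ := Nat.card {p : PY // pact g p = p}

theorem pf_one (h : SL) : pf (h, ⟨1, 0⟩) = κ1 h ^ 2 := by
  rw [pf, sq, ← fix1 h, ← fix_prod (fun v => h.1 *ᵥ v) (fun v => h.1 *ᵥ v)]
  exact Nat.card_congr (Equiv.subtypeEquivRight fun v => by simp [pact])

theorem pf_t (h : SL) (t : ZMod 3) (ht : t ≠ 0) : pf (h, ⟨1, t⟩) = κ2 h := by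
  have ht' := z3sq ht
  refine Nat.card_congr ⟨fun p => ⟨p.1.1, ?_⟩,
    fun a => ⟨(a.1, (-t) • ((h.1 - 1) *ᵥ a.1)), ?_⟩, ?_, ?_⟩
  · obtain ⟨⟨a, b⟩, hp⟩ := p
    simp only [pact, Prod.mk.injEq, Units.val_one, one_smul, mulVec_add, mulVec_smul] at hp
    obtain ⟨h1, h2⟩ := hp
    rw [h2] at h1
    have : (h.1 - 1) *ᵥ a = (-t) • b := by
      rw [sub_mulVec, one_mulVec]
      linear_combination (norm := module) h1
    rw [← mulVec_mulVec, this, mulVec_smul, sub_mulVec, one_mulVec, h2]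
    simp
  · obtain ⟨a, ha⟩ := a
    have h2 : h.1 *ᵥ ((h.1 - 1) *ᵥ a) = (h.1 - 1) *ᵥ a := by
      rw [← mulVec_mulVec, sub_mulVec h.1 1, one_mulVec, sub_eq_zero] at ha
      exact ha
    simp only [pact, Prod.mk.injEq, Units.val_one, one_smul, mulVec_add, mulVec_smul, h2, and_true]
    rw [smul_smul, mul_neg, ht', sub_mulVec, one_mulVec]
    module
  · rintro ⟨⟨a, b⟩, hp⟩
    simp only [pact, Prod.mk.injEq, Units.val_one, one_smul, mulVec_add, mulVec_smul] at hp
    obtain ⟨h1, h2⟩ := hp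
    rw [h2] at h1
    have : (h.1 - 1) *ᵥ a = (-t) • b := by
      rw [sub_mulVec, one_mulVec]
      linear_combination (norm := module) h1
    apply Subtype.ext
    simp only [Prod.mk.injEq, true_and]
    rw [this, smul_smul, neg_mul_neg, ht', one_smul]
  · rintro ⟨a, ha⟩
    rfl

theorem fixm (h : SL) : Nat.card {v : V3 // (-1 : ZMod 3) • (h.1 *ᵥ v) = v} = κm h :=
  Nat.card_congr (Equiv.subtypeEquivRight fun v => by
    rw [add_mulVec, one_mulVec, neg_one_smul, neg_eq_iff_add_eq_zero])

theorem vthree (v : V3) : v + v + v = 0 := by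
  funext i
  simp only [Pi.add_apply, Pi.zero_apply]
  generalize v i = x
  revert x; decide

theorem pf_neg (h : SL) (t : ZMod 3) : pf (h, ⟨-1, t⟩) = κ1 h * κm h := by
  rw [← fix1, ← fixm, ← fix_prod (fun v => h.1 *ᵥ v) (fun v => (-1 : ZMod 3) • (h.1 *ᵥ v))]
  let e : PY ≃ PY := ⟨fun p => (p.1 - t • p.2, p.2), fun p => (p.1 + t • p.2, p.2),
    fun p => by simp, fun p => by simp⟩
  refine Nat.card_congr (Equiv.subtypeEquiv e ?_)
  rintro ⟨a, b⟩
  have h3 := vthree (t • b)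
  simp only [pact, Prod.mk.injEq, mulVec_add, mulVec_sub, mulVec_smul, e, Equiv.coe_fn_mk,
    Units.val_neg, Units.val_one]
  refine and_congr_left fun hb => ?_
  have hb' : h.1 *ᵥ b = -b := by rw [neg_one_smul] at hb; rw [← hb, neg_neg, hb]
  rw [hb']
  constructor <;> intro hh
  · linear_combination (norm := module) hh + h3
  · linear_combination (norm := module) hh + (-1 : ℤ) • h3

def Dep (p : PY) : Prop := p.2 = 0 ∨ ∃ x : ZMod 3, p.1 = x • p.2

theorem dep_pact (g : GG) {p : PY} (hp : Dep p) : Dep (pact g p) := by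
  obtain ⟨a, b⟩ := p
  obtain ⟨h, s, t⟩ := g
  rcases hp with hb | ⟨x, hx⟩
  · left
    simp only at hb
    simp [pact, hb]
  · right
    simp only at hx
    have hs : (s : ZMod 3) * s = 1 := z3sq s.ne_zero
    refine ⟨s * (x + t), ?_⟩
    simp only [pact, hx, mulVec_add, mulVec_smul, smul_smul]
    rw [show (s : ZMod 3) * (x + t) * s = x + t by linear_combination (x + t) * hs]
    module

abbrev DP := {p : PY // Dep p}
def dact (g : GG) (p : DP) : DP := ⟨pact g p.1, dep_pact g p.2⟩
noncomputable def df (g : GG) : ℕ := Nat.card {p : DP // dact g p = p}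

theorem df_eq (h : SL) (s : U3) (t : ZMod 3) : df (h, ⟨s, t⟩) + Nat.card {x : ZMod 3 // (x + t) * s = x} =
    κ1 h + Nat.card {x : ZMod 3 // (x + t) * s = x} * Nat.card {v : V3 // (s : ZMod 3) • (h.1 *ᵥ v) = v} := by
  have hs : (s : ZMod 3) * s = 1 := z3sq s.ne_zero
  have key : df (h, ⟨s, t⟩) = Nat.card ({v : V3 // h.1 *ᵥ v = v} ⊕
    {x : ZMod 3 // (x + t) * s = x} × {v : {v : V3 // (s : ZMod 3) • (h.1 *ᵥ v) = v} // v ≠ ⟨0, by simp⟩}) := by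
    symm
    refine Nat.card_congr (Equiv.ofBijective
      (Sum.elim (fun v => ⟨⟨(v.1, 0), Or.inl rfl⟩, ?_⟩)
        (fun u => ⟨⟨(u.1.1 • u.2.1.1, u.2.1.1), Or.inr ⟨u.1.1, rfl⟩⟩, ?_⟩)) ⟨?_, ?_⟩)
    · apply Subtype.ext
      simp [dact, pact, v.2]
    · obtain ⟨⟨x, hx⟩, ⟨⟨v, hv⟩, hv'⟩⟩ := u
      have hv2 : h.1 *ᵥ v = (s : ZMod 3) • v := by
        conv_rhs => rw [← hv, smul_smul, hs, one_smul]
      apply Subtype.ext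
      simp only [dact, pact, mulVec_add, mulVec_smul, hv2, smul_smul, hs, one_smul, ← add_smul,
        Prod.mk.injEq, and_true]
      rw [hx]
    · rintro (a | ⟨x, ⟨⟨v, hv⟩, hv'⟩⟩) (b | ⟨y, ⟨⟨w, hw⟩, hw'⟩⟩) e <;>
        have e1 := congrArg (fun p => p.1.1.1) e <;> have e2 := congrArg (fun p => p.1.1.2) e
      · exact congrArg Sum.inl (Subtype.ext e1)
      · exact absurd (Subtype.ext e2.symm) hw'
      · exact absurd (Subtype.ext e2) hv'
      · have e3 : v = w := e2
        subst e3
        have hv0 : v ≠ 0 := fun h => hv' (Subtype.ext h)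
        have : x.1 = y.1 := smul_left_injective _ hv0 e1
        rw [Subtype.ext this]
    · rintro ⟨⟨⟨a, b⟩, hd⟩, hp⟩
      have hp' := congrArg Subtype.val hp
      simp only [dact, pact, Prod.mk.injEq] at hp'
      by_cases hb : b = 0
      · subst hb
        exact ⟨Sum.inl ⟨a, by simpa using hp'.1⟩, rfl⟩
      · rcases hd with hd | ⟨x, hx⟩
        · exact absurd hd hb
        simp only at hx
        subst hx
        refine ⟨Sum.inr (⟨x, ?_⟩, ⟨⟨b, hp'.2⟩, fun h => hb (congrArg Subtype.val h)⟩), rfl⟩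
        have hv2 : h.1 *ᵥ b = (s : ZMod 3) • b := by
          conv_rhs => rw [← hp'.2, smul_smul, hs, one_smul]
        have := hp'.1
        rw [← add_smul, mulVec_smul, hv2, smul_smul] at this
        exact smul_left_injective _ hb this
  rw [key, Nat.card_sum, Nat.card_prod, fix1]
  have : Nat.card {v : {v : V3 // (s : ZMod 3) • (h.1 *ᵥ v) = v} // v ≠ ⟨0, by simp⟩} + 1 =
      Nat.card {v : V3 // (s : ZMod 3) • (h.1 *ᵥ v) = v} := by
    classical
    rw [Nat.card_eq_fintype_card, Nat.card_eq_fintype_card]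
    have := Fintype.card_subtype_compl (fun v : {v : V3 // (s : ZMod 3) • (h.1 *ᵥ v) = v} => v = ⟨0, by simp⟩)
    rw [Fintype.card_subtype_eq] at this
    simp only [ne_eq]
    have h0 : 0 < Fintype.card {v : V3 // (s : ZMod 3) • (h.1 *ᵥ v) = v} :=
      Fintype.card_pos_iff.2 ⟨⟨0, by simp⟩⟩
    omega
  rw [← this]
  ring

theorem xcard (s : U3) (t : ZMod 3) : Nat.card {x : ZMod 3 // (x + t) * s = x} =
    if s = 1 then (if t = 0 then 3 else 0) else 1 := by
  rw [Nat.card_eq_fintype_card]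
  revert s t; decide

theorem df_one (h : SL) : df (h, ⟨1, 0⟩) + 3 = 4 * κ1 h := by
  have := df_eq h 1 0
  rw [xcard] at this
  simp only [if_true, Units.val_one, one_smul, fix1] at this
  omega
theorem df_t (h : SL) (t : ZMod 3) (ht : t ≠ 0) : df (h, ⟨1, t⟩) = κ1 h := by
  have := df_eq h 1 t
  rw [xcard] at this
  simp only [if_true, if_neg ht] at this
  omega
theorem df_neg (h : SL) (t : ZMod 3) : df (h, ⟨-1, t⟩) + 1 = κ1 h + κm h := by
  have := df_eq h (-1) t
  rw [xcard, if_neg (by decide), Units.val_neg, Units.val_one, fixm] at this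
  omega

def N0r (x y : Fin 3 → PY) : Prop := ∃ g : GG, y = fun i => pact g (x i)
def N1r (x y : DP × (Fin 2 → PY)) : Prop := ∃ g : GG, y = (dact g x.1, fun i => pact g (x.2 i))
def N2r (x y : Fin 2 → PY) : Prop := ∃ g : SL × U3, y = fun i => pact (g.1, ⟨g.2, 0⟩) (x i)

theorem GG_card : Fintype.card GG = 5616 * 6 := by
  rw [Fintype.card_prod, STg.card, SL_sums.1]

theorem GG_sum (f : GG → ℕ) : ∑ g, f g = ∑ h, ∑ σ, f (h, σ) := Fintype.sum_prod_type _

theorem NC_N0 : NC N0r = 13623 := by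
  have := NC_act' (r := N0r) (fun (g : GG) x i => pact g (x i))
    (fun x => funext fun i => pact_one _) (fun g k x => funext fun i => pact_mul _ _ _)
    (fun x y => Iff.rfl)
  rw [GG_card, GG_sum] at this
  simp only [fix_pi] at this
  have e : ∀ h : SL, ∑ σ, pf (h, σ) ^ 3 = Fast.w1 (κ1 h) (κ2 h) (κm h) := by
    intro h
    rw [STg.sum_eq, pf_one, pf_t h 1 (by decide), pf_t h (-1) (by decide), pf_neg, pf_neg, pf_neg]
    unfold Fast.w1
    ring
  simp only [pf] at e
  simp only [e] at this
  rw [SL_sums.2.1] at this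
  omega

theorem N1_arith (n a b c d : ℕ) (h1 : a = n * (5616 * 6)) (h2 : b = d)
    (h3 : c = 6 * 5616 * 2562 + 3 * d) (h4 : a + 3 * b = c) : n = 2562 := by
  omega

theorem sum3 {S : Type} [Fintype S] (a b c : S → ℕ) (h : ∀ x, a x + 3 * b x = c x) :
    ∑ x, a x + 3 * ∑ x, b x = ∑ x, c x := by
  rw [Finset.mul_sum, ← Finset.sum_add_distrib]
  exact Finset.sum_congr rfl fun x _ => h x

theorem N1_alg (x y m a b c d : ℕ) (d0 : a + 3 = 4 * x) (d1 : b + 1 = x + m)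
    (d2 : c + 1 = x + m) (d3 : d + 1 = x + m) :
    a * (x ^ 2) ^ 2 + x * y ^ 2 + x * y ^ 2 + (b * (x * m) ^ 2 + c * (x * m) ^ 2 + d * (x * m) ^ 2) +
      3 * Fast.w3 x y m = Fast.w2 x y m := by
  unfold Fast.w2 Fast.w3
  zify at *
  linear_combination (x : ℤ) ^ 4 * d0 + ((x : ℤ) * m) ^ 2 * (d1 + d2 + d3)

theorem N1_e (h : SL) : ∑ σ, df (h, σ) * pf (h, σ) ^ 2 + 3 * Fast.w3 (κ1 h) (κ2 h) (κm h) =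
    Fast.w2 (κ1 h) (κ2 h) (κm h) := by
  rw [STg.sum_eq, pf_one, pf_t h 1 (by decide), pf_t h (-1) (by decide), pf_neg, pf_neg, pf_neg,
    df_t h 1 (by decide), df_t h (-1) (by decide)]
  exact N1_alg _ _ _ _ _ _ _ (df_one h) (df_neg h 0) (df_neg h 1) (df_neg h (-1))

theorem N1_this : ∑ h, ∑ σ, df (h, σ) * pf (h, σ) ^ 2 = NC N1r * (5616 * 6) := by
  have := NC_act' (r := N1r) (fun (g : GG) x => (dact g x.1, fun i => pact g (x.2 i)))
    (fun x => Prod.ext (Subtype.ext (pact_one _)) (funext fun i => pact_one _))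
    (fun g k x => Prod.ext (Subtype.ext (pact_mul _ _ _)) (funext fun i => pact_mul _ _ _))
    (fun x y => Iff.rfl)
  rw [GG_card, GG_sum] at this
  have e0 : ∀ g : GG, Nat.card {x : DP × (Fin 2 → PY) // (dact g x.1, fun i => pact g (x.2 i)) = x} =
      df g * pf g ^ 2 := fun g => by
    rw [fix_prod (dact g) (fun x i => pact g (x i)), fix_pi]; rfl
  simp only [e0] at this
  exact this

theorem N1_final {S : Type} [Fintype S] (a b c : S → ℕ) (n d : ℕ) (h : ∀ x, a x + 3 * b x = c x)
    (h1 : Finset.univ.sum a = n * (5616 * 6)) (h2 : Finset.univ.sum b = d)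
    (h3 : Finset.univ.sum c = 6 * 5616 * 2562 + 3 * d) : n = 2562 :=
  N1_arith n _ _ _ d h1 h2 h3 (sum3 a b c h)

theorem NC_N1 : NC N1r = 2562 :=
  N1_final (fun h => ∑ σ, df (h, σ) * pf (h, σ) ^ 2) (fun h => Fast.w3 (κ1 h) (κ2 h) (κm h))
    (fun h => Fast.w2 (κ1 h) (κ2 h) (κm h)) _ (2 * 5616 * 143) N1_e N1_this SL_sums.2.2.2.1 SL_sums.2.2.1

theorem NC_N2 : NC N2r = 143 := by
  have := NC_act' (r := N2r) (fun (g : SL × U3) x i => pact (g.1, ⟨g.2, 0⟩) (x i))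
    (fun x => funext fun i => pact_one _)
    (fun g k x => funext fun i => by
      rw [← pact_mul]
      congr 2
      ext
      · rfl
      · simp [STg.mul_t])
    (fun x y => Iff.rfl)
  rw [Fintype.card_prod, SL_sums.1, Fintype.sum_prod_type] at this
  simp only [fix_pi] at this
  have e : ∀ h : SL, ∑ s : U3, pf (h, ⟨s, 0⟩) ^ 2 = Fast.w3 (κ1 h) (κ2 h) (κm h) := by
    intro h
    have hu : (Finset.univ : Finset U3) = {1, -1} := by decide
    rw [hu, Finset.sum_pair (by decide), pf_one, pf_neg]
    unfold Fast.w3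
    ring
  simp only [pf] at e
  simp only [e] at this
  have hU : Fintype.card U3 = 2 := by decide
  rw [SL_sums.2.2.2.1, hU] at this
  omega

open Matrix

abbrev W1 := (Fin 3 → V3) × ZMod 3
abbrev W1b := (Fin 3 → V3) × ZMod 3 × ZMod 3
abbrev W2 := (Fin 3 → PY) × ZMod 3 × ZMod 3

def R1 (w w' : W1) : Prop := ∃ (h : SL) (ε : ZMod 3) (n : V3), ε ≠ 0 ∧
  (∀ i, w'.1 i = h.1 *ᵥ w.1 i) ∧ w'.2 = ε * w.2 + n ⬝ᵥ w'.1 0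
def R1b (w w' : W1b) : Prop := ∃ (h : SL) (ε t : ZMod 3) (n : V3), ε ≠ 0 ∧
  (∀ i, w'.1 i = h.1 *ᵥ w.1 i) ∧ w'.2.2 = ε * w.2.2 ∧
  w'.2.1 = ε * w.2.1 + t * w.2.2 + n ⬝ᵥ w'.1 0
def R2 (w w' : W2) : Prop := ∃ (g : GG) (ε : ZMod 3) (n : V3), ε ≠ 0 ∧
  (∀ i, w'.1 i = pact g (w.1 i)) ∧ w'.2.1 = ε * (w.2.1 + g.2.t * w.2.2) + n ⬝ᵥ (w'.1 0).1 ∧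
  w'.2.2 = ε * g.2.s * w.2.2 + n ⬝ᵥ (w'.1 0).2

theorem dot_hit {v : V3} (hv : v ≠ 0) (x : ZMod 3) : ∃ n : V3, n ⬝ᵥ v = x := by
  obtain ⟨i, hi⟩ : ∃ i, v i ≠ 0 := by
    by_contra hc
    push Not at hc
    exact hv (funext hc)
  refine ⟨Pi.single i (x * v i), ?_⟩
  rw [single_dotProduct, mul_assoc, z3sq hi, mul_one]

theorem SL_cancel (h : SL) {v : V3} (hv : h.1 *ᵥ v = 0) : v = 0 := by
  rw [← SL_act_one v, ← inv_mul_cancel h, SL_act_mul, hv, mulVec_zero]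

theorem cons_eq {α : Type} {w : Fin 3 → α} {x : α} (h : w 0 = x) :
    (Fin.cons x (fun i : Fin 2 => w i.succ) : Fin 3 → α) = w := by
  rw [← h]
  exact Fin.cons_self_tail w

theorem NC_R1 (hr : Equivalence R1) : NC R1 = 35 := by
  have e : NC R1 = NC (Sum.LiftRel (RM 3) (RM 2)) := by
    refine NC_pull hr (Sum.elim (fun M => (M, 0)) (fun M => (Fin.cons 0 M, 1))) ?_ ?_
    · have x : ∀ (M : Fin 3 → V3) (N : Fin 2 → V3), ¬ R1 (M, 0) (Fin.cons 0 N, 1) := by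
        rintro M N ⟨h, ε, n, hε, h1, h2⟩
        simp at h2
      rintro (M | M) (N | N)
      · simp only [Sum.liftRel_inl_inl, Sum.elim_inl]
        constructor
        · rintro ⟨h, rfl⟩
          exact ⟨h, 1, 0, by decide, fun i => rfl, by simp⟩
        · rintro ⟨h, ε, n, hε, h1, h2⟩
          exact ⟨h, funext h1⟩
      · simp only [Sum.not_liftRel_inl_inr, Sum.elim_inl, Sum.elim_inr, false_iff]
        exact x M N
      · simp only [Sum.not_liftRel_inr_inl, Sum.elim_inl, Sum.elim_inr, false_iff]
        exact fun h => x N M (hr.symm h)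
      · simp only [Sum.liftRel_inr_inr, Sum.elim_inr]
        constructor
        · rintro ⟨h, rfl⟩
          refine ⟨h, 1, 0, by decide, fun i => ?_, by simp⟩
          refine Fin.cases ?_ (fun i => ?_) i
          · simp
          · simp
        · rintro ⟨h, ε, n, hε, h1, h2⟩
          exact ⟨h, funext fun i => h1 i.succ⟩
    · rintro ⟨M, γ⟩
      by_cases hM : M 0 = 0
      · by_cases hγ : γ = 0
        · subst hγ
          exact ⟨Sum.inl M, hr.refl _⟩
        · refine ⟨Sum.inr fun i => M i.succ, 1, γ, 0, hγ, fun i => ?_, ?_⟩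
          · simp only [Sum.elim_inr]
            rw [cons_eq hM]; simp
          · simp [z3sq hγ]
      · obtain ⟨n, hn⟩ := dot_hit hM (-γ)
        refine ⟨Sum.inl M, 1, 1, n, by decide, fun i => by simp, ?_⟩
        simp [hn]
  rw [e, NC_sum, NC_RM3, NC_RM2]

theorem NC_R1b (hr : Equivalence R1b) : NC R1b = 64 := by
  have e : NC R1b = NC (Sum.LiftRel (Sum.LiftRel (RM 3) (RM 2)) (RM 3)) := by
    refine NC_pull hr (Sum.elim (Sum.elim (fun M => (M, 0, 0)) (fun M => (Fin.cons 0 M, 1, 0)))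
      (fun M => (M, 0, 1))) ?_ ?_
    · have x : ∀ (M : Fin 3 → V3) (N : Fin 2 → V3), ¬ R1b (M, 0, 0) (Fin.cons 0 N, 1, 0) := by
        rintro M N ⟨h, ε, t, n, hε, h1, h2, h3⟩
        simp at h3
      have y : ∀ (M N : Fin 3 → V3) a b, ¬ R1b (M, a, 0) (N, b, 1) := by
        rintro M N a b ⟨h, ε, t, n, hε, h1, h2, h3⟩
        simp at h2
      rintro ((M | M) | M) ((N | N) | N)
      · simp only [Sum.liftRel_inl_inl, Sum.elim_inl]
        constructor
        · rintro ⟨h, rfl⟩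
          exact ⟨h, 1, 0, 0, by decide, fun i => rfl, by simp⟩
        · rintro ⟨h, ε, t, n, hε, h1, h2⟩
          exact ⟨h, funext h1⟩
      · simp only [Sum.liftRel_inl_inl, Sum.not_liftRel_inl_inr, Sum.elim_inl, Sum.elim_inr, false_iff]
        exact x M N
      · simp only [Sum.not_liftRel_inl_inr, Sum.elim_inl, Sum.elim_inr, false_iff]
        exact y _ _ _ _
      · simp only [Sum.liftRel_inl_inl, Sum.not_liftRel_inr_inl, Sum.elim_inl, Sum.elim_inr, false_iff]
        exact fun h => x N M (hr.symm h)
      · simp only [Sum.liftRel_inl_inl, Sum.liftRel_inr_inr, Sum.elim_inl, Sum.elim_inr]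
        constructor
        · rintro ⟨h, rfl⟩
          refine ⟨h, 1, 0, 0, by decide, fun i => ?_, by simp⟩
          refine Fin.cases ?_ (fun i => ?_) i
          · simp
          · simp
        · rintro ⟨h, ε, t, n, hε, h1, h2⟩
          exact ⟨h, funext fun i => h1 i.succ⟩
      · simp only [Sum.not_liftRel_inl_inr, Sum.elim_inl, Sum.elim_inr, false_iff]
        exact y _ _ _ _
      · simp only [Sum.not_liftRel_inr_inl, Sum.elim_inl, Sum.elim_inr, false_iff]
        exact fun h => y _ _ _ _ (hr.symm h)
      · simp only [Sum.not_liftRel_inr_inl, Sum.elim_inl, Sum.elim_inr, false_iff]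
        exact fun h => y _ _ _ _ (hr.symm h)
      · simp only [Sum.liftRel_inr_inr, Sum.elim_inr]
        constructor
        · rintro ⟨h, rfl⟩
          exact ⟨h, 1, 0, 0, by decide, fun i => rfl, by simp⟩
        · rintro ⟨h, ε, t, n, hε, h1, h2⟩
          exact ⟨h, funext h1⟩
    · rintro ⟨M, γ, δ⟩
      by_cases hδ : δ = 0
      · subst hδ
        by_cases hM : M 0 = 0
        · by_cases hγ : γ = 0
          · subst hγ
            exact ⟨Sum.inl (Sum.inl M), hr.refl _⟩
          · refine ⟨Sum.inl (Sum.inr fun i => M i.succ), 1, γ, 0, 0, hγ, fun i => ?_, ?_⟩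
            · simp only [Sum.elim_inl, Sum.elim_inr]
              rw [cons_eq hM]; simp
            · simp [z3sq hγ]
        · obtain ⟨n, hn⟩ := dot_hit hM (-γ)
          refine ⟨Sum.inl (Sum.inl M), 1, 1, 0, n, by decide, fun i => by simp, ?_⟩
          simp [hn]
      · refine ⟨Sum.inr M, 1, δ, -γ, 0, hδ, fun i => by simp, ?_⟩
        simp [z3sq hδ]
        ring
  rw [e, NC_sum, NC_sum, NC_RM3, NC_RM2]

/-- `γ` is hit by the row `p`. -/
def InJ (p : PY) (γ : ZMod 3 × ZMod 3) : Prop := ∃ n : V3, n ⬝ᵥ p.1 = γ.1 ∧ n ⬝ᵥ p.2 = γ.2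

theorem dep_of_not (p : PY) (γ) (h : ¬ InJ p γ) : Dep p := by
  obtain ⟨a, b⟩ := p
  by_contra hd
  simp only [Dep, not_or, not_exists] at hd
  obtain ⟨hb, hx⟩ := hd
  obtain ⟨i, hi⟩ : ∃ i, b i ≠ 0 := by
    by_contra hc
    push Not at hc
    exact hb (funext hc)
  have hi2 := z3sq hi
  obtain ⟨j, hj⟩ : ∃ j, a j * b i - a i * b j ≠ 0 := by
    by_contra hc
    push Not at hc
    refine hx (a i * b i) (funext fun j => ?_)
    have := hc j
    simp only [Pi.smul_apply, smul_eq_mul]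
    linear_combination b i * this - a j * hi2
  have hj2 := z3sq hj
  refine h ⟨(Pi.single j ((a j * b i - a i * b j) * (γ.1 * b i - γ.2 * a i)) : V3) +
    Pi.single i ((a j * b i - a i * b j) * (γ.2 * a j - γ.1 * b j)), ?_, ?_⟩
  · rw [add_dotProduct, single_dotProduct, single_dotProduct]
    linear_combination γ.1 * hj2
  · rw [add_dotProduct, single_dotProduct, single_dotProduct]
    linear_combination γ.2 * hj2

theorem dep_form {p : PY} (hd : Dep p) (hp : p ≠ 0) : ∃ x y : ZMod 3, (x ≠ 0 ∨ y ≠ 0) ∧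
    ∀ γ, InJ p γ ↔ x * γ.1 + y * γ.2 = 0 := by
  obtain ⟨a, b⟩ := p
  by_cases hb : b = 0
  · subst hb
    have ha : a ≠ 0 := fun h => hp (by rw [h]; rfl)
    refine ⟨0, 1, Or.inr (by decide), fun γ => ⟨?_, fun h => ?_⟩⟩
    · rintro ⟨n, h1, h2⟩
      simp at h2
      simp [← h2]
    · obtain ⟨n, hn⟩ := dot_hit ha γ.1
      refine ⟨n, hn, ?_⟩
      simp at h
      simp [h]
  · rcases hd with hd | ⟨x, hx⟩
    · exact absurd hd hb
    simp only at hx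
    subst hx
    refine ⟨1, -x, Or.inl (by decide), fun γ => ⟨?_, fun h => ?_⟩⟩
    · rintro ⟨n, h1, h2⟩
      simp only [dotProduct_smul, smul_eq_mul] at h1 h2
      rw [← h1, ← h2]; ring
    · obtain ⟨n, hn⟩ := dot_hit hb γ.2
      refine ⟨n, ?_, hn⟩
      simp only [dotProduct_smul, smul_eq_mul, hn]
      linear_combination -h

theorem exists_stg (p : DP) : ∃ γ : ZMod 3 × ZMod 3, (p.1 = 0 → γ = (1, 0)) ∧ ¬ InJ p.1 γ := by
  by_cases hp : p.1 = 0
  · refine ⟨(1, 0), fun _ => rfl, ?_⟩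
    rintro ⟨n, h1, h2⟩
    rw [hp] at h1
    simp at h1
  · obtain ⟨x, y, hxy, h⟩ := dep_form p.2 hp
    refine ⟨(x, if x = 0 then y else 0), fun h => absurd h hp, ?_⟩
    rw [h]
    simp only
    clear h
    revert x y; decide
noncomputable def stg (p : DP) : ZMod 3 × ZMod 3 := (exists_stg p).choose
theorem stg_zero {p : DP} (h : p.1 = 0) : stg p = (1, 0) := (exists_stg p).choose_spec.1 h
theorem stg_not (p : DP) : ¬ InJ p.1 (stg p) := (exists_stg p).choose_spec.2

theorem connect {p : PY} (hd : Dep p) (hp : p ≠ 0) {u v : ZMod 3 × ZMod 3} (hu : ¬ InJ p u)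
    (hv : ¬ InJ p v) : ∃ (ε : ZMod 3) (n : V3), ε ≠ 0 ∧ u.1 = ε * v.1 + n ⬝ᵥ p.1 ∧
      u.2 = ε * v.2 + n ⬝ᵥ p.2 := by
  obtain ⟨x, y, hxy, h⟩ := dep_form hd hp
  rw [h] at hu hv
  have hv2 := z3sq hv
  let ε := (x * u.1 + y * u.2) * (x * v.1 + y * v.2)
  have : InJ p (u.1 - ε * v.1, u.2 - ε * v.2) := by
    rw [h]
    simp only [ε]
    linear_combination -(x * u.1 + y * u.2) * hv2
  obtain ⟨n, h1, h2⟩ := this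
  exact ⟨ε, n, mul_ne_zero hu hv, by rw [h1]; ring, by rw [h2]; ring⟩

theorem dot_mulVec (h : SL) (n v : V3) : ∃ m : V3, ∀ v, m ⬝ᵥ (h.1 *ᵥ v) = n ⬝ᵥ v := by
  refine ⟨n ᵥ* (h⁻¹).1, fun v => ?_⟩
  rw [← dotProduct_mulVec, ← SL_act_mul, inv_mul_cancel, SL_act_one]

theorem inJ_pact (g : GG) (p : PY) (γ : ZMod 3 × ZMod 3) (ε : ZMod 3) (hε : ε ≠ 0)
    (h : InJ (pact g p) (ε * (γ.1 + g.2.t * γ.2), ε * g.2.s * γ.2)) : InJ p γ := by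
  obtain ⟨h, s, t⟩ := g
  obtain ⟨a, b⟩ := p
  obtain ⟨n, h1, h2⟩ := h
  have hs : (s : ZMod 3) * s = 1 := z3sq s.ne_zero
  have hε := z3sq hε
  simp only [pact, dotProduct_smul, smul_eq_mul, mulVec_add, mulVec_smul, dotProduct_add] at h1 h2
  refine ⟨ε • (n ᵥ* h.1), ?_, ?_⟩
  · simp only [smul_dotProduct, smul_eq_mul, ← dotProduct_mulVec]
    linear_combination ε * h1 - t * s * ε * h2 + t * (ε * (n ⬝ᵥ h.1 *ᵥ b) - ε * ε * γ.2) * hs + γ.1 * hε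
  · simp only [smul_dotProduct, smul_eq_mul, ← dotProduct_mulVec]
    linear_combination s * ε * h2 - (ε * (n ⬝ᵥ h.1 *ᵥ b) - ε * ε * γ.2) * hs + γ.2 * hε

theorem pact_eq_zero {g : GG} {p : PY} (h : pact g p = 0) : p = 0 := by
  rw [← pact_one p, ← inv_mul_cancel g, pact_mul, h, pact_zero]

theorem NC_R2 (hr : Equivalence R2) : NC R2 = 16328 := by
  have e : NC R2 = NC (Sum.LiftRel N0r (Sum.LiftRel N1r N2r)) := by
    refine NC_pull hr (Sum.elim (fun M => (M, 0, 0)) (Sum.elim (fun M => (Fin.cons M.1.1 M.2, stg M.1))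
      (fun M => (Fin.cons 0 M, 0, 1)))) ?_ ?_
    · have x : ∀ (M N : Fin 3 → PY) γ, ¬ InJ (N 0) γ → ¬ R2 (M, 0, 0) (N, γ) := by
        rintro M N γ hγ ⟨g, ε, n, hε, h1, h2, h3⟩
        refine hγ ⟨n, ?_, ?_⟩
        · simpa using h2.symm
        · simpa using h3.symm
      have x1 : ∀ M (N : DP × (Fin 2 → PY)), ¬ R2 (M, 0, 0) (Fin.cons N.1.1 N.2, stg N.1) :=
        fun M N => x _ _ _ (stg_not N.1)
      have x2 : ∀ M (N : Fin 2 → PY), ¬ R2 (M, 0, 0) (Fin.cons 0 N, 0, 1) := by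
        refine fun M N => x _ _ _ ?_
        rintro ⟨n, h1, h2⟩
        simp at h2
      have x3 : ∀ (N : DP × (Fin 2 → PY)) (M : Fin 2 → PY),
          ¬ R2 (Fin.cons N.1.1 N.2, stg N.1) (Fin.cons 0 M, 0, 1) := by
        rintro N M ⟨g, ε, n, hε, h1, h2, h3⟩
        have h0 := h1 0
        simp only [Fin.cons_zero] at h0 h3
        rw [stg_zero (pact_eq_zero h0.symm)] at h3
        simp at h3
      rintro (M | M | M) (N | N | N)
      · simp only [Sum.liftRel_inl_inl, Sum.elim_inl]
        constructor
        · rintro ⟨h, rfl⟩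
          exact ⟨h, 1, 0, by decide, fun i => rfl, by simp⟩
        · rintro ⟨h, ε, n, hε, h1, h2⟩
          exact ⟨h, funext h1⟩
      · simp only [Sum.not_liftRel_inl_inr, Sum.elim_inl, Sum.elim_inr, false_iff]
        exact x1 _ _
      · simp only [Sum.not_liftRel_inl_inr, Sum.elim_inl, Sum.elim_inr, false_iff]
        exact x2 _ _
      · simp only [Sum.not_liftRel_inr_inl, Sum.elim_inl, Sum.elim_inr, false_iff]
        exact fun h => x1 _ _ (hr.symm h)
      · simp only [Sum.liftRel_inr_inr, Sum.liftRel_inl_inl, Sum.elim_inl, Sum.elim_inr]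
        constructor
        · rintro ⟨g, rfl⟩
          obtain ⟨ε, n, hε, h1, h2⟩ : ∃ (ε : ZMod 3) (n : V3), ε ≠ 0 ∧
              (stg (dact g M.1)).1 = ε * ((stg M.1).1 + g.2.t * (stg M.1).2) + n ⬝ᵥ (pact g M.1.1).1 ∧
              (stg (dact g M.1)).2 = ε * (g.2.s * (stg M.1).2) + n ⬝ᵥ (pact g M.1.1).2 := by
            by_cases h0 : M.1.1 = 0
            · have h0' : (dact g M.1).1 = 0 := by
                change pact g M.1.1 = 0
                rw [h0, pact_zero]
              rw [stg_zero h0, stg_zero h0']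
              exact ⟨1, 0, by decide, by simp, by simp⟩
            · refine connect (u := stg (dact g M.1))
                (v := ((stg M.1).1 + g.2.t * (stg M.1).2, g.2.s * (stg M.1).2)) (dact g M.1).2
                (fun h => h0 (pact_eq_zero h)) (stg_not _) fun h => stg_not M.1
                  (inJ_pact g _ _ 1 (by decide) ?_)
              change InJ (pact g M.1.1) _ at h
              simpa using h
          refine ⟨g, ε, n, hε, fun i => ?_, h1, by rw [mul_assoc]; exact h2⟩
          refine Fin.cases ?_ (fun i => ?_) i
          · rfl
          · rfl
        · rintro ⟨g, ε, n, hε, h1, h2⟩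
          exact ⟨g, Prod.ext (Subtype.ext (h1 0)) (funext fun i => h1 i.succ)⟩
      · simp only [Sum.liftRel_inr_inr, Sum.not_liftRel_inl_inr, Sum.elim_inl, Sum.elim_inr, false_iff]
        exact x3 _ _
      · simp only [Sum.not_liftRel_inr_inl, Sum.elim_inl, Sum.elim_inr, false_iff]
        exact fun h => x2 _ _ (hr.symm h)
      · simp only [Sum.liftRel_inr_inr, Sum.not_liftRel_inr_inl, Sum.elim_inl, Sum.elim_inr, false_iff]
        exact fun h => x3 _ _ (hr.symm h)
      · simp only [Sum.liftRel_inr_inr, Sum.elim_inr]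
        constructor
        · rintro ⟨⟨h, s⟩, rfl⟩
          refine ⟨(h, ⟨s, 0⟩), s, 0, s.ne_zero, fun i => ?_, by simp, by simp [z3sq s.ne_zero]⟩
          refine Fin.cases ?_ (fun i => ?_) i
          · simp only [Fin.cons_zero, pact_zero]
          · rfl
        · rintro ⟨⟨h, s, t⟩, ε, n, hε, h1, h2, h3⟩
          have ht : t = 0 := by
            simp at h2
            rcases h2 with h | h
            · exact absurd h hε
            · exact h
          subst ht
          exact ⟨(h, s), funext fun i => h1 i.succ⟩
    · rintro ⟨M, γ⟩
      by_cases hJ : InJ (M 0) γ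
      · obtain ⟨n, h1, h2⟩ := hJ
        refine ⟨Sum.inl M, 1, 1, -n, by decide, fun i => by rw [pact_one]; rfl, ?_, ?_⟩
        · have : (1 : GG).2.t = 0 := rfl
          simp only [this]; simp [h1]
        · have : (1 : GG).2.s = 1 := rfl
          simp only [this]; simp [h2]
      · have hd := dep_of_not _ _ hJ
        by_cases h0 : M 0 = 0
        · by_cases hδ : γ.2 = 0
          · have hγ : γ.1 ≠ 0 := fun h => hJ ⟨0, by simp [h], by simp [hδ]⟩
            refine ⟨Sum.inr (Sum.inl (⟨M 0, hd⟩, fun i => M i.succ)), 1, γ.1, 0, hγ, fun i => ?_, ?_, ?_⟩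
            · simp only [Sum.elim_inr, Sum.elim_inl]
              rw [cons_eq rfl, pact_one]
            · simp only [Sum.elim_inr, Sum.elim_inl]
              rw [stg_zero (by exact h0), hδ]
              simp [z3sq hγ]
            · simp only [Sum.elim_inr, Sum.elim_inl]
              rw [stg_zero (by exact h0), hδ]
              simp
          · refine ⟨Sum.inr (Sum.inr fun i => pact (1, ⟨1, -(γ.1 * γ.2)⟩) (M i.succ)),
              (1, ⟨1, -(γ.1 * γ.2)⟩), γ.2, 0, hδ, fun i => ?_, ?_, ?_⟩
            · simp only [Sum.elim_inr]
              refine Fin.cases ?_ (fun i => ?_) i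
              · rw [h0, pact_zero]; rfl
              · rfl
            · have h2 := z3sq hδ
              simp only [Sum.elim_inr, zero_dotProduct]
              linear_combination γ.1 * γ.2 * h2
            · simp [z3sq hδ]
        · obtain ⟨ε, n, hε, h1, h2⟩ := connect hd h0 (stg_not ⟨M 0, hd⟩) hJ
          refine ⟨Sum.inr (Sum.inl (⟨M 0, hd⟩, fun i => M i.succ)), 1, ε, n, hε, fun i => ?_, ?_, ?_⟩
          · simp only [Sum.elim_inr, Sum.elim_inl]
            rw [cons_eq rfl, pact_one]
          · have : (1 : GG).2.t = 0 := rfl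
            simp only [Sum.elim_inr, Sum.elim_inl, this, zero_mul, add_zero]
            exact h1
          · have : (1 : GG).2.s = 1 := rfl
            simp only [Sum.elim_inr, Sum.elim_inl, this, Units.val_one, mul_one]
            exact h2
  rw [e, NC_sum, NC_sum, NC_N0, NC_N1, NC_N2]

open Matrix

theorem NC_coord {X W : Type} {ρ : X → X → Prop} (hρ : Equivalence ρ) {R : W → W → Prop} (C : X → W)
    (F : W → X) (hCF : ∀ w, C (F w) = w) (h : ∀ x x', ρ x x' ↔ R (C x) (C x')) :
    Equivalence R ∧ NC ρ = NC R := by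
  have hF : ∀ w w', R w w' ↔ ρ (F w) (F w') := fun w w' => by rw [h, hCF, hCF]
  refine ⟨⟨fun w => (hF _ _).2 (hρ.refl _), fun a => (hF _ _).2 (hρ.symm ((hF _ _).1 a)),
    fun a b => (hF _ _).2 (hρ.trans ((hF _ _).1 a) ((hF _ _).1 b))⟩, ?_⟩
  refine NC_pull hρ F hF fun x => ⟨C x, ?_⟩
  rw [h, hCF, ← h]
  exact hρ.refl _

theorem comb_dot (v : V3) (m : V3) : comb v m = v ⬝ᵥ m := by
  simp only [comb, zsmul_eq_mul, bal_cast, dotProduct, Fin.sum_univ_three]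

theorem dt_det (g : Fin 3 → V3) : dt g = (Matrix.of g).det := by
  rw [det_fin_three]
  simp only [dt, OCML.det3, of_apply]
  ring

theorem slL {ε : ZMod 3} (hε : ε ≠ 0) (g : Fin 3 → V3) (hg : dt g = ε) :
    ∃ h : SL, ∀ u v : V3, (∀ j, ε * u j = g j ⬝ᵥ v) ↔ v = h.1 *ᵥ u := by
  have h2 := z3sq hε
  let K : SL := ⟨ε • Matrix.of g, by
    rw [det_smul, ← dt_det, hg]
    simp only [Fintype.card_fin]
    linear_combination (ε * ε + 1) * h2⟩
  refine ⟨K⁻¹, fun u v => ?_⟩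
  have e : (∀ j, ε * u j = g j ⬝ᵥ v) ↔ u = K.1 *ᵥ v := by
    constructor
    · intro h
      funext j
      have : (K.1 *ᵥ v) j = ε * (g j ⬝ᵥ v) := by
        change ((ε • Matrix.of g) *ᵥ v) j = _
        rw [smul_mulVec]; rfl
      rw [this, ← h j]
      linear_combination - u j * h2
    · rintro h j
      have : (K.1 *ᵥ v) j = ε * (g j ⬝ᵥ v) := by
        change ((ε • Matrix.of g) *ᵥ v) j = _
        rw [smul_mulVec]; rfl
      rw [h, this]
      linear_combination (g j ⬝ᵥ v) * h2
  rw [e]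
  constructor
  · rintro rfl
    rw [← SL_act_mul, inv_mul_cancel, SL_act_one]
  · rintro rfl
    rw [← SL_act_mul, mul_inv_cancel, SL_act_one]

theorem slR {ε : ZMod 3} (hε : ε ≠ 0) (h : SL) :
    ∃ g : Fin 3 → V3, dt g = ε ∧ ∀ u v : V3, (∀ j, ε * u j = g j ⬝ᵥ v) ↔ v = h.1 *ᵥ u := by
  have h2 := z3sq hε
  let g : Fin 3 → V3 := fun j => ε • (h⁻¹).1 j
  have hg : dt g = ε := by
    rw [dt_det]
    have : Matrix.of g = ε • (h⁻¹).1 := rfl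
    rw [this, det_smul, (h⁻¹).2]
    simp only [Fintype.card_fin]
    linear_combination ε * h2
  refine ⟨g, hg, fun u v => ?_⟩
  have e : (∀ j, ε * u j = g j ⬝ᵥ v) ↔ u = (h⁻¹).1 *ᵥ v := by
    constructor
    · intro hh
      funext j
      have e1 := hh j
      simp only [g, smul_dotProduct, smul_eq_mul] at e1
      exact mul_left_cancel₀ hε e1
    · rintro rfl j
      simp only [g, smul_dotProduct, smul_eq_mul]
      rfl
  rw [e]
  constructor
  · rintro rfl
    rw [← SL_act_mul, mul_inv_cancel, SL_act_one]
  · rintro rfl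
    rw [← SL_act_mul, inv_mul_cancel, SL_act_one]

namespace Par
variable (p : Par)

abbrev XX := {w : (Fin 3 → Fin 3 → p.Z) × p.Z // p.D.Good w.1}
def mdl (w : p.XX) : QRep (CE (ZD.mcoc w.1.1)) := p.D.model w.1.1 w.1.2 w.2
def rho (w w' : p.XX) : Prop := QRep.LIso (p.mdl w) (p.mdl w')

theorem liso_refl {G : Type} [AddCommGroup G] (R : QRep G) : QRep.LIso R R :=
  QRep.LIso.of_iso ⟨Equiv.refl _, fun _ _ => rfl⟩
theorem liso_symm {G H : Type} [AddCommGroup G] [AddCommGroup H] {R : QRep G} {S : QRep H}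
    (h : QRep.LIso R S) : QRep.LIso S R := by
  obtain ⟨f, hf⟩ := h.iso
  refine QRep.LIso.of_iso ⟨f.symm, fun x y => ?_⟩
  rw [Equiv.symm_apply_eq, hf, f.apply_symm_apply, f.apply_symm_apply]
theorem liso_trans {G H K : Type} [AddCommGroup G] [AddCommGroup H] [AddCommGroup K] {R : QRep G}
    {S : QRep H} {T : QRep K} (h : QRep.LIso R S) (h' : QRep.LIso S T) : QRep.LIso R T := by
  obtain ⟨f, hf⟩ := h.iso
  obtain ⟨f', hf'⟩ := h'.iso
  refine QRep.LIso.of_iso ⟨f.trans f', fun x y => ?_⟩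
  simp only [Equiv.trans_apply, hf, hf']

theorem rho_equiv : Equivalence p.rho :=
  ⟨fun _ => liso_refl _, fun h => liso_symm h, fun h h' => liso_trans h h'⟩

variable {p}

theorem cross {p q : Par} (w : p.XX) (w' : q.XX) (h : QRep.LIso (p.mdl w) (q.mdl w')) :
    ∃ (θ : p.Z →+ q.Z) (d t ε : ZMod 3) (g : Fin 3 → V3) (y : V3) (n : V3) (y' : ZMod 3),
      d ≠ 0 ∧ ε ≠ 0 ∧ dt g = ε ∧ q.r = p.r ∧ (∀ i, ε * p.z i + t * p.r i = d * q.z i) ∧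
      (∀ x, θ x = ⟨d * x.fst, ε * x.snd + t * x.fst⟩) ∧
      (∀ i j, θ (w.1.1 i j) = comb (g j) (w'.1.1 i) + ⟨q.r i * y j, q.z i * y j⟩) ∧
      θ w.1.2 = w'.1.2 + (comb n (w'.1.1 0) + ⟨q.r 0 * y', q.z 0 * y'⟩) := by
  obtain ⟨θ, g, y, n, y', hi, hτ, ha, hT, hγ⟩ := (ZD.model_iff w.2 w'.2).1 h
  have hε : dt g ≠ 0 := by
    intro h0
    have h1 := ha 1
    rw [h0, zero_mul, map_zero] at h1
    have h2 := hi (h1.trans (map_zero θ).symm)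
    have h3 := p.D.ainj (h2.trans (map_zero _).symm)
    exact absurd h3 (by decide)
  obtain ⟨d, t, hd, hf, hr, hz⟩ := hom_form hi hτ ha
  exact ⟨θ, d, t, dt g, g, fun j => (y j).fst, n, y'.fst, hd, hε, rfl, hr, hz, hf, hT, hγ⟩

theorem rho_iff (w w' : p.XX) : p.rho w w' ↔
    ∃ (θ : p.Z →+ p.Z) (d t ε : ZMod 3) (g : Fin 3 → V3) (y : V3) (n : V3) (y' : ZMod 3),
      d ≠ 0 ∧ ε ≠ 0 ∧ dt g = ε ∧ (∀ i, ε * p.z i + t * p.r i = d * p.z i) ∧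
      (∀ x, θ x = ⟨d * x.fst, ε * x.snd + t * x.fst⟩) ∧
      (∀ i j, θ (w.1.1 i j) = comb (g j) (w'.1.1 i) + ⟨p.r i * y j, p.z i * y j⟩) ∧
      θ w.1.2 = w'.1.2 + (comb n (w'.1.1 0) + ⟨p.r 0 * y', p.z 0 * y'⟩) := by
  constructor
  · intro h
    obtain ⟨θ, d, t, ε, g, y, n, y', hd, hε, hg, hr, hz, hf, hT, hγ⟩ := cross w w' h
    exact ⟨θ, d, t, ε, g, y, n, y', hd, hε, hg, hz, hf, hT, hγ⟩
  · rintro ⟨θ, d, t, ε, g, y, n, y', hd, hε, hg, hz, hf, hT, hγ⟩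
    obtain ⟨θ', hi, hτ, ha, hf'⟩ := exists_hom p hd hε hz
    have hθ : θ = θ' := AddMonoidHom.ext fun x => by rw [hf, hf']
    subst hθ
    subst hg
    exact (ZD.model_iff w.2 w'.2).2 ⟨θ, g, fun j => ⟨y j, 0⟩, n, ⟨y', 0⟩, hi, hτ, ha, hT, hγ⟩

theorem comb_fst (v : V3) (m : Fin 3 → p.Z) : (comb v m).fst = v ⬝ᵥ fun j => (m j).fst := by
  rw [← comb_dot]
  exact comb_map CE.fstHom v m

theorem snd_add0 (hk : p.k = 0) (x y : p.Z) : (x + y).snd = x.snd + y.snd := by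
  rw [CE.snd_add]
  have e : ∀ a b c k : ZMod 3, k = 0 → a + b + c * k = a + b := fun a b c k h => by simp [h]
  exact e _ _ _ _ hk

theorem comb_snd (hk : p.k = 0) (v : V3) (m : Fin 3 → p.Z) :
    (comb v m).snd = v ⬝ᵥ fun j => (m j).snd := by
  rw [← comb_dot]
  exact comb_map (AddMonoidHom.mk' CE.snd (snd_add0 hk)) v m

theorem comb_inr (v : V3) (s : V3) : comb v (fun j => (CE.inr (s j) : p.Z)) = CE.inr (v ⬝ᵥ s) := by
  rw [← comb_dot, comb_map]

theorem add_z (x : p.Z) (y : ZMod 3) : x + ⟨0, y⟩ = ⟨x.fst, x.snd + y⟩ := by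
  apply CE.ext
  · simp
  · rw [CE.snd_add]
    change _ + _ + ((kap x.fst 0 : ℤ) : ZMod 3) * p.k = _
    rw [kap_symm, kap_zero]; simp

/-! Type I. -/
theorem count_I (hz : p.z = 0) (hr : p.r 0 ≠ 0) : NC p.rho = 35 := by
  have hk : p.k = 0 := by simp [k, hz]
  have hr2 := z3sq hr
  obtain ⟨h1, h2⟩ := NC_coord (R := R1) p.rho_equiv
    (fun w => ((fun i j => (w.1.1 i j).snd, w.1.2.snd) : W1))
    (fun m => ⟨(fun i j => ⟨0, m.1 i j⟩, ⟨0, m.2⟩), by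
      intro i k j
      apply CE.ext <;> simp⟩) (fun w => rfl) (by
    rintro ⟨⟨T, γ⟩, hT⟩ ⟨⟨T', γ'⟩, hT'⟩
    have gd : ∀ {T : Fin 3 → Fin 3 → p.Z}, p.D.Good T → ∀ i j, (T i j).fst = p.r i * p.r 0 * (T 0 j).fst := by
      intro T hT i j
      have := congrArg CE.fst (hT 0 i j)
      simp only [τ_fst] at this
      linear_combination p.r 0 * this - (T i j).fst * hr2
    rw [rho_iff]
    simp only [R1]
    constructor
    · rintro ⟨θ, d, t, ε, g, y, n, y', hd, hε, hg, hz', hf, hT, hγ⟩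
      have ht : t = 0 := by
        have := hz' 0
        rw [hz] at this
        simp only [Pi.zero_apply, mul_zero, zero_add] at this
        exact (mul_eq_zero.1 this).resolve_right hr
      subst ht
      obtain ⟨h, hh⟩ := slL hε g hg
      refine ⟨h, ε, -n, hε, fun i => (hh _ _).1 fun j => ?_, ?_⟩
      · have := congrArg CE.snd (hT i j)
        rw [hf, snd_add0 hk, comb_snd hk, hz] at this
        simpa using this
      · have := congrArg CE.snd hγ
        rw [hf, snd_add0 hk, snd_add0 hk, comb_snd hk, hz] at this
        simp only [Pi.zero_apply, zero_mul, add_zero] at this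
        rw [neg_dotProduct]
        linear_combination -this
    · rintro ⟨h, ε, n, hε, hM, hγ⟩
      obtain ⟨g, hg, hh⟩ := slR hε h
      obtain ⟨θ, -, -, -, hf⟩ := exists_hom p (d := 1) (t := 0) (by decide) hε (by simp [hz])
      refine ⟨θ, 1, 0, ε, g, fun j => p.r 0 * ((T 0 j).fst - (comb (g j) (T' 0)).fst), -n,
        p.r 0 * (γ.fst - γ'.fst - (comb (-n) (T' 0)).fst), by decide, hε, hg, by simp [hz], hf,
        fun i j => ?_, ?_⟩
      · rw [hf]
        apply CE.ext
        · simp only [CE.fst_add, comb_fst]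
          rw [gd hT i j]
          have e : (fun l => (T' i l).fst) = (p.r i * p.r 0) • (fun l => (T' 0 l).fst) :=
            funext fun l => gd hT' i l
          rw [e, dotProduct_smul, smul_eq_mul]
          ring
        · rw [snd_add0 hk, comb_snd hk, hz]
          have := (hh (fun j => (T i j).snd) _).2 (hM i) j
          simpa using this
      · rw [hf]
        apply CE.ext
        · simp only [CE.fst_add]
          linear_combination -(γ.fst - γ'.fst - (comb (-n) (T' 0)).fst) * hr2
        · rw [snd_add0 hk, snd_add0 hk, comb_snd hk, hz]
          simp only [Pi.zero_apply, zero_mul, add_zero]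
          rw [neg_dotProduct]
          linear_combination -hγ)
  rw [h2, NC_R1 h1]

/-! Type IIa. -/
theorem count_IIa (hz : p.z = 0) (hr : p.r = 0) : NC p.rho = 16328 := by
  have hk : p.k = 0 := by simp [k, hz]
  obtain ⟨h1, h2⟩ := NC_coord (R := R2) p.rho_equiv
    (fun w => ((fun i => (fun j => (w.1.1 i j).snd, fun j => (w.1.1 i j).fst),
      w.1.2.snd, w.1.2.fst) : W2))
    (fun m => ⟨(fun i j => ⟨(m.1 i).2 j, (m.1 i).1 j⟩, ⟨m.2.2, m.2.1⟩), by
      intro i k j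
      apply CE.ext <;> simp [hz, hr]⟩) (fun w => rfl) (by
    rintro ⟨⟨T, γ⟩, hT⟩ ⟨⟨T', γ'⟩, hT'⟩
    rw [rho_iff]
    simp only [R2]
    constructor
    · rintro ⟨θ, d, t, ε, g, y, n, y', hd, hε, hg, hz', hf, hT, hγ⟩
      obtain ⟨h, hh⟩ := slL hε g hg
      have hε2 := z3sq hε
      refine ⟨(h, ⟨Units.mk0 (ε * d) (mul_ne_zero hε hd), ε * t⟩), ε, -n, hε, fun i => ?_, ?_, ?_⟩
      · apply Prod.ext
        · refine (hh _ _).1 fun j => ?_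
          have := congrArg CE.snd (hT i j)
          rw [hf, snd_add0 hk, comb_snd hk, hz] at this
          simp only [Pi.zero_apply, zero_mul, add_zero] at this
          rw [← this]
          simp only [Pi.add_apply, Pi.smul_apply, smul_eq_mul]
          linear_combination (t * (T i j).fst) * hε2
        · change _ = (ε * d) • (h.1 *ᵥ _)
          rw [← mulVec_smul]
          refine (hh _ _).1 fun j => ?_
          have := congrArg CE.fst (hT i j)
          rw [hf, CE.fst_add, comb_fst, hr] at this
          simp only [Pi.zero_apply, zero_mul, add_zero] at this
          rw [← this]
          simp only [Pi.smul_apply, smul_eq_mul]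
          linear_combination (d * (T i j).fst) * hε2
      · have := congrArg CE.snd hγ
        rw [hf, snd_add0 hk, snd_add0 hk, comb_snd hk, hz] at this
        simp only [Pi.zero_apply, zero_mul, add_zero] at this
        rw [neg_dotProduct]
        linear_combination -this - t * γ.fst * hε2
      · have := congrArg CE.fst hγ
        rw [hf, CE.fst_add, CE.fst_add, comb_fst, hr] at this
        simp only [Pi.zero_apply, zero_mul, add_zero] at this
        rw [neg_dotProduct]
        simp only [Units.val_mk0]
        linear_combination -this - d * γ.fst * hε2
    · rintro ⟨⟨h, s, t⟩, ε, n, hε, hM, hγ, hδ⟩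
      obtain ⟨g, hg, hh⟩ := slR hε h
      have hε2 := z3sq hε
      have hd : ε * s ≠ 0 := mul_ne_zero hε s.ne_zero
      obtain ⟨θ, -, -, -, hf⟩ := exists_hom p (d := ε * s) (t := ε * t) hd hε (by simp [hz, hr])
      refine ⟨θ, ε * s, ε * t, ε, g, 0, -n, 0, hd, hε, hg, by simp [hz, hr], hf, fun i j => ?_, ?_⟩
      · rw [hf]
        have hMi := hM i
        simp only [pact, Prod.mk.injEq] at hMi
        obtain ⟨m1, m2⟩ := hMi
        rw [← mulVec_smul] at m2
        have m1 := (hh _ _).2 m1 j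
        have m2 := (hh _ _).2 m2 j
        simp only [Pi.add_apply, Pi.smul_apply, smul_eq_mul] at m1 m2
        apply CE.ext
        · rw [CE.fst_add, comb_fst, hr]
          simp only [Pi.zero_apply, zero_mul, add_zero]
          linear_combination m2
        · rw [snd_add0 hk, comb_snd hk, hz]
          simp only [Pi.zero_apply, zero_mul, add_zero]
          linear_combination m1
      · rw [hf]
        apply CE.ext
        · rw [CE.fst_add, CE.fst_add, comb_fst, hr]
          simp only [Pi.zero_apply, zero_mul, add_zero]
          rw [neg_dotProduct]
          linear_combination -hδ
        · rw [snd_add0 hk, snd_add0 hk, comb_snd hk, hz]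
          simp only [Pi.zero_apply, zero_mul, add_zero]
          rw [neg_dotProduct]
          linear_combination -hγ)
  rw [h2, NC_R2 h1]
end Par

open Matrix

theorem comb_lin {M : Type} [AddCommGroup M] (v : V3) (m n : Fin 3 → M) (b : ℤ) :
    comb v (fun j => m j + b • n j) = comb v m + b • comb v n := by
  simp only [comb]
  module

namespace Par
variable {p : Par}

/-! Type IIb. -/
def sig (T : Fin 3 → Fin 3 → p.Z) (q i : Fin 3) : V3 := fun j => (T i j - bal (p.z i) • T q j).snd

def crd (T : Fin 3 → Fin 3 → p.Z) (q i : Fin 3) : V3 := if i = q then fun j => (T q j).fst else sig T q i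

theorem sig_eq {T : Fin 3 → Fin 3 → p.Z} (hT : p.D.Good T) {q : Fin 3} (hq : p.z q = 1) (i j) :
    T i j = CE.inr (sig T q i j) + bal (p.z i) • T q j := by
  have h := congrArg CE.snd (hT q i j)
  simp only [τ_snd, hq, one_mul] at h
  have e : T i j - bal (p.z i) • T q j = CE.inr (sig T q i j) := by
    apply CE.eq_inr
    change CE.fstHom (T i j - bal (p.z i) • T q j) = 0
    rw [map_sub, map_zsmul, CE.fstHom_apply, CE.fstHom_apply, h, zsmul_eq_mul, bal_cast, sub_self]
  rw [← e, sub_add_cancel]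

theorem sig_q {T : Fin 3 → Fin 3 → p.Z} {q : Fin 3} (hq : p.z q = 1) : sig T q q = 0 := by
  funext j
  simp only [sig, hq, bal_one, one_zsmul, sub_self]
  rfl

theorem inr_z (i : Fin 3) (y : ZMod 3) : (⟨0, p.z i * y⟩ : p.Z) = bal (p.z i) • CE.inr y := by
  rw [← map_zsmul, zsmul_eq_mul, bal_cast]
  rfl

theorem crd_iff {T T' : Fin 3 → Fin 3 → p.Z} (hT : p.D.Good T) (hT' : p.D.Good T') {q : Fin 3}
    (hq : p.z q = 1) {θ : p.Z →+ p.Z} {ε t : ZMod 3} (hf : ∀ x, θ x = ⟨ε * x.fst, ε * x.snd + t * x.fst⟩)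
    (g : Fin 3 → V3) :
    (∃ y : V3, ∀ i j, θ (T i j) = comb (g j) (T' i) + ⟨0, p.z i * y j⟩) ↔
      ∀ i j, ε * crd T q i j = g j ⬝ᵥ crd T' q i := by
  have hc : ∀ i j, comb (g j) (T' i) = CE.inr (g j ⬝ᵥ sig T' q i) + bal (p.z i) • comb (g j) (T' q) := by
    intro i j
    have : T' i = fun j => CE.inr (sig T' q i j) + bal (p.z i) • T' q j := funext fun j => sig_eq hT' hq i j
    conv_lhs => rw [this]
    rw [comb_lin, comb_inr]
  have ht : ∀ i j, θ (T i j) = CE.inr (ε * sig T q i j) + bal (p.z i) • θ (T q j) := by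
    intro i j
    conv_lhs => rw [sig_eq hT hq i j]
    rw [map_add, map_zsmul, hf (CE.inr _)]
    congr 1
    apply CE.ext <;> simp
  constructor
  · rintro ⟨y, hy⟩ i j
    unfold crd
    split_ifs with hi
    · have := congrArg CE.fst (hy q j)
      rw [hf, CE.fst_add, comb_fst] at this
      simpa using this
    · have h1 := hy i j
      have h2 := hy q j
      rw [inr_z] at h1 h2
      rw [hq, bal_one, one_zsmul] at h2
      rw [ht, hc, h2] at h1
      have h3 : (CE.inr (ε * sig T q i j) : p.Z) = CE.inr (g j ⬝ᵥ sig T' q i) := by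
        linear_combination (norm := module) (1 : ℤ) • h1
      exact CE.inr_inj h3
  · intro h
    have hσ : ∀ i j, ε * sig T q i j = g j ⬝ᵥ sig T' q i := by
      intro i j
      by_cases hi : i = q
      · subst hi
        rw [sig_q hq, sig_q hq]; simp
      · have := h i j
        simpa only [crd, if_neg hi] using this
    have hy : ∀ j, ∃ y : ZMod 3, θ (T q j) = comb (g j) (T' q) + CE.inr y := by
      intro j
      refine ⟨(θ (T q j)).snd - (comb (g j) (T' q)).snd, ?_⟩
      change _ = comb (g j) (T' q) + ⟨0, _⟩
      rw [add_z]
      apply CE.ext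
      · have := h q j
        simp only [crd, if_true] at this
        rw [hf, comb_fst]
        exact this
      · simp
    choose y hy using hy
    refine ⟨y, fun i j => ?_⟩
    rw [ht, hc, hy, inr_z, hσ]
    module

def mkT (q : Fin 3) (M : Fin 3 → V3) (i j : Fin 3) : p.Z :=
  if i = q then ⟨M q j, 0⟩ else CE.inr (M i j) + bal (p.z i) • ⟨M q j, 0⟩

theorem mk_fst {q : Fin 3} (hq : p.z q = 1) (M : Fin 3 → V3) (i j) :
    (mkT (p := p) q M i j).fst = p.z i * M q j := by
  unfold mkT
  split_ifs with h
  · rw [h, hq, one_mul]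
  · rw [CE.fst_add]
    change 0 + CE.fstHom (bal (p.z i) • (⟨M q j, 0⟩ : p.Z)) = _
    rw [map_zsmul, CE.fstHom_apply, zsmul_eq_mul, bal_cast, zero_add]

theorem mk_good (hr : p.r = 0) {q : Fin 3} (hq : p.z q = 1) (M : Fin 3 → V3) :
    p.D.Good (mkT (p := p) q M) := by
  intro i k j
  apply CE.ext
  · simp [hr]
  · simp only [τ_snd, mk_fst hq]
    ring

theorem crd_mk {q : Fin 3} (M : Fin 3 → V3) (i) : crd (mkT (p := p) q M) q i = M i := by
  unfold crd
  split_ifs with h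
  · subst h
    funext j
    simp [mkT]
  · funext j
    simp [sig, mkT, h]

theorem good_fst {T : Fin 3 → Fin 3 → p.Z} (hT : p.D.Good T) {q : Fin 3} (hq : p.z q = 1) (i j) :
    (T i j).fst = p.z i * (T q j).fst := by
  have h := congrArg CE.snd (hT q i j)
  simpa only [τ_snd, hq, one_mul] using h

theorem rho_iff2 (hr : p.r = 0) {q : Fin 3} (hq : p.z q = 1) (w w' : p.XX) : p.rho w w' ↔
    ∃ (h : SL) (t ε : ZMod 3) (n : V3) (y' : ZMod 3), ε ≠ 0 ∧
      (∀ i, crd w'.1.1 q i = h.1 *ᵥ crd w.1.1 q i) ∧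
      (⟨ε * w.1.2.fst, ε * w.1.2.snd + t * w.1.2.fst⟩ : p.Z) =
        w'.1.2 + (comb n (w'.1.1 0) + ⟨0, p.z 0 * y'⟩) := by
  rw [rho_iff]
  simp only [hr, Pi.zero_apply, zero_mul, mul_zero, add_zero]
  constructor
  · rintro ⟨θ, d, t, ε, g, y, n, y', hd, hε, hg, hz, hf, hT, hγ⟩
    have hde : ε = d := by
      have := hz q
      rwa [hq, mul_one, mul_one] at this
    subst hde
    obtain ⟨h, hh⟩ := slL hε g hg
    refine ⟨h, t, ε, n, y', hε, fun i => (hh _ _).1 ((crd_iff w.2 w'.2 hq hf g).1 ⟨y, hT⟩ i), ?_⟩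
    rw [← hf, hγ]
  · rintro ⟨h, t, ε, n, y', hε, hM, hγ⟩
    obtain ⟨g, hg, hh⟩ := slR hε h
    obtain ⟨θ, -, -, -, hf⟩ := exists_hom p (d := ε) (t := t) hε hε (by simp [hr])
    obtain ⟨y, hy⟩ := (crd_iff w.2 w'.2 hq hf g).2 fun i => (hh _ _).2 (hM i)
    exact ⟨θ, ε, t, ε, g, y, n, y', hε, hε, hg, fun _ => rfl, hf, hy, by rw [hf, hγ]⟩

theorem count_IIb1 (hr : p.r = 0) (hz : p.z 0 = 1) : NC p.rho = 35 := by
  obtain ⟨h1, h2⟩ := NC_coord (R := R1) p.rho_equiv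
    (fun w => ((fun i => crd w.1.1 0 i, w.1.2.fst) : W1))
    (fun m => ⟨(mkT 0 m.1, ⟨m.2, 0⟩), mk_good hr hz _⟩) (fun w => by
      simp only [crd_mk]) (by
    rintro w w'
    rw [rho_iff2 hr hz]
    simp only [R1]
    have e0 : crd w'.1.1 0 0 = fun j => (w'.1.1 0 j).fst := by simp [crd]
    rw [e0]
    constructor
    · rintro ⟨h, t, ε, n, y', hε, hM, hγ⟩
      refine ⟨h, ε, -n, hε, hM, ?_⟩
      have := congrArg CE.fst hγ
      simp only [CE.fst_add, comb_fst] at this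
      rw [neg_dotProduct]
      linear_combination -this
    · rintro ⟨h, ε, n, hε, hM, hγ⟩
      refine ⟨h, 0, ε, -n, ε * w.1.2.snd - (w'.1.2 + comb (-n) (w'.1.1 0)).snd, hε, hM, ?_⟩
      rw [← add_assoc, hz, one_mul, add_z]
      apply CE.ext
      · simp only [CE.fst_add, comb_fst]
        rw [neg_dotProduct]
        linear_combination -hγ
      · simp)
  rw [h2, NC_R1 h1]

theorem count_IIb2 (hr : p.r = 0) (hz : p.z 0 = 0) {q : Fin 3} (hq : p.z q = 1) : NC p.rho = 64 := by
  have hq0 : (0 : Fin 3) ≠ q := by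
    rintro rfl
    rw [hz] at hq
    exact absurd hq (by decide)
  obtain ⟨h1, h2⟩ := NC_coord (R := R1b) p.rho_equiv
    (fun w => ((fun i => crd w.1.1 q i, w.1.2.snd, w.1.2.fst) : W1b))
    (fun m => ⟨(mkT q m.1, ⟨m.2.2, m.2.1⟩), mk_good hr hq _⟩) (fun w => by
      simp only [crd_mk]) (by
    rintro w w'
    rw [rho_iff2 hr hq]
    simp only [R1b]
    have e0 : ∀ n : V3, comb n (w'.1.1 0) = (⟨0, n ⬝ᵥ crd w'.1.1 q 0⟩ : p.Z) := by
      intro n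
      have : w'.1.1 0 = fun j => CE.inr (crd w'.1.1 q 0 j) := by
        funext j
        rw [crd, if_neg hq0]
        conv_lhs => rw [sig_eq w'.2 hq 0 j]
        rw [hz, bal_zero, zero_zsmul, add_zero]
      conv_lhs => rw [this]
      rw [comb_inr]
      rfl
    simp only [hz, zero_mul, e0, add_z, add_zero]
    simp only [CE.mk.injEq]
    constructor
    · rintro ⟨h, t, ε, n, y', hε, hM, hγ1, hγ2⟩
      refine ⟨h, ε, t, -n, hε, hM, hγ1.symm, ?_⟩
      rw [neg_dotProduct]
      linear_combination -hγ2
    · rintro ⟨h, ε, t, n, hε, hM, hγ1, hγ2⟩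
      refine ⟨h, t, ε, -n, 0, hε, hM, hγ1.symm, ?_⟩
      rw [neg_dotProduct]
      linear_combination -hγ2)
  rw [h2, NC_R1b h1]

end Par

open Matrix

namespace Quasigroup
theorem iso_symm {Q Q' : Type} {q : Quasigroup Q} {q' : Quasigroup Q'} (h : Iso q q') : Iso q' q := by
  obtain ⟨f, hf⟩ := h
  refine ⟨f.symm, fun x y => ?_⟩
  rw [Equiv.symm_apply_eq, hf, f.apply_symm_apply, f.apply_symm_apply]

theorem iso_trans {Q Q' Q'' : Type} {q : Quasigroup Q} {q' : Quasigroup Q'} {q'' : Quasigroup Q''}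
    (h : Iso q q') (h' : Iso q' q'') : Iso q q'' := by
  obtain ⟨f, hf⟩ := h
  obtain ⟨f', hf'⟩ := h'
  refine ⟨f.trans f', fun x y => ?_⟩
  simp only [Equiv.trans_apply, hf, hf']

theorem medial_iso {Q Q' : Type} {q : Quasigroup Q} {q' : Quasigroup Q'} (h : Iso q q')
    (hm : Medial q') : Medial q := by
  obtain ⟨f, hf⟩ := h
  intro x y u v
  apply f.injective
  simp only [hf]
  exact hm _ _ _ _

theorem trimedial_iso {Q Q' : Type} {q : Quasigroup Q} {q' : Quasigroup Q'} (h : Iso q q')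
    (hm : Trimedial q') : Trimedial q := by
  obtain ⟨f, hf⟩ := h
  have key : ∀ a b c x, x ∈ genSet q a b c → f x ∈ genSet q' (f a) (f b) (f c) := by
    rintro a b c x hx S ⟨⟨s1, s2, s3⟩, ha, hb, hc⟩
    refine hx (f ⁻¹' S) ⟨⟨?_, ?_, ?_⟩, ha, hb, hc⟩
    · intro x hx y hy
      change f _ ∈ S
      rw [hf]
      exact s1 _ hx _ hy
    · intro x hx z hz y h
      exact s2 _ hx _ hz _ (by rw [← hf, h])
    · intro y hy z hz x h
      exact s3 _ hy _ hz _ (by rw [← hf, h])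
  intro a b c x hx y hy u hu v hv
  apply f.injective
  simp only [hf]
  exact hm _ _ _ _ (key _ _ _ _ hx) _ (key _ _ _ _ hy) _ (key _ _ _ _ hu) _ (key _ _ _ _ hv)

theorem exists_transport {Q Q' : Type} (q : Quasigroup Q) (e : Q ≃ Q') :
    ∃ q' : Quasigroup Q', Iso q q' := by
  refine ⟨⟨fun x y => e (q.mul (e.symm x) (e.symm y)), fun x => ?_, fun x => ?_⟩, e, fun x y => by simp⟩
  · exact e.bijective.comp ((q.leftBij _).comp e.symm.bijective)
  · exact e.bijective.comp ((q.rightBij _).comp e.symm.bijective)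
end Quasigroup

abbrev Tot := Σ i : Idx, (par i).XX
def grel (x y : Tot) : Prop := QRep.LIso ((par x.1).mdl x.2) ((par y.1).mdl y.2)

theorem grel_equiv : Equivalence grel :=
  ⟨fun _ => Par.liso_refl _, fun h => Par.liso_symm h, fun h h' => Par.liso_trans h h'⟩

instance (p : Par) : Finite p.Z := Finite.of_equiv _ CE.toProd.symm

theorem grel_idx (x y : Tot) (h : grel x y) : x.1 = y.1 := by
  obtain ⟨θ, d, t, ε, g, y, n, y', hd, hε, hg, hr, hz, -⟩ := Par.cross _ _ h
  exact par_inj _ _ hd hε hr hz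

theorem nrm_sum : ∑ z : {z : V3 // Nrm z}, (if z.1 0 = 1 then 35 else 64) = 571 := by
  decide +kernel

theorem NC_grel : NC grel = 17004 := by
  rw [NC_sigma grel_equiv grel_idx]
  have e : ∀ i : Idx, (NC fun y y' : (par i).XX => grel ⟨i, y⟩ ⟨i, y'⟩) =
      Sum.elim (fun _ => 35) (Sum.elim (fun _ => 16328) fun z => if z.1 0 = 1 then 35 else 64) i := by
    rintro (i | i | z)
    · exact Par.count_I (p := par (.inl i)) rfl (rI_ne i)
    · exact Par.count_IIa (p := par (.inr (.inl i))) rfl rfl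
    · change _ = if z.1 0 = 1 then 35 else 64
      split_ifs with h
      · exact Par.count_IIb1 (p := par (.inr (.inr z))) rfl h
      · rcases z.2 with h0 | ⟨h0, h1 | ⟨-, h1⟩⟩
        · exact absurd h0 h
        · exact Par.count_IIb2 (p := par (.inr (.inr z))) rfl h0 (q := 1) h1
        · exact Par.count_IIb2 (p := par (.inr (.inr z))) rfl h0 (q := 2) h1
  rw [Finset.sum_congr rfl fun i _ => e i, Fintype.sum_sum_type, Fintype.sum_sum_type]
  simp only [Sum.elim_inl, Sum.elim_inr]
  rw [nrm_sum]
  simp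

open Quasigroup in
/-- Up to isomorphism, there are exactly 17004 trimedial quasigroups of order 243
that are not medial. -/
theorem stmt :
    ∃ reps : Fin 17004 → Quasigroup (Fin 243),
      (∀ i, (Trimedial (reps i)) ∧ ¬ Medial (reps i)) ∧
      (∀ i j, i ≠ j → ¬ Iso (reps i) (reps j)) ∧
      (∀ (Q : Type) (q : Quasigroup Q), Nat.card Q = 243 →
        (Trimedial q) → ¬ Medial q → ∃ i, Iso q (reps i)) := by
  have hc : Nat.card (Quot grel) = 17004 := NC_grel
  have hfin : Finite (Quot grel) := Nat.finite_of_card_ne_zero (by rw [hc]; norm_num)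
  have E : Quot grel ≃ Fin 17004 := Finite.equivFinOfCardEq hc
  have hrep : ∀ i : Fin 17004, ∃ q' : Quasigroup (Fin 243),
      Iso ((par (E.symm i).out.1).mdl (E.symm i).out.2).toQ q' := by
    intro i
    have R := (par (E.symm i).out.1).mdl (E.symm i).out.2
    have := R.fin
    exact exists_transport _ (Finite.equivFinOfCardEq R.card)
  choose reps hreps using hrep
  refine ⟨reps, fun i => ⟨trimedial_iso (iso_symm (hreps i)) (QRep.trimedial _),
    fun h => QRep.not_medial _ (medial_iso (hreps i) h)⟩, fun i j hij h => hij ?_, ?_⟩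
  · have h1 := QRep.LIso.of_iso (iso_trans (hreps i) (iso_trans h (iso_symm (hreps j))))
    have h2 : grel (E.symm i).out (E.symm j).out := h1
    have h3 := Quot.sound h2
    rw [Quot.out_eq, Quot.out_eq] at h3
    exact E.symm.injective h3
  · intro Q q hq ht hm
    obtain ⟨_, R, hR⟩ := exists_rep q hq ht hm
    obtain ⟨i, T, γ, hT, hl⟩ := exists_model R
    let x : Tot := ⟨i, ⟨(T, γ), hT⟩⟩
    refine ⟨E (Quot.mk _ x), ?_⟩
    have e1 : Iso q R.toQ := ⟨Equiv.refl _, fun a b => (hR a b).symm⟩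
    have e2 : grel x (E.symm (E (Quot.mk _ x))).out := by
      refine (quot_eq_iff grel_equiv).1 ?_
      rw [Quot.out_eq, E.symm_apply_apply]
    exact iso_trans e1 (iso_trans (iso_symm hl.iso) (iso_trans (QRep.LIso.iso e2) (hreps _)))
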